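/- arXiv:2102.06886 — 4 statements merged into one kernel-verified Lean document; each statement's English description precedes it below -/
import Mathlib

section
/- (Gale's envy-free division theorem.) Let r ≥ 1 and let A : Fin r → Fin r → Set Δ^{r-1} be an old-style preference matrix that is closed and covering. Assume that no player prefers a degenerate tile, i.e., for all i, j and all z ∈ A i j one has z i ≠ 0. Then there exists a permutation σ ∈ Equiv.Perm (Fin r) such that ⋂ j, A (σ j) j is nonempty; that is, there is a single cut z in which every player j prefers the tile σ j, with distinct players receiving distinct tiles. -/
section Scarf

variable {I T α : Type*} [LinearOrder α]

/-- A finite set is dominant for a family of orders if no point lies, in every order at once,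
strictly above the minimum of the set. -/
def Dominant (f : I → T → α) (σ : Finset T) : Prop :=
  ∀ t, ∃ i, ∀ s ∈ σ, f i t ≤ f i s

theorem Dominant.mono {f : I → T → α} {σ τ : Finset T} (h : Dominant f σ) (hτ : τ ⊆ σ) :
    Dominant f τ := fun t => (h t).imp fun _ hi s hs => hi s (hτ hs)

/-- The points strictly above `m` in every order but the `d`-th. -/
def AboveExcept (f : I → T → α) (m : I → T) (d : I) (y : T) : Prop :=
  ∀ i, i ≠ d → f i (m i) < f i y

/-- `y` is the largest point, in the `d`-th order, among those of `AboveExcept f m d`. -/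
def IsTopExcept (f : I → T → α) (m : I → T) (d : I) (y : T) : Prop :=
  AboveExcept f m d y ∧ ∀ t, AboveExcept f m d t → f d t ≤ f d y

theorem exists_isTopExcept [Finite T] {f : I → T → α} {m : I → T} {d : I} {y : T}
    (hy : AboveExcept f m d y) : ∃ z, IsTopExcept f m d z := by
  obtain ⟨z, hz, hmax⟩ := Set.exists_max_image {t | AboveExcept f m d t} (f d)
    (Set.toFinite _) ⟨y, hy⟩
  exact ⟨z, hz, hmax⟩

theorem IsTopExcept.unique {f : I → T → α} (hf : ∀ i, Function.Injective (f i)) {m : I → T}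
    {d : I} {y z : T} (hy : IsTopExcept f m d y) (hz : IsTopExcept f m d z) : y = z :=
  hf d (le_antisymm (hz.2 y hy.1) (hy.2 z hz.1))

theorem Dominant.insert_of_isTopExcept [DecidableEq T] {f : I → T → α} {τ : Finset T}
    (hdom : Dominant f τ) {m : I → T} (hm : ∀ i, ∀ s ∈ τ, f i (m i) ≤ f i s)
    {d : I} {y : T} (hy : IsTopExcept f m d y) (hmem : ∀ i, m i ∈ τ) :
    Dominant f (insert y τ) := by
  intro t
  by_cases ht : AboveExcept f m d t
  · refine ⟨d, ?_⟩
    obtain ⟨i, hi⟩ := hdom t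
    have hid : i = d := by
      by_contra hne
      exact absurd (hi _ (hmem i)) (not_le.2 (ht i hne))
    subst hid
    intro s hs
    rcases Finset.mem_insert.1 hs with rfl | hs
    · exact hy.2 t ht
    · exact hi s hs
  · simp only [AboveExcept, not_forall, not_lt] at ht
    obtain ⟨i, hne, hi⟩ := ht
    refine ⟨i, fun s hs => ?_⟩
    rcases Finset.mem_insert.1 hs with rfl | hs
    · exact hi.trans (hy.1 i hne).le
    · exact hi.trans (hm i s hs)

/-- A nonempty dominant set with one element less than there are orders has two distinguished
orders, and its dominant one-point extensions are exactly the top points relative to these. -/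
theorem Dominant.exists_extension_pair [Fintype I] [DecidableEq I] [DecidableEq T]
    {f : I → T → α}
    (hf : ∀ i, Function.Injective (f i)) {τ : Finset T} (hne : τ.Nonempty)
    (hcard : τ.card + 1 = Fintype.card I) (hdom : Dominant f τ) :
    ∃ (m : I → T) (a b : I), (∀ i, m i ∈ τ) ∧ (∀ i, ∀ s ∈ τ, f i (m i) ≤ f i s) ∧
      a ≠ b ∧ m a = m b ∧ (∀ i j, m i = m j → i ≠ j → i = a ∨ i = b) ∧
      (∀ y, ¬ (IsTopExcept f m a y ∧ IsTopExcept f m b y)) ∧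
      ∀ y, (y ∉ τ ∧ Dominant f (insert y τ)) ↔ (IsTopExcept f m a y ∨ IsTopExcept f m b y) := by
  choose m hmem hm using fun i => Finset.exists_min_image τ (f i) hne
  have hsurj : ∀ s ∈ τ, ∃ i, m i = s := fun s hs => by
    obtain ⟨i, hi⟩ := hdom s
    exact ⟨i, hf i (le_antisymm (hm i s hs) (hi _ (hmem i)))⟩
  obtain ⟨a, -, b, -, hab, hmab⟩ := Finset.exists_ne_map_eq_of_card_lt_of_maps_to
    (s := Finset.univ) (t := τ) (f := m) (by rw [Finset.card_univ]; omega) (fun i _ => hmem i)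
  -- a set of orders whose minima exhaust `τ`, and which omits `d`, is the complement of `d`
  have key : ∀ (G : Finset I) (d : I), d ∉ G → (∀ s ∈ τ, ∃ i ∈ G, m i = s) →
      G = Finset.univ.erase d ∧ Set.InjOn m G := by
    intro G d hd hG
    have himg : τ ⊆ G.image m := fun s hs => by
      obtain ⟨i, hi, rfl⟩ := hG s hs
      exact Finset.mem_image_of_mem _ hi
    have h1 := Finset.card_le_card himg
    have h2 : (Finset.univ.erase d).card = Fintype.card I - 1 := by
      rw [Finset.card_erase_of_mem (Finset.mem_univ d), Finset.card_univ]
    have h3 : G ⊆ Finset.univ.erase d := fun i hi => by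
      simp only [Finset.mem_erase, Finset.mem_univ, and_true]
      rintro rfl
      exact hd hi
    have h4 : (G.image m).card ≤ G.card := Finset.card_image_le
    have h5 := Finset.card_le_card h3
    refine ⟨Finset.eq_of_subset_of_card_le h3 (by omega), ?_⟩
    exact Finset.card_image_iff.1 (by omega)
  have hpair : ∀ d, Set.InjOn m (Finset.univ.erase d : Finset I) → d = a ∨ d = b := by
    intro d hd
    by_contra! h
    exact hab (hd (by simp [h.1.symm]) (by simp [h.2.symm]) hmab)
  have hother : ∀ d, d = a ∨ d = b → ∃ d', d' ≠ d ∧ m d' = m d := by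
    rintro d (rfl | rfl)
    · exact ⟨b, hab.symm, hmab.symm⟩
    · exact ⟨a, hab, hmab⟩
  have hsurj' : ∀ d, d = a ∨ d = b → ∀ s ∈ τ, ∃ i, i ≠ d ∧ m i = s := by
    intro d hd s hs
    obtain ⟨i, rfl⟩ := hsurj s hs
    by_cases hi : i = d
    · subst hi
      exact hother i hd
    · exact ⟨i, hi, rfl⟩
  refine ⟨m, a, b, hmem, hm, hab, hmab, ?_, ?_, ?_⟩
  · intro i j hij hne'
    refine hpair i (key _ i (by simp) fun s hs => ?_).2
    obtain ⟨k, rfl⟩ := hsurj s hs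
    by_cases hk : k = i
    · exact ⟨j, by simp [hne'.symm], by rw [hk, hij]⟩
    · exact ⟨k, by simp [hk], rfl⟩
  · rintro y ⟨⟨ha, -⟩, hb, -⟩
    obtain ⟨i, hi⟩ := hdom y
    refine absurd (hi _ (hmem i)) (not_le.2 ?_)
    by_cases h : i = a
    · exact hb i (h ▸ hab)
    · exact ha i h
  · intro y
    constructor
    · rintro ⟨hy, hins⟩
      obtain ⟨d, hd⟩ := hins y
      have hG := key {i | f i (m i) ≤ f i y} d
        (by
          simp only [Finset.mem_filter, Finset.mem_univ, true_and, not_le]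
          refine lt_of_le_of_ne (hd _ (Finset.mem_insert_of_mem (hmem d))) fun h => hy ?_
          rw [hf d h]
          exact hmem d)
        (by
          intro s hs
          obtain ⟨i, hi⟩ := hins s
          have : m i = s := hf i (le_antisymm (hm i s hs)
            (hi _ (Finset.mem_insert_of_mem (hmem i))))
          refine ⟨i, ?_, this⟩
          simp only [Finset.mem_filter, Finset.mem_univ, true_and, this]
          exact hi y (Finset.mem_insert_self _ _))
      have hd' := hpair d (hG.1 ▸ hG.2)
      have htop : IsTopExcept f m d y := by
        constructor
        · intro i hi
          have : i ∈ ({i | f i (m i) ≤ f i y} : Finset I) := by rw [hG.1]; simp [hi]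
          refine lt_of_le_of_ne (by simpa using this) fun h => hy ?_
          rw [← hf i h]
          exact hmem i
        · intro t ht
          obtain ⟨i, hi⟩ := hins t
          have hid : i = d := by
            by_contra hne
            exact absurd (hi _ (Finset.mem_insert_of_mem (hmem i))) (not_le.2 (ht i hne))
          exact hid ▸ hi y (Finset.mem_insert_self _ _)
      rcases hd' with rfl | rfl
      · exact Or.inl htop
      · exact Or.inr htop
    · have main : ∀ d, d = a ∨ d = b → IsTopExcept f m d y → y ∉ τ ∧ Dominant f (insert y τ) := by
        intro d hd hy
        refine ⟨fun hyτ => ?_, hdom.insert_of_isTopExcept hm hy hmem⟩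
        obtain ⟨i, hi, rfl⟩ := hsurj' d hd y hyτ
        exact lt_irrefl _ (hy.1 i hi)
      rintro (h | h)
      · exact main a (Or.inl rfl) h
      · exact main b (Or.inr rfl) h

section Slack

variable [Fintype I] [DecidableEq I] [DecidableEq T] {f : I → T → α}
  {e : I → T} {c : T → I} {i₀ : I} {τ : Finset T}

theorem subset_image_slack_erase
    (hmin : ∀ i t, f i (e i) ≤ f i t)
    (hmax : ∀ t, t ∉ Set.range e → ∀ i j, i ≠ j → f i t < f i (e j))
    (hf : ∀ i, Function.Injective (f i)) (hinj : Function.Injective e)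
    {i d : I} (hid : i ≠ d) (h : ∀ s ∈ τ, f i (e d) ≤ f i s) :
    τ ⊆ (Finset.univ.erase i).image e := by
  intro s hs
  have hr : s ∈ Set.range e := by
    by_contra hr
    exact absurd (h s hs) (not_le.2 (hmax s hr i d hid))
  obtain ⟨k, rfl⟩ := hr
  refine Finset.mem_image_of_mem _ (Finset.mem_erase.2 ⟨?_, Finset.mem_univ _⟩)
  rintro rfl
  exact hid (hinj (hf k (le_antisymm (hmin k _) (h _ hs))))

/-- If the points `e i` are slack points, then a nonempty dominant set of the right size whose
colours are all but `i₀` has exactly two dominant one-point extensions, unless it consists of slack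
points only, in which case it has exactly one. -/
theorem Dominant.card_extensions [Finite T]
    (hf : ∀ i, Function.Injective (f i)) (hc : ∀ i, c (e i) = i)
    (hmin : ∀ i t, f i (e i) ≤ f i t)
    (hmax : ∀ t, t ∉ Set.range e → ∀ i j, i ≠ j → f i t < f i (e j))
    (hI : 1 < Fintype.card I) (hdom : Dominant f τ) (hcard : τ.card + 1 = Fintype.card I)
    (hcol : τ.image c = Finset.univ.erase i₀) :
    {y | y ∉ τ ∧ Dominant f (insert y τ)}.ncard =
      if τ = (Finset.univ.erase i₀).image e then 1 else 2 := by
  have hinj : Function.Injective e := fun i j h => by rw [← hc i, h, hc]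
  have hne : τ.Nonempty := Finset.card_pos.1 (by omega)
  obtain ⟨m, a, b, hmem, hm, hab, hmab, honly, hdisj, hext⟩ :=
    hdom.exists_extension_pair hf hne hcard
  have hset : {y | y ∉ τ ∧ Dominant f (insert y τ)} =
      {y | IsTopExcept f m a y ∨ IsTopExcept f m b y} := Set.ext hext
  have htop : ∀ d, e d ∉ τ → ∃ y, IsTopExcept f m d y := by
    intro d hd
    refine exists_isTopExcept (y := e d) fun i hid => ?_
    by_contra! hle
    have hsub := subset_image_slack_erase hmin hmax hf hinj hid
      fun s hs => hle.trans (hm i s hs)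
    have hsub' : τ ⊆ ((Finset.univ.erase i).erase d).image e := by
      intro s hs
      obtain ⟨k, hk, rfl⟩ := Finset.mem_image.1 (hsub hs)
      refine Finset.mem_image_of_mem _ (Finset.mem_erase.2 ⟨?_, hk⟩)
      rintro rfl
      exact hd hs
    have h1 := (Finset.card_le_card hsub').trans Finset.card_image_le
    rw [Finset.card_erase_of_mem (by simp [hid.symm]), Finset.card_erase_of_mem (by simp),
      Finset.card_univ] at h1
    omega
  have hmslack : ∀ d, e d ∈ τ → m d = e d := fun d hd =>
    hf d (le_antisymm (hm d _ hd) (hmin d _))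
  have houter : ∀ d d', d' ≠ d → m d' = m d → e d ∈ τ →
      τ = (Finset.univ.erase i₀).image e := by
    intro d d' hdd hmd hd
    have hsub := subset_image_slack_erase (τ := τ) hmin hmax hf hinj hdd fun s hs => by
      rw [← hmslack d hd, ← hmd]
      exact hm d' s hs
    have heq := Finset.eq_of_subset_of_card_le hsub (by
      refine Finset.card_image_le.trans ?_
      rw [Finset.card_erase_of_mem (by simp), Finset.card_univ]
      omega)
    have : d' = i₀ := by
      by_contra hne
      have : d' ∈ τ.image c := by rw [hcol]; simp [hne]
      rw [heq, Finset.image_image] at this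
      simp [hc] at this
    rw [← this]
    exact heq
  split_ifs with hτ
  · have hi₀ : e i₀ ∉ τ := by
      rw [hτ]
      simp [hinj.eq_iff]
    have hes : ∀ i, i ≠ i₀ → e i ∈ τ := fun i hi => by
      rw [hτ]
      exact Finset.mem_image_of_mem _ (by simp [hi])
    have hempty : ∀ d, d ≠ i₀ → m i₀ = m d → ∀ y, ¬ IsTopExcept f m d y := by
      rintro d hd hmd y ⟨hy, -⟩
      have hy0 := hy i₀ hd.symm
      rw [hmd, hmslack d (hes d hd)] at hy0
      have hr : y ∈ Set.range e := by
        by_contra hr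
        exact lt_asymm hy0 (hmax y hr i₀ d hd.symm)
      obtain ⟨k, rfl⟩ := hr
      by_cases hk : k = i₀
      · subst hk
        exact absurd hy0 (not_lt.2 (hmin k _))
      · by_cases hkd : k = d
        · subst hkd
          exact lt_irrefl _ hy0
        · have := hy k hkd
          rw [hmslack k (hes k hk)] at this
          exact lt_irrefl _ this
    obtain ⟨y, hy⟩ := htop i₀ hi₀
    have hi₀ab : i₀ = a ∨ i₀ = b := by
      by_contra! h
      rw [hmslack a (hes a h.1.symm), hmslack b (hes b h.2.symm)] at hmab
      exact hab (hinj hmab)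
    rw [Set.ncard_eq_one]
    refine ⟨y, ?_⟩
    rw [hset]
    ext z
    simp only [Set.mem_ofPred_eq, Set.mem_singleton_iff]
    rcases hi₀ab with rfl | rfl
    · constructor
      · rintro (h | h)
        · exact h.unique hf hy
        · exact absurd h (hempty b hab.symm hmab z)
      · rintro rfl
        exact Or.inl hy
    · constructor
      · rintro (h | h)
        · exact absurd h (hempty a hab hmab.symm z)
        · exact h.unique hf hy
      · rintro rfl
        exact Or.inr hy
  · obtain ⟨y, hy⟩ := htop a fun h => hτ (houter a b hab.symm hmab.symm h)
    obtain ⟨z, hz⟩ := htop b fun h => hτ (houter b a hab hmab h)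
    rw [Set.ncard_eq_two]
    refine ⟨y, z, ?_, ?_⟩
    · rintro rfl
      exact hdisj y ⟨hy, hz⟩
    · rw [hset]
      ext x
      simp only [Set.mem_ofPred_eq, Set.mem_insert_iff, Set.mem_singleton_iff]
      constructor
      · rintro (h | h)
        · exact Or.inl (h.unique hf hy)
        · exact Or.inr (h.unique hf hz)
      · rintro (rfl | rfl)
        · exact Or.inl hy
        · exact Or.inr hz

theorem even_card_erase_colours {R : Finset T} (hR : R.image c ≠ Finset.univ)
    (hcard : R.card = Fintype.card I) :
    Even (R.filter fun x => (R.erase x).image c = Finset.univ.erase i₀).card := by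
  have hI : 0 < Fintype.card I := Fintype.card_pos_iff.2 ⟨i₀⟩
  rcases (R.filter fun x => (R.erase x).image c = Finset.univ.erase i₀).eq_empty_or_nonempty
    with h | ⟨x, hx⟩
  · simp [h]
  · obtain ⟨hxR, hx⟩ := Finset.mem_filter.1 hx
    have hcx : c x ≠ i₀ := by
      intro h
      apply hR
      rw [← Finset.insert_erase hxR, Finset.image_insert, hx, h,
        Finset.insert_erase (Finset.mem_univ _)]
    have hinj : Set.InjOn c (R.erase x : Finset T) := by
      rw [← Finset.card_image_iff, hx, Finset.card_erase_of_mem hxR,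
        Finset.card_erase_of_mem (Finset.mem_univ _), Finset.card_univ, hcard]
    have : c x ∈ (R.erase x).image c := by rw [hx]; simp [hcx]
    obtain ⟨x', hx', hxx'⟩ := Finset.mem_image.1 this
    obtain ⟨hne, hx'R⟩ := Finset.mem_erase.1 hx'
    have heq : (R.filter fun x => (R.erase x).image c = Finset.univ.erase i₀) = {x, x'} := by
      ext y
      simp only [Finset.mem_filter, Finset.mem_insert, Finset.mem_singleton]
      constructor
      · rintro ⟨hyR, hy⟩
        by_contra! hyx
        have hye : y ∈ R.erase x := Finset.mem_erase.2 ⟨hyx.1, hyR⟩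
        have h1 : c y ∈ (R.erase x).image c := Finset.mem_image_of_mem _ hye
        rw [hx, ← hy] at h1
        obtain ⟨z, hz, hzy⟩ := Finset.mem_image.1 h1
        obtain ⟨hzy', hzR⟩ := Finset.mem_erase.1 hz
        by_cases hzx : z = x
        · subst hzx
          exact hyx.2 (hinj hye hx' (hzy.symm.trans hxx'.symm))
        · exact hzy' (hinj (Finset.mem_coe.2 (Finset.mem_erase.2 ⟨hzx, hzR⟩)) hye hzy)
      · rintro (rfl | rfl)
        · exact ⟨hxR, hx⟩
        · refine ⟨hx'R, ?_⟩
          rw [← hx, ← Finset.insert_erase hx', Finset.image_insert, hxx',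
            ← Finset.image_insert, Finset.erase_right_comm, Finset.insert_erase]
          exact Finset.mem_erase.2 ⟨hne.symm, hxR⟩
    rw [heq, Finset.card_pair hne.symm]
    exact even_two

/-- A Sperner-type lemma for families of linear orders, due to Scarf. -/
theorem exists_dominant_colourful [Fintype T]
    (hf : ∀ i, Function.Injective (f i)) (hc : ∀ i, c (e i) = i)
    (hmin : ∀ i t, f i (e i) ≤ f i t)
    (hmax : ∀ t, t ∉ Set.range e → ∀ i j, i ≠ j → f i t < f i (e j))
    (hI : 1 < Fintype.card I) :
    ∃ R : Finset T, Dominant f R ∧ R.card = Fintype.card I ∧ R.image c = Finset.univ := by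
  classical
  by_contra! hno
  have hinj : Function.Injective e := fun i j h => by rw [← hc i, h, hc]
  obtain ⟨i₀⟩ : Nonempty I := Fintype.card_pos_iff.1 (by omega)
  let doors : Finset (Finset T) := {τ | Dominant f τ ∧ τ.card + 1 = Fintype.card I ∧
    τ.image c = Finset.univ.erase i₀}
  let rooms : Finset (Finset T) := {R | Dominant f R ∧ R.card = Fintype.card I}
  have hcount := Finset.sum_card_bipartiteAbove_eq_sum_card_bipartiteBelow
    (s := doors) (t := rooms) (fun τ R => τ ⊆ R)
  have hrooms : ∀ R ∈ rooms, Even (doors.bipartiteBelow (fun τ R => τ ⊆ R) R).card := by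
    intro R hR
    obtain ⟨hRd, hRc⟩ : Dominant f R ∧ R.card = Fintype.card I := by simpa [rooms] using hR
    have heq : doors.bipartiteBelow (fun τ R => τ ⊆ R) R =
        (R.filter fun x => (R.erase x).image c = Finset.univ.erase i₀).image R.erase := by
      ext τ
      simp only [Finset.mem_bipartiteBelow, Finset.mem_image, Finset.mem_filter, doors,
        Finset.mem_univ, true_and]
      constructor
      · rintro ⟨⟨-, hτc, hτ⟩, hsub⟩
        obtain ⟨x, hx, rfl⟩ := Finset.exists_eq_insert_iff.2 ⟨hsub, by omega⟩
        exact ⟨x, ⟨Finset.mem_insert_self _ _, by rwa [Finset.erase_insert hx]⟩,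
          Finset.erase_insert hx⟩
      · rintro ⟨x, ⟨hx, hxc⟩, rfl⟩
        exact ⟨⟨hRd.mono (Finset.erase_subset _ _), by
          rw [Finset.card_erase_add_one hx, hRc], hxc⟩, Finset.erase_subset _ _⟩
    rw [heq, Finset.card_image_of_injOn]
    · exact even_card_erase_colours (hno R hRd hRc) hRc
    · exact (Finset.erase_injOn R).mono (Finset.coe_subset.2 (Finset.filter_subset _ _))
  have hdoors : ∀ τ ∈ doors, (rooms.bipartiteAbove (fun τ R => τ ⊆ R) τ).card =
      if τ = (Finset.univ.erase i₀).image e then 1 else 2 := by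
    intro τ hτ
    obtain ⟨hτd, hτc, hτi⟩ : Dominant f τ ∧ τ.card + 1 = Fintype.card I ∧
      τ.image c = Finset.univ.erase i₀ := by simpa [doors] using hτ
    rw [← hτd.card_extensions hf hc hmin hmax hI hτc hτi, ← Set.ncard_coe_finset]
    have heq : (rooms.bipartiteAbove (fun τ R => τ ⊆ R) τ : Set (Finset T)) =
        (fun y => insert y τ) '' {y | y ∉ τ ∧ Dominant f (insert y τ)} := by
      ext R
      simp only [Finset.mem_coe, Finset.mem_bipartiteAbove, Set.mem_image, Set.mem_ofPred_eq,
        rooms, Finset.mem_filter, Finset.mem_univ, true_and]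
      constructor
      · rintro ⟨⟨hRd, hRc⟩, hsub⟩
        obtain ⟨x, hx, rfl⟩ := Finset.exists_eq_insert_iff.2 ⟨hsub, by omega⟩
        exact ⟨x, ⟨hx, hRd⟩, rfl⟩
      · rintro ⟨x, ⟨hx, hxd⟩, rfl⟩
        exact ⟨⟨hxd, by rw [Finset.card_insert_of_notMem hx, hτc]⟩, Finset.subset_insert _ _⟩
    rw [heq, Set.InjOn.ncard_image]
    rintro x ⟨hx, -⟩ y ⟨-, -⟩ hxy
    exact (Finset.insert_inj hx).1 hxy
  have houter : (Finset.univ.erase i₀).image e ∈ doors := by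
    simp only [doors, Finset.mem_filter, Finset.mem_univ, true_and]
    refine ⟨fun t => ?_, ?_, ?_⟩
    · by_cases ht : t ∈ Set.range e
      · obtain ⟨k, rfl⟩ := ht
        exact ⟨k, fun s _ => hmin k s⟩
      · refine ⟨i₀, fun s hs => ?_⟩
        obtain ⟨j, hj, rfl⟩ := Finset.mem_image.1 hs
        exact (hmax t ht i₀ j (Finset.ne_of_mem_erase hj).symm).le
    · rw [Finset.card_image_of_injective _ hinj, Finset.card_erase_add_one (Finset.mem_univ _),
        Finset.card_univ]
    · rw [Finset.image_image]
      simp [Function.comp_def, hc]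
  rw [Finset.sum_congr rfl hdoors, ← Finset.add_sum_erase _ _ houter, if_pos rfl] at hcount
  have h1 : Even (∑ τ ∈ doors.erase ((Finset.univ.erase i₀).image e),
      if τ = (Finset.univ.erase i₀).image e then 1 else 2) := by
    refine Finset.even_sum _ fun τ hτ => ?_
    rw [if_neg (Finset.ne_of_mem_erase hτ)]
    exact even_two
  have h2 := hcount ▸ Finset.even_sum _ hrooms
  rw [Nat.even_add] at h2
  exact Nat.not_even_one (h2.2 h1)

end Slack

end Scarf

section Grid

variable {I : Type*} [Fintype I] [DecidableEq I]

/-- A discrete form of the dual Knaster-Kuratowski-Mazurkiewicz lemma: for any colouring of the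
integer points of a dilated simplex there is a point `p` such that every colour `i` occurs near `p`,
except possibly when the `i`-th coordinate of `p` is small. -/
theorem exists_near_all_colours (hI : 1 < Fintype.card I) (N : ℕ)
    (c : {k : I → ℕ // ∑ i, k i = N} → I) :
    ∃ p : {k : I → ℕ // ∑ i, k i = N}, ∀ i, p.1 i < Fintype.card I ∨
      ∃ s, c s = i ∧ ∀ j, s.1 j < p.1 j + Fintype.card I ∧ p.1 j < s.1 j + Fintype.card I := by
  obtain ⟨i₀⟩ : Nonempty I := Fintype.card_pos_iff.1 (by omega)
  let G := {k : I → ℕ // ∑ i, k i = N}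
  have hle : ∀ (g : G) (i : I), g.1 i ≤ N := fun g i =>
    (Finset.single_le_sum (f := g.1) (fun _ _ => Nat.zero_le _) (Finset.mem_univ i)).trans_eq g.2
  have : Finite G := Finite.of_injective
    (fun (g : G) (i : I) => (⟨g.1 i, Nat.lt_succ_of_le (hle g i)⟩ : Fin (N + 1))) fun g g' h => by
      ext i
      simpa using congrFun h i
  have : Fintype G := Fintype.ofFinite G
  have : DecidableEq G := Classical.decEq G
  let idx : G ⊕ I → ℕ := fun t => Fintype.equivFin (G ⊕ I) t
  have hidx : Function.Injective idx := Fin.val_injective.comp (Fintype.equivFin (G ⊕ I)).injective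
  let h : I → G ⊕ I → ℕ := fun i =>
    Sum.elim (fun g => g.1 i + 1) (fun j => if i = j then 0 else N + 2)
  let f : I → G ⊕ I → ℕ ×ₗ ℕ := fun i t => toLex (h i t, idx t)
  have hlt : ∀ {i t t'}, h i t < h i t' → f i t < f i t' := fun hh =>
    Prod.Lex.toLex_lt_toLex.2 (Or.inl hh)
  have hle' : ∀ {i t t'}, f i t ≤ f i t' → h i t ≤ h i t' := fun hh => by
    by_contra! hcon
    exact absurd hh (not_le.2 (hlt hcon))
  obtain ⟨R, hdom, hcard, hcol⟩ := exists_dominant_colourful (f := f) (e := Sum.inr)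
    (c := Sum.elim c id)
    (fun i t t' htt => hidx (congrArg (fun x => (ofLex x).2) htt))
    (fun i => rfl)
    (fun i t => by
      by_cases hti : t = Sum.inr i
      · rw [hti]
      · refine (hlt ?_).le
        rcases t with g | j
        · simp [h]
        · have : i ≠ j := fun hij => hti (by rw [hij])
          simp [h, this])
    (fun t ht i j hij => hlt (by
      rcases t with g | k
      · have := hle g i
        simp only [h, Sum.elim_inl, Sum.elim_inr, if_neg hij]
        omega
      · exact absurd ⟨k, rfl⟩ ht))
    hI
  -- the orders available for a grid point are those whose slack point is not in `R`
  have hgrid : ∀ g : G, ∃ i, Sum.inr i ∉ R ∧ ∀ s ∈ R, g.1 i + 1 ≤ h i s := by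
    intro g
    obtain ⟨i, hi⟩ := hdom (Sum.inl g)
    refine ⟨i, fun hiR => ?_, fun s hs => hle' (hi s hs)⟩
    have := hle' (hi _ hiR)
    simp [h] at this
  obtain ⟨p, hp⟩ : ∃ p : G, Sum.inl p ∈ R := by
    by_contra! hno
    have hsub : R ⊆ Finset.univ.image Sum.inr := by
      rintro (g | i) hx
      · exact absurd hx (hno g)
      · simp
    have heq := Finset.eq_of_subset_of_card_le hsub
      (Finset.card_image_le.trans (by rw [hcard, Finset.card_univ]))
    obtain ⟨i, hi, -⟩ := hgrid ⟨Pi.single i₀ N, by simp⟩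
    rw [heq] at hi
    simp at hi
  choose m hm hmin using fun i => Finset.exists_min_image R (h i) ⟨_, hp⟩
  have hq : ∀ g, Sum.inl g ∈ R → ∀ i, h i (m i) - 1 ≤ g.1 i := by
    intro g hg i
    have := hmin i _ hg
    simp only [h, Sum.elim_inl] at this ⊢
    omega
  have hsum : N < ∑ i, (h i (m i) - 1) + Fintype.card I := by
    by_contra! hle
    have hsum1 : ∑ i, (h i (m i) - 1 + 1) = ∑ i, (h i (m i) - 1) + Fintype.card I := by
      rw [Finset.sum_add_distrib]
      simp
    obtain ⟨i, hi, hi'⟩ := hgrid ⟨fun i => (h i (m i) - 1 + 1) +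
      (Pi.single i₀ (N - (∑ i, (h i (m i) - 1) + Fintype.card I)) : I → ℕ) i, by
        rw [Finset.sum_add_distrib, hsum1]
        simp
        omega⟩
    have := hi' _ (hm i)
    simp only at this
    omega
  have hclose : ∀ g, Sum.inl g ∈ R → ∀ i, g.1 i < h i (m i) - 1 + Fintype.card I := by
    intro g hg i
    have h1 : ∑ j, (g.1 j - (h j (m j) - 1)) + ∑ j, (h j (m j) - 1) = N := by
      rw [← Finset.sum_add_distrib]
      exact (Finset.sum_congr rfl fun j _ => Nat.sub_add_cancel (hq g hg j)).trans g.2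
    have h2 := Finset.single_le_sum (f := fun j => g.1 j - (h j (m j) - 1))
      (fun _ _ => Nat.zero_le _) (Finset.mem_univ i)
    omega
  refine ⟨p, fun i => ?_⟩
  by_cases hi : Sum.inr i ∈ R
  · left
    have h1 := hclose p hp i
    have h2 : h i (m i) = 0 := by
      have := hmin i _ hi
      simpa [h] using this
    omega
  · right
    have : i ∈ R.image (Sum.elim c id) := by rw [hcol]; exact Finset.mem_univ i
    obtain ⟨s | j, hs, hsi⟩ := Finset.mem_image.1 this
    · refine ⟨s, hsi, fun j => ⟨?_, ?_⟩⟩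
      · exact (hclose s hs j).trans_le (Nat.add_le_add_right (hq p hp j) _)
      · exact (hclose p hp j).trans_le (Nat.add_le_add_right (hq s hs j) _)
    · have : j = i := hsi
      exact absurd (this ▸ hs) hi

end Grid

theorem exists_limit_of_compactSpace {X : Type*} [PseudoMetricSpace X] [CompactSpace X]
    (x : ℕ → X) : ∃ z, ∀ ε > 0, ∃ m : ℕ, 1 / ((m : ℝ) + 1) < ε ∧ dist (x m) z < ε := by
  obtain ⟨z, φ, hφ, hz⟩ := CompactSpace.tendsto_subseq x
  refine ⟨z, fun ε hε => ?_⟩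
  have h1 := (tendsto_one_div_add_atTop_nhds_zero_nat (𝕜 := ℝ)).comp hφ.tendsto_atTop
  obtain ⟨k, hk, hk'⟩ := ((h1.eventually_lt_const hε).and (Metric.tendsto_nhds.1 hz ε hε)).exists
  exact ⟨φ k, hk, hk'⟩

/-- The dual Knaster-Kuratowski-Mazurkiewicz lemma. -/
theorem stdSimplex.exists_mem_all_of_dual_kkm {I : Type*} [Fintype I] [DecidableEq I]
    (hI : 1 < Fintype.card I) (B : I → Set (stdSimplex ℝ I)) (hB : ∀ i, IsClosed (B i))
    (hcov : ∀ z, ∃ i, z ∈ B i) (hface : ∀ i (z : stdSimplex ℝ I), z.1 i = 0 → z ∈ B i) :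
    ∃ z, ∀ i, z ∈ B i := by
  have happrox : ∀ m : ℕ, ∃ p : stdSimplex ℝ I, ∀ i, p.1 i < 1 / ((m : ℝ) + 1) ∨
      ∃ s ∈ B i, dist s p < 1 / ((m : ℝ) + 1) := by
    intro m
    have hn : (0 : ℝ) < Fintype.card I := by exact_mod_cast (by omega : 0 < Fintype.card I)
    have hm : (0 : ℝ) < (m : ℝ) + 1 := by positivity
    let emb : {k : I → ℕ // ∑ i, k i = (m + 1) * Fintype.card I} → stdSimplex ℝ I := fun k =>
      ⟨fun i => k.1 i / (((m : ℝ) + 1) * Fintype.card I), fun i => by positivity, by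
        rw [← Finset.sum_div, ← Nat.cast_sum, k.2]
        push_cast
        exact div_self (by positivity)⟩
    choose c hc using fun k => hcov (emb k)
    obtain ⟨p, hp⟩ := exists_near_all_colours hI _ c
    have hscale : 1 / ((m : ℝ) + 1) = Fintype.card I / (((m : ℝ) + 1) * Fintype.card I) := by
      field_simp
    refine ⟨emb p, fun i => (hp i).imp (fun h => ?_) ?_⟩
    · rw [hscale]
      exact div_lt_div_of_pos_right (by exact_mod_cast h) (by positivity)
    · rintro ⟨s, rfl, hs⟩
      refine ⟨emb s, hc s, ?_⟩
      rw [Subtype.dist_eq, dist_pi_lt_iff (by positivity)]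
      intro j
      obtain ⟨h1, h2⟩ := hs j
      have h1' : (s.1 j : ℝ) < p.1 j + Fintype.card I := by exact_mod_cast h1
      have h2' : (p.1 j : ℝ) < s.1 j + Fintype.card I := by exact_mod_cast h2
      rw [Real.dist_eq, hscale]
      simp only [emb]
      rw [← sub_div, abs_div, abs_of_pos (by positivity : (0 : ℝ) < ((m : ℝ) + 1) * Fintype.card I)]
      exact div_lt_div_of_pos_right (abs_lt.2 ⟨by linarith, by linarith⟩) (by positivity)
  choose x hx using happrox
  obtain ⟨z, hz⟩ := exists_limit_of_compactSpace x
  refine ⟨z, fun i => ?_⟩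
  by_contra hzi
  have hpos : 0 < z.1 i := lt_of_le_of_ne (z.2.1 i) fun h => hzi (hface i z h.symm)
  obtain ⟨ε, hε, hball⟩ := Metric.isOpen_iff.1 (hB i).isOpen_compl z hzi
  obtain ⟨m, hm, hmz⟩ := hz (min (ε / 2) (z.1 i / 2)) (by positivity)
  obtain ⟨hm1, hm2⟩ := lt_min_iff.1 hm
  obtain ⟨hmz1, hmz2⟩ := lt_min_iff.1 hmz
  rcases hx m i with h | ⟨s, hs, hsx⟩
  · have h1 : dist ((x m).1 i) (z.1 i) < z.1 i / 2 :=
      (dist_le_pi_dist (x m).1 z.1 i).trans_lt hmz2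
    rw [Real.dist_eq, abs_lt] at h1
    linarith
  · refine hball ?_ hs
    rw [Metric.mem_ball]
    linarith [dist_triangle s (x m) z]

theorem exists_perm_forall_pos_of_mem_doublyStochastic {I : Type*} [Fintype I] [DecidableEq I]
    {M : Matrix I I ℝ} (hM : M ∈ doublyStochastic ℝ I) :
    ∃ σ : Equiv.Perm I, ∀ j, 0 < M (σ j) j := by
  obtain ⟨w, hw, hw1, rfl⟩ := exists_eq_sum_perm_of_mem_doublyStochastic hM
  obtain ⟨σ, hσ⟩ : ∃ σ, 0 < w σ := by
    by_contra! h
    have : ∑ σ, w σ ≤ 0 := Finset.sum_nonpos fun σ _ => h σ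
    linarith
  refine ⟨σ⁻¹, fun j => ?_⟩
  rw [Matrix.sum_apply]
  refine Finset.sum_pos' (fun τ _ => ?_) ⟨σ, Finset.mem_univ _, ?_⟩
  · rw [Matrix.smul_apply, smul_eq_mul]
    refine mul_nonneg (hw τ) ?_
    rw [Equiv.Perm.permMatrix, PEquiv.toMatrix_apply]
    split_ifs <;> simp
  · simpa [Equiv.Perm.permMatrix, PEquiv.toMatrix_apply] using hσ

/-- Approximate envy-free division: for closed covering preferences avoiding degenerate tiles
there is a cut at which each player almost prefers the tile assigned to her. -/
theorem exists_perm_forall_mem_thickening {I : Type*} [Fintype I] [DecidableEq I]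
    (hI : 1 < Fintype.card I) (A : I → I → Set (stdSimplex ℝ I))
    (hcov : ∀ j, (⋃ i, A i j) = Set.univ)
    (hnondeg : ∀ i j, ∀ z ∈ A i j, z.1 i ≠ 0) {ε : ℝ} (hε : 0 < ε) :
    ∃ (z : stdSimplex ℝ I) (σ : Equiv.Perm I), ∀ j, z ∈ Metric.thickening ε (A (σ j) j) := by
  let g : I → I → stdSimplex ℝ I → ℝ := fun i j z => z.1 i * (thickenedIndicator hε (A i j) z : ℝ)
  have hg0 : ∀ i j z, 0 ≤ g i j z := fun i j z => mul_nonneg (z.2.1 i) (NNReal.coe_nonneg _)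
  have hgc : ∀ i j, Continuous (g i j) := fun i j =>
    ((continuous_apply i).comp continuous_subtype_val).mul
      (NNReal.continuous_coe.comp (thickenedIndicator hε (A i j)).continuous)
  have hsum : ∀ j z, 0 < ∑ i, g i j z := by
    intro j z
    obtain ⟨i, hi⟩ := Set.mem_iUnion.1 (hcov j ▸ Set.mem_univ z)
    refine Finset.sum_pos' (fun i _ => hg0 i j z) ⟨i, Finset.mem_univ i, ?_⟩
    simp only [g, thickenedIndicator_one hε _ hi, NNReal.coe_one, mul_one]
    exact lt_of_le_of_ne (z.2.1 i) (hnondeg i j z hi).symm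
  let M : stdSimplex ℝ I → Matrix I I ℝ := fun z i j => g i j z / ∑ k, g k j z
  have hM0 : ∀ z i j, 0 ≤ M z i j := fun z i j => div_nonneg (hg0 i j z) (hsum j z).le
  have hMcol : ∀ z j, ∑ i, M z i j = 1 := fun z j => by
    simp only [M]
    rw [← Finset.sum_div, div_self (hsum j z).ne']
  have hMtotal : ∀ z, ∑ i, ∑ j, M z i j = ∑ _i : I, (1 : ℝ) := fun z => by
    rw [Finset.sum_comm]
    exact Finset.sum_congr rfl fun j _ => hMcol z j
  obtain ⟨z, hz⟩ := stdSimplex.exists_mem_all_of_dual_kkm hI (fun i => {z | ∑ j, M z i j ≤ 1})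
    (fun i => isClosed_le (continuous_finsetSum _ fun j _ =>
      (hgc i j).div (continuous_finsetSum _ fun k _ => hgc k j) fun z => (hsum j z).ne')
      continuous_const)
    (fun z => by
      have : Nonempty I := Fintype.card_pos_iff.1 (by omega)
      obtain ⟨i, -, hi⟩ := Finset.exists_le_of_sum_le Finset.univ_nonempty (hMtotal z).le
      exact ⟨i, hi⟩)
    (fun i z hzi => by
      simp [M, g, hzi])
  have hMrow : ∀ i, ∑ j, M z i j = 1 := fun i =>
    (Finset.sum_eq_sum_iff_of_le fun i _ => hz i).1 (hMtotal z) i (Finset.mem_univ i)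
  obtain ⟨σ, hσ⟩ := exists_perm_forall_pos_of_mem_doublyStochastic
    (mem_doublyStochastic_iff_sum.2 ⟨hM0 z, hMrow, hMcol z⟩)
  refine ⟨z, σ, fun j => ?_⟩
  by_contra hzj
  have := hσ j
  simp only [M, g, thickenedIndicator_zero hε _ hzj, NNReal.coe_zero, mul_zero, zero_div,
    lt_irrefl] at this

/-- Gale's envy-free division theorem. `A i j` is the set of cuts in which
player `j` prefers tile `i`. -/
theorem gale_envy_free (r : ℕ) (hr : 1 ≤ r)
    (A : Fin r → Fin r → Set (stdSimplex ℝ (Fin r)))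
    (hclosed : ∀ i j, IsClosed (A i j))
    (hcov : ∀ j, (⋃ i, A i j) = Set.univ)
    (hnondeg : ∀ i j, ∀ z ∈ A i j, (z : Fin r → ℝ) i ≠ 0) :
    ∃ σ : Equiv.Perm (Fin r), (⋂ j, A (σ j) j).Nonempty := by
  rcases hr.eq_or_lt with rfl | hr
  · obtain ⟨z⟩ : Nonempty (stdSimplex ℝ (Fin 1)) := inferInstance
    refine ⟨1, z, Set.mem_iInter.2 fun j => ?_⟩
    obtain ⟨i, hi⟩ := Set.mem_iUnion.1 (hcov j ▸ Set.mem_univ z)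
    rwa [Subsingleton.elim ((1 : Equiv.Perm (Fin 1)) j) i]
  · have hI : 1 < Fintype.card (Fin r) := by simpa using hr
    choose x σ hx using fun m : ℕ => exists_perm_forall_mem_thickening hI A hcov hnondeg
      (Nat.one_div_pos_of_nat (α := ℝ) (n := m))
    obtain ⟨z, hz⟩ := exists_limit_of_compactSpace x
    have hsep : ∀ p : Fin r × Fin r, ∃ ε > 0, z ∉ A p.1 p.2 →
        Metric.ball z ε ⊆ (A p.1 p.2)ᶜ := by
      intro p
      by_cases hp : z ∈ A p.1 p.2
      · exact ⟨1, one_pos, fun h => absurd hp h⟩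
      · obtain ⟨ε, hε, hball⟩ := Metric.isOpen_iff.1 (hclosed p.1 p.2).isOpen_compl z hp
        exact ⟨ε, hε, fun _ => hball⟩
    choose ε hε hball using hsep
    have : Nonempty (Fin r) := ⟨⟨0, by omega⟩⟩
    obtain ⟨p₀, hp₀⟩ := Finite.exists_min ε
    obtain ⟨m, hm, hmz⟩ := hz (ε p₀ / 2) (half_pos (hε p₀))
    refine ⟨σ m, z, Set.mem_iInter.2 fun j => ?_⟩
    by_contra hzj
    obtain ⟨y, hy, hxy⟩ := Metric.mem_thickening_iff.1 (hx m j)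
    refine hball (σ m j, j) hzj ?_ hy
    rw [Metric.mem_ball]
    have h1 := hp₀ (σ m j, j)
    have h2 := dist_triangle_left y z (x m)
    linarith
end

section
/- (Avvakumov–Karasev envy-free division theorem.) Let r be a prime power and let A : Fin r → Fin r → Set Δ^{r-1} be an old-style preference matrix that is closed, covering, and satisfies the partition-equivalence condition P_pe. Then there exists a permutation π ∈ Equiv.Perm (Fin r) such that ⋂ j, A (π j) j is nonempty; that is, there is a partition of [0,1] into at most r non-degenerate intervals and an envy-free assignment in which each non-degenerate interval is given to a different player and the remaining players receive empty pieces. -/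
/-- The left endpoint of tile `i` of the cut `z`: the sum of the lengths of
the tiles strictly before `i`. -/
def cutLeft {r : ℕ} (z : Fin r → ℝ) (i : Fin r) : ℝ :=
  ∑ k ∈ Finset.univ.filter (fun k => k < i), z k

/-- The right endpoint of tile `i` of the cut `z` (the `i`-th cut point
`a i z = ∑_{k ≤ i} z k`). -/
def cutRight {r : ℕ} (z : Fin r → ℝ) (i : Fin r) : ℝ :=
  ∑ k ∈ Finset.univ.filter (fun k => k ≤ i), z k

/-- Tile `i` of the cut `z`, recorded by its pair of endpoints. -/
def tileOf {r : ℕ} (z : Fin r → ℝ) (i : Fin r) : ℝ × ℝ :=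
  (cutLeft z i, cutRight z i)

/-- The set of essential (non-degenerate) tiles of the cut `z`. -/
def Ess {r : ℕ} (z : Fin r → ℝ) : Set (ℝ × ℝ) :=
  {t | ∃ i, 0 < z i ∧ t = tileOf z i}

namespace EnvyFree

open Finset Equiv

variable {n : ℕ}

/-- The sign of a labelling `c` of the vertices of a simplex: `±1` if `c` is bijective and `0`
otherwise. -/
def labelSign (c : Fin n → Fin n) : ℤ :=
  Matrix.det (Matrix.of fun i t => if c t = i then (1 : ℤ) else 0)

theorem sum_labelSign_update (c : Fin n → Fin n) (a : Fin n) :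
    ∑ t, labelSign (Function.update c t a) = labelSign c := by
  set M : Matrix (Fin n) (Fin n) ℤ := Matrix.of fun i t => if c t = i then (1 : ℤ) else 0
  have hupd : ∀ t, labelSign (Function.update c t a) =
      M.cramer (fun i => if a = i then 1 else 0) t := by
    intro t
    rw [Matrix.cramer_apply, labelSign]
    congr 1
    ext i s
    by_cases h : s = t
    · subst h; simp
    · simp [M, h]
  have hcr := congrArg (fun w => ∑ i, w i)
    (Matrix.mulVec_cramer M (fun i => if a = i then (1 : ℤ) else 0))
  simp only [Matrix.mulVec, dotProduct] at hcr
  rw [Finset.sum_comm] at hcr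
  simp only [hupd]
  simpa [M, ← Finset.sum_mul, labelSign] using hcr

theorem labelSign_comp (σ : Perm (Fin n)) (c : Fin n → Fin n) :
    labelSign (σ ∘ c) = Perm.sign σ * labelSign c := by
  have := Matrix.det_permute σ⁻¹ (Matrix.of fun i t => if c t = i then (1 : ℤ) else 0)
  rw [Perm.sign_inv, Int.cast_id] at this
  rw [labelSign, labelSign, ← this]
  congr 1
  ext i t
  simp [Equiv.eq_symm_apply, Perm.inv_def]

theorem injective_of_labelSign_ne_zero {c : Fin n → Fin n} (h : labelSign c ≠ 0) :
    Function.Injective c := by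
  intro s t hst
  by_contra hne
  exact h (Matrix.det_zero_of_column_eq hne fun i => by simp [hst])

theorem isUnit_labelSign {c : Fin n → Fin n} (h : Function.Injective c) :
    IsUnit (labelSign c) := by
  have hc : c = Equiv.ofBijective c (Finite.injective_iff_bijective.mp h) ∘ id := by
    ext; simp
  have hid : labelSign (id : Fin n → Fin n) = 1 := by
    rw [labelSign, ← Matrix.det_one (n := Fin n)]
    congr 1
    ext i t
    simp [Matrix.one_apply, eq_comm]
  rw [hc, labelSign_comp, hid, mul_one]
  exact Units.isUnit _

/-- The alcoves of the affine Coxeter complex of type `A`: the pair `(x, π)` stands for the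
simplex with vertices `x + e_{π 0} + ⋯ + e_{π (t - 1)}`, where `t : Fin n`. -/
abbrev Alcove (n : ℕ) := (Fin n → ℤ) × Perm (Fin n)

/-- The vertex of type `t` of an alcove. -/
def vertex (S : Alcove n) (t : Fin n) : Fin n → ℤ :=
  fun i => S.1 i + if S.2.symm i < t then 1 else 0

theorem vertex_sub_le (S : Alcove n) (s t i j : Fin n) :
    vertex S s i - vertex S s j ≤ vertex S t i - vertex S t j + 1 := by
  simp only [vertex]
  split_ifs <;> omega

/-- The alcove sharing with `S` all vertices but the one of type `t`. -/
def adjacent [NeZero n] (t : Fin n) (S : Alcove n) : Alcove n :=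
  (if t = 0 then S.1 + Pi.single (S.2 t) 1 - Pi.single (S.2 (t - 1)) 1 else S.1,
    S.2 * swap (t - 1) t)

theorem sub_one_ne [NeZero n] (hn : 2 ≤ n) (t : Fin n) : t - 1 ≠ t := by
  obtain ⟨m, rfl⟩ : ∃ m, n = m + 2 := ⟨n - 2, by omega⟩
  simp

theorem adjacent_adjacent [NeZero n] (t : Fin n) (S : Alcove n) :
    adjacent t (adjacent t S) = S := by
  ext1
  · by_cases h : t = 0 <;> simp [adjacent, h]
  · simp [adjacent, mul_assoc]

theorem sum_adjacent [NeZero n] (t : Fin n) (S : Alcove n) :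
    ∑ i, (adjacent t S).1 i = ∑ i, S.1 i := by
  by_cases h : t = 0 <;> simp [adjacent, h, Finset.sum_add_distrib]

theorem sign_adjacent [NeZero n] (hn : 2 ≤ n) (t : Fin n) (S : Alcove n) :
    Perm.sign (adjacent t S).2 = -Perm.sign S.2 := by
  simp [adjacent, Perm.sign_swap (sub_one_ne hn t)]

theorem vertex_adjacent [NeZero n] (hn : 2 ≤ n) {s t : Fin n} (hst : s ≠ t) (S : Alcove n) :
    vertex (adjacent t S) s = vertex S s := by
  ext i
  obtain ⟨k, rfl⟩ := S.2.surjective i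
  have hne := sub_one_ne hn t
  have hval : t = 0 ∧ ((t - 1 : Fin n) : ℕ) = n - 1 ∨ t ≠ 0 ∧ ((t - 1 : Fin n) : ℕ) + 1 = t := by
    obtain ⟨m, rfl⟩ : ∃ m, n = m + 1 := ⟨n - 1, by omega⟩
    by_cases h : t = 0
    · left; subst h; simp
    · right
      have : (t : ℕ) ≠ 0 := fun h' => h (Fin.ext h')
      refine ⟨h, ?_⟩
      rw [Fin.val_sub_one_of_ne_zero h]; omega
  have hs : (s : ℕ) ≠ t := fun h => hst (Fin.ext h)
  have hinv : (S.2 * swap (t - 1) t).symm (S.2 k) = swap (t - 1) t k := by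
    simp [Equiv.symm_apply_eq]
  simp only [vertex, adjacent, hinv, Equiv.symm_apply_apply]
  have := s.isLt
  rcases hval with ⟨h, hv⟩ | ⟨h, hv⟩
  · have h0 : (t : ℕ) = 0 := by simp [h]
    rw [if_pos h]
    rcases eq_or_ne k t with hk | hk
    · subst hk
      have h1 : S.2 k ≠ S.2 (k - 1) := fun h' => hne (S.2.injective h').symm
      rw [swap_apply_right]
      simp only [Pi.add_apply, Pi.sub_apply, Pi.single_apply, if_true, if_neg h1, Fin.lt_def]
      split_ifs <;> omega
    rcases eq_or_ne k (t - 1) with hk' | hk'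
    · subst hk'
      have h1 : S.2 (t - 1) ≠ S.2 t := fun h' => hne (S.2.injective h')
      rw [swap_apply_left]
      simp only [Pi.add_apply, Pi.sub_apply, Pi.single_apply, if_true, if_neg h1, Fin.lt_def]
      split_ifs <;> omega
    · simp [hk, hk', swap_apply_of_ne_of_ne]
  · rw [if_neg h]
    congr 1
    rcases eq_or_ne k t with hk | hk
    · subst hk
      rw [swap_apply_right]
      simp only [Fin.lt_def]
      congr 1
      apply propext
      omega
    rcases eq_or_ne k (t - 1) with hk' | hk'
    · subst hk'
      rw [swap_apply_left]
      simp only [Fin.lt_def]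
      congr 1
      apply propext
      omega
    · rw [swap_apply_of_ne_of_ne hk' hk]

/-- The action of the symmetric group on alcoves. -/
def relabel (σ : Perm (Fin n)) (S : Alcove n) : Alcove n := (S.1 ∘ σ.symm, σ * S.2)

theorem vertex_relabel (σ : Perm (Fin n)) (S : Alcove n) (t : Fin n) :
    vertex (relabel σ S) t = vertex S t ∘ σ.symm := by
  ext i
  simp only [vertex, relabel, Function.comp_apply]
  rfl

theorem adjacent_relabel [NeZero n] (σ : Perm (Fin n)) (S : Alcove n) (t : Fin n) :
    adjacent t (relabel σ S) = relabel σ (adjacent t S) := by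
  ext1
  · by_cases h : t = 0
    · ext i
      simp [adjacent, relabel, h, Pi.single_apply, Equiv.symm_apply_eq]
    · simp [adjacent, relabel, h]
  · simp [adjacent, relabel, mul_assoc]

theorem sum_relabel (σ : Perm (Fin n)) (S : Alcove n) :
    ∑ i, (relabel σ S).1 i = ∑ i, S.1 i :=
  Equiv.sum_comp σ.symm S.1

theorem relabel_symm_relabel (σ : Perm (Fin n)) (S : Alcove n) :
    relabel σ.symm (relabel σ S) = S := by
  ext1
  · ext i; simp [relabel]
  · ext i; simp [relabel]

/-- `A` is separated from its complement in `v` by a gap of at least `K`. -/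
def Separates (K : ℤ) (v : Fin n → ℤ) (A : Finset (Fin n)) : Prop :=
  ∀ a ∈ A, ∀ b ∉ A, v a + K ≤ v b

/-- The points of `ℤⁿ` all of whose consecutive gaps are at most `K`. -/
def Clustered (K : ℤ) (v : Fin n → ℤ) : Prop :=
  ∀ A : Finset (Fin n), A.Nonempty → A ≠ univ → ¬ Separates (K + 1) v A

theorem Separates.relabel {K : ℤ} {v : Fin n → ℤ} {A : Finset (Fin n)} (h : Separates K v A)
    (σ : Perm (Fin n)) : Separates K (v ∘ σ.symm) (A.map σ.toEmbedding) := by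
  intro a ha b hb
  rw [Finset.mem_map_equiv] at ha hb
  exact h _ ha _ hb

theorem map_symm_map (σ : Perm (Fin n)) (A : Finset (Fin n)) :
    (A.map σ.toEmbedding).map σ.symm.toEmbedding = A := by
  ext a; simp [Finset.mem_map_equiv]

theorem comp_symm_comp (σ : Perm (Fin n)) (v : Fin n → ℤ) :
    (v ∘ σ.symm) ∘ σ.symm.symm = v := by
  ext a; simp

theorem Clustered.relabel {K : ℤ} {v : Fin n → ℤ} (h : Clustered K v) (σ : Perm (Fin n)) :
    Clustered K (v ∘ σ.symm) := by
  intro A hA hA' hs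
  have := hs.relabel σ.symm
  rw [comp_symm_comp] at this
  refine h _ (hA.map) (fun he => hA' ?_) this
  rw [← map_symm_map σ.symm A, he]
  ext; simp

theorem Separates.subset_or_subset {K : ℤ} (hK : 0 < K) {v : Fin n → ℤ} {A B : Finset (Fin n)}
    (hA : Separates K v A) (hB : Separates K v B) : A ⊆ B ∨ B ⊆ A := by
  by_contra! h
  obtain ⟨a, ha, ha'⟩ := Finset.not_subset.mp h.1
  obtain ⟨b, hb, hb'⟩ := Finset.not_subset.mp h.2
  have := hA a ha b hb'
  have := hB b hb a ha'
  omega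

theorem Clustered.sub_le [NeZero n] {K : ℤ} (hK : 0 ≤ K) {v : Fin n → ℤ} (h : Clustered K v)
    (i j : Fin n) : v i - v j ≤ n * K := by
  obtain ⟨m, hm⟩ := Finite.exists_min v
  have key : ∀ k : ℕ, k ≤ n → k ≤ #{i | v i ≤ v m + k * K} := by
    intro k
    induction k with
    | zero => simp
    | succ k ih =>
      intro hk
      have ih := ih (by omega)
      set A : Finset (Fin n) := {i | v i ≤ v m + k * K} with hA
      have hsub : A ⊆ ({i | v i ≤ v m + (k + 1 : ℕ) * K} : Finset (Fin n)) := by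
        intro i hi
        simp only [hA, mem_filter, mem_univ, true_and] at hi ⊢
        push_cast
        nlinarith
      by_cases hu : A = univ
      · have := Finset.card_le_card hsub
        rw [hu, Finset.card_univ, Fintype.card_fin] at this
        omega
      · have hne : A.Nonempty := ⟨m, by simp [hA]; positivity⟩
        have hs := h A hne hu
        simp only [Separates, not_forall, not_le] at hs
        obtain ⟨a, ha, b, hb, hab⟩ := hs
        have hlt : A ⊂ ({i | v i ≤ v m + (k + 1 : ℕ) * K} : Finset (Fin n)) := by
          refine Finset.ssubset_iff_subset_ne.mpr ⟨hsub, fun he => hb ?_⟩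
          rw [he]
          simp only [hA, mem_filter, mem_univ, true_and] at ha ⊢
          push_cast
          linarith
        have := Finset.card_lt_card hlt
        omega
  have hn := key n le_rfl
  have hu : ({i | v i ≤ v m + n * K} : Finset (Fin n)) = univ :=
    Finset.eq_univ_of_card _ (le_antisymm (Finset.card_le_univ _) (by simpa using hn))
  have hi : i ∈ ({i | v i ≤ v m + n * K} : Finset (Fin n)) := by rw [hu]; exact mem_univ i
  simp only [mem_filter, mem_univ, true_and] at hi
  linarith [hm j]

open Classical in
/-- The alcoves, up to translation along the diagonal, all of whose vertices are clustered. -/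
noncomputable def alcoves (n : ℕ) (K : ℤ) : Finset (Alcove n) :=
  {S ∈ (Fintype.piFinset fun _ => Icc (-(n * K)) (n * K)) ×ˢ univ |
    ∑ i, S.1 i = 0 ∧ ∀ t, Clustered K (vertex S t)}

theorem mem_alcoves [NeZero n] {K : ℤ} (hK : 0 ≤ K) {S : Alcove n} :
    S ∈ alcoves n K ↔ ∑ i, S.1 i = 0 ∧ ∀ t, Clustered K (vertex S t) := by
  simp only [alcoves, mem_filter, mem_product, Fintype.mem_piFinset, mem_Icc, mem_univ, and_true,
    and_iff_right_iff_imp]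
  rintro ⟨hsum, hS⟩ i
  have h0 : Clustered K S.1 := by
    convert hS 0 using 1
    ext i
    simp [vertex]
  have hpos : (0 : ℤ) < n := by exact_mod_cast NeZero.pos n
  have hle : ∀ j, S.1 i - S.1 j ≤ n * K ∧ S.1 j - S.1 i ≤ n * K :=
    fun j => ⟨h0.sub_le hK i j, h0.sub_le hK j i⟩
  have h1 : ∑ j, (S.1 i - S.1 j) ≤ ∑ _j : Fin n, (n * K : ℤ) := sum_le_sum fun j _ => (hle j).1
  have h2 : ∑ j, (S.1 j - S.1 i) ≤ ∑ _j : Fin n, (n * K : ℤ) := sum_le_sum fun j _ => (hle j).2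
  simp only [sum_sub_distrib, hsum, sum_const, card_univ, Fintype.card_fin, nsmul_eq_mul] at h1 h2
  constructor <;> nlinarith

theorem relabel_mem_alcoves [NeZero n] {K : ℤ} (hK : 0 ≤ K) {S : Alcove n} (hS : S ∈ alcoves n K)
    (σ : Perm (Fin n)) : relabel σ S ∈ alcoves n K := by
  rw [mem_alcoves hK] at hS ⊢
  exact ⟨(sum_relabel σ S).trans hS.1, fun t => vertex_relabel σ S t ▸ (hS.2 t).relabel σ⟩

theorem exists_strictMonoOn_perm {A B : Finset (Fin n)} (h : #A = #B) :
    ∃ σ : Perm (Fin n), A.map σ.toEmbedding = B ∧ StrictMonoOn σ A ∧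
      StrictMonoOn σ (Aᶜ : Finset _) := by
  have hc : #(Aᶜ) = #(Bᶜ) := by simp [card_compl, h]
  let e₁ : {a // a ∈ A} ≃o {a // a ∈ B} := (A.orderIsoOfFin rfl).symm.trans (B.orderIsoOfFin h.symm)
  let e₂ : {a // a ∈ Aᶜ} ≃o {a // a ∈ Bᶜ} :=
    (Aᶜ.orderIsoOfFin rfl).symm.trans (Bᶜ.orderIsoOfFin hc.symm)
  let e₂' : {a // ¬ a ∈ A} ≃ {a // ¬ a ∈ B} :=
    (Equiv.subtypeEquivRight fun _ => mem_compl.symm).trans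
      (e₂.toEquiv.trans (Equiv.subtypeEquivRight fun _ => mem_compl))
  have hA : ∀ a (ha : a ∈ A), Equiv.subtypeCongr e₁.toEquiv e₂' a = e₁ ⟨a, ha⟩ := by
    intro a ha
    simp [Equiv.subtypeCongr, ha]
  have hA' : ∀ a (ha : a ∈ Aᶜ), Equiv.subtypeCongr e₁.toEquiv e₂' a = e₂ ⟨a, ha⟩ := by
    intro a ha
    simp [Equiv.subtypeCongr, mem_compl.mp ha, e₂']
    rfl
  refine ⟨Equiv.subtypeCongr e₁.toEquiv e₂', ?_, ?_, ?_⟩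
  · refine Finset.eq_of_subset_of_card_le (fun b hb => ?_) (by simp [h])
    obtain ⟨a, ha, rfl⟩ := Finset.mem_map.mp hb
    rw [Equiv.toEmbedding_apply, hA a ha]
    exact (e₁ ⟨a, ha⟩).2
  · intro a ha b hb hab
    rw [hA a ha, hA b hb]
    exact e₁.strictMono hab
  · intro a ha b hb hab
    rw [hA' a ha, hA' b hb]
    exact e₂.strictMono hab

theorem dvd_sum_alcoves [NeZero n] {p m : ℕ} (hp : p.Prime) (hpm : n = p ^ m) (hn : 2 ≤ n)
    {K : ℤ} (hK : 0 ≤ K) (t : Fin n) (F : Alcove n → ℤ)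
    (hadj : ∀ S, F (adjacent t S) = -F S)
    (hrel : ∀ S (A : Finset (Fin n)) (σ : Perm (Fin n)),
      (∀ s ≠ t, Separates K (vertex S s) A) → StrictMonoOn σ A →
      StrictMonoOn σ (Aᶜ : Finset _) → F (relabel σ S) = F S) :
    (p : ℤ) ∣ ∑ S ∈ alcoves n K, F S := by
  classical
  have hinner : ∑ S ∈ alcoves n K with adjacent t S ∈ alcoves n K, F S = 0 := by
    refine Finset.sum_involution (fun S _ => adjacent t S) (fun S _ => by rw [hadj]; ring) ?_ ?_
      (fun S _ => adjacent_adjacent t S)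
    · intro S _ _ h
      have := sign_adjacent hn t S
      rw [h] at this
      exact units_ne_neg_self _ this
    · intro S hS
      rw [mem_filter] at hS ⊢
      exact ⟨hS.2, by rw [adjacent_adjacent]; exact hS.1⟩
  rw [← Finset.sum_filter_add_sum_filter_not _ (fun S => adjacent t S ∈ alcoves n K), hinner,
    zero_add]
  set B := {S ∈ alcoves n K | adjacent t S ∉ alcoves n K} with hB
  let IsCut (v : Fin n → ℤ) (A : Finset (Fin n)) : Prop :=
    A.Nonempty ∧ A ≠ univ ∧ Separates (K + 1) v A
  let IsMinCut (v : Fin n → ℤ) (A : Finset (Fin n)) : Prop :=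
    IsCut v A ∧ ∀ A', IsCut v A' → #A ≤ #A'
  have hcut_rel : ∀ v A (σ : Perm (Fin n)), IsCut v A →
      IsCut (v ∘ σ.symm) (A.map σ.toEmbedding) := by
    rintro v A σ ⟨h1, h2, h3⟩
    refine ⟨h1.map, fun h => h2 ?_, h3.relabel σ⟩
    rw [← map_symm_map σ A, h]
    ext; simp
  have hmin_rel : ∀ v A (σ : Perm (Fin n)), IsMinCut v A →
      IsMinCut (v ∘ σ.symm) (A.map σ.toEmbedding) := by
    rintro v A σ ⟨h1, h2⟩
    refine ⟨hcut_rel v A σ h1, fun A' hA' => ?_⟩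
    have := hcut_rel _ _ σ.symm hA'
    rw [comp_symm_comp] at this
    simpa using h2 _ this
  have hB_rel : ∀ S ∈ B, ∀ σ, relabel σ S ∈ B := by
    intro S hS σ
    rw [hB, mem_filter] at hS ⊢
    refine ⟨relabel_mem_alcoves hK hS.1 σ, fun h => hS.2 ?_⟩
    rw [adjacent_relabel] at h
    simpa [relabel_symm_relabel] using relabel_mem_alcoves hK h σ.symm
  have hunique : ∀ S ∈ B, ∃! A, IsMinCut (vertex (adjacent t S) t) A := by
    intro S hS
    rw [hB, mem_filter] at hS
    have hS' := (mem_alcoves hK).mp hS.1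
    have hex : ∃ A, IsCut (vertex (adjacent t S) t) A := by
      by_contra! h
      refine hS.2 ((mem_alcoves hK).mpr ⟨(sum_adjacent t S).trans hS'.1, fun s => ?_⟩)
      rcases eq_or_ne s t with rfl | hst
      · exact fun A h1 h2 h3 => h A ⟨h1, h2, h3⟩
      · rw [vertex_adjacent hn hst]
        exact hS'.2 s
    obtain ⟨A, hA, hmin⟩ := Finset.exists_min_image
      ({A | IsCut (vertex (adjacent t S) t) A} : Finset (Finset (Fin n))) card
      (by obtain ⟨A, hA⟩ := hex; exact ⟨A, by simpa using hA⟩)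
    simp only [mem_filter, mem_univ, true_and] at hA hmin
    refine ⟨A, ⟨hA, hmin⟩, fun A' hA' => ?_⟩
    rcases hA'.1.2.2.subset_or_subset (by omega) hA.2.2 with h | h
    · exact Finset.eq_of_subset_of_card_le h (hmin _ hA'.1)
    · exact (Finset.eq_of_subset_of_card_le h (hA'.2 _ hA)).symm
  let g (A : Finset (Fin n)) : ℤ := ∑ S ∈ B with IsMinCut (vertex (adjacent t S) t) A, F S
  have hg : ∑ S ∈ B, F S = ∑ A, g A := by
    simp only [g, sum_filter]
    rw [sum_comm]
    refine sum_congr rfl fun S hS => ?_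
    obtain ⟨A, hA, hA'⟩ := hunique S hS
    rw [sum_eq_single A, if_pos hA]
    · exact fun A' _ hne => if_neg fun h => hne (hA' _ h)
    · simp
  have hg_card : g.FactorsThrough card := by
    intro A A' hcard
    obtain ⟨σ, hσ, hmono, hmono'⟩ := exists_strictMonoOn_perm hcard
    refine sum_nbij' (relabel σ) (relabel σ.symm) ?_ ?_ ?_ ?_ ?_
    · intro S hS
      rw [mem_filter] at hS ⊢
      refine ⟨hB_rel S hS.1 σ, ?_⟩
      rw [adjacent_relabel, vertex_relabel, ← hσ]
      exact hmin_rel _ _ σ hS.2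
    · intro S hS
      rw [mem_filter] at hS ⊢
      refine ⟨hB_rel S hS.1 σ.symm, ?_⟩
      rw [adjacent_relabel, vertex_relabel, ← map_symm_map σ A, hσ]
      exact hmin_rel _ _ σ.symm hS.2
    · exact fun S _ => relabel_symm_relabel σ S
    · exact fun S _ => relabel_symm_relabel σ.symm S
    · intro S hS
      rw [mem_filter] at hS
      refine (hrel S A σ (fun s hs a ha b hb => ?_) hmono hmono').symm
      have h1 := hS.2.1.2.2 a ha b hb
      have h2 := vertex_sub_le (adjacent t S) t s b a
      rw [vertex_adjacent hn hs] at h2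
      omega
  have hg0 : ∀ A, A = ∅ ∨ A = univ → g A = 0 := by
    intro A hA
    refine sum_eq_zero fun S hS => ?_
    obtain ⟨h1, h2, -⟩ := (mem_filter.mp hS).2.1
    rcases hA with rfl | rfl
    · simp at h1
    · simp at h2
  have hsum := Finset.sum_powerset_apply_card (Function.extend card g 0)
    (x := (univ : Finset (Fin n)))
  simp only [hg_card.extend_apply, powerset_univ, card_univ, Fintype.card_fin] at hsum
  rw [hg, hsum]
  refine dvd_sum fun k hk => ?_
  rcases eq_or_ne k 0 with rfl | hk0
  · have := hg_card.extend_apply 0 ∅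
    rw [card_empty, hg0 _ (Or.inl rfl)] at this
    simp [this]
  rcases eq_or_ne k n with rfl | hkn
  · have := hg_card.extend_apply 0 univ
    rw [card_univ, Fintype.card_fin, hg0 _ (Or.inr rfl)] at this
    simp [this]
  rw [nsmul_eq_mul]
  refine Dvd.dvd.mul_right ?_ _
  subst hpm
  exact_mod_cast hp.dvd_choose_pow hk0 hkn

/-- A labelling `L t` of the vertices of each type `t` is equivariant under the relabellings that
shuffle two clusters separated by a gap of at least `K`. -/
def ShuffleEquivariant (K : ℤ) (L : Fin n → (Fin n → ℤ) → Fin n) : Prop :=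
  ∀ (t : Fin n) (v : Fin n → ℤ) (A : Finset (Fin n)) (σ : Perm (Fin n)), Separates K v A →
    StrictMonoOn σ A → StrictMonoOn σ (Aᶜ : Finset _) → L t (v ∘ σ.symm) = σ (L t v)

/-- The number of fully labelled alcoves, counted with signs. -/
noncomputable def degree (K : ℤ) (L : Fin n → (Fin n → ℤ) → Fin n) : ℤ :=
  ∑ S ∈ alcoves n K, Perm.sign S.2 * labelSign fun t => L t (vertex S t)

theorem dvd_degree_sub_degree_of_eq [NeZero n] {p m : ℕ} (hp : p.Prime) (hpm : n = p ^ m)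
    (hn : 2 ≤ n) {K : ℤ} (hK : 0 ≤ K) {L L' : Fin n → (Fin n → ℤ) → Fin n}
    (hL : ShuffleEquivariant K L) (hL' : ShuffleEquivariant K L') (s : Fin n)
    (hs : ∀ t ≠ s, L t = L' t) : (p : ℤ) ∣ degree K L' - degree K L := by
  let F (t : Fin n) (S : Alcove n) : ℤ := Perm.sign S.2 *
    labelSign (Function.update (fun r => L' r (vertex S r)) t (L s (vertex S s)))
  have hF : degree K L' - degree K L = ∑ t ∈ univ.erase s, ∑ S ∈ alcoves n K, F t S := by
    rw [sum_comm, degree, degree, ← sum_sub_distrib]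
    refine sum_congr rfl fun S _ => ?_
    rw [← mul_sum, ← mul_sub]
    congr 1
    have h := sum_labelSign_update (fun r => L' r (vertex S r)) (L s (vertex S s))
    rw [← add_sum_erase univ _ (mem_univ s)] at h
    rw [← h]
    have : Function.update (fun r => L' r (vertex S r)) s (L s (vertex S s)) =
        fun r => L r (vertex S r) := by
      ext r
      rcases eq_or_ne r s with rfl | hr
      · simp
      · simp [hr, hs r hr]
    rw [this]
    ring
  rw [hF]
  refine dvd_sum fun t ht => ?_
  have hst : s ≠ t := (ne_of_mem_erase ht).symm
  refine dvd_sum_alcoves hp hpm hn hK t (F t) (fun S => ?_) (fun S A σ hA hσ hσ' => ?_)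
  · have : Function.update (fun r => L' r (vertex (adjacent t S) r)) t
        (L s (vertex (adjacent t S) s)) =
        Function.update (fun r => L' r (vertex S r)) t (L s (vertex S s)) := by
      ext r
      rcases eq_or_ne r t with rfl | hr
      · simp [vertex_adjacent hn hst]
      · simp [hr, vertex_adjacent hn hr]
    simp only [F, this, sign_adjacent hn]
    simp
  · have : Function.update (fun r => L' r (vertex (relabel σ S) r)) t
        (L s (vertex (relabel σ S) s)) =
        σ ∘ Function.update (fun r => L' r (vertex S r)) t (L s (vertex S s)) := by
      ext r
      rcases eq_or_ne r t with rfl | hr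
      · simp [vertex_relabel, hL s _ A σ (hA s hst) hσ hσ']
      · simp [hr, vertex_relabel, hL' r _ A σ (hA r hr) hσ hσ']
    have hsign : Perm.sign (relabel σ S).2 = Perm.sign σ * Perm.sign S.2 := Perm.sign_mul _ _
    simp only [F, this, labelSign_comp, hsign, Units.val_mul]
    have hsq : ((Perm.sign σ : ℤˣ) : ℤ) * (Perm.sign σ : ℤˣ) = 1 := by
      rw [← Units.val_mul, Int.units_mul_self, Units.val_one]
    linear_combination ((Perm.sign S.2 : ℤˣ) : ℤ) *
      labelSign (Function.update (fun r => L' r (vertex S r)) t (L s (vertex S s))) * hsq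

/-- The degree modulo `p` does not depend on the labelling. -/
theorem dvd_degree_sub_degree [NeZero n] {p m : ℕ} (hp : p.Prime) (hpm : n = p ^ m)
    (hn : 2 ≤ n) {K : ℤ} (hK : 0 ≤ K) {L L' : Fin n → (Fin n → ℤ) → Fin n}
    (hL : ShuffleEquivariant K L) (hL' : ShuffleEquivariant K L') :
    (p : ℤ) ∣ degree K L' - degree K L := by
  let H (k : ℕ) (t : Fin n) : (Fin n → ℤ) → Fin n := if (t : ℕ) < k then L' t else L t
  have hH : ∀ k, ShuffleEquivariant K (H k) := by
    intro k t
    by_cases h : (t : ℕ) < k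
    · simpa [H, h] using hL' t
    · simpa [H, h] using hL t
  have key : ∀ k ≤ n, (p : ℤ) ∣ degree K (H k) - degree K L := by
    intro k
    induction k with
    | zero => simp [H]
    | succ k ih =>
      intro hk
      have h1 := dvd_degree_sub_degree_of_eq hp hpm hn hK (hH k) (hH (k + 1)) ⟨k, hk⟩
        (fun t ht => by
          have : (t : ℕ) ≠ k := fun h => ht (Fin.ext h)
          have : (t : ℕ) < k ↔ (t : ℕ) < k + 1 := by omega
          simp [H, this])
      simpa using dvd_add h1 (ih (by omega))
  have hn' : H n = L' := by
    ext1 t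
    simp [H]
  exact hn' ▸ key n le_rfl

theorem sort_comp_symm {K : ℤ} (hK : 0 < K) {v : Fin n → ℤ} {A : Finset (Fin n)}
    {σ : Perm (Fin n)} (hA : Separates K v A) (hσ : StrictMonoOn σ A)
    (hσ' : StrictMonoOn σ (Aᶜ : Finset _)) :
    Tuple.sort (v ∘ σ.symm) = σ * Tuple.sort v := by
  obtain ⟨hmono, hties⟩ := Tuple.eq_sort_iff.mp (rfl : Tuple.sort v = Tuple.sort v)
  refine (Tuple.eq_sort_iff.mpr ⟨?_, fun i j hij heq => ?_⟩).symm
  · intro i j hij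
    simpa using hmono hij
  · simp only [Function.comp_apply, Perm.mul_apply, Equiv.symm_apply_apply] at heq ⊢
    have hlt := hties i j hij heq
    by_cases hi : Tuple.sort v i ∈ A <;> by_cases hj : Tuple.sort v j ∈ A
    · exact hσ hi hj hlt
    · have := hA _ hi _ hj
      omega
    · have := hA _ hj _ hi
      omega
    · exact hσ' (by simpa using hi) (by simpa using hj) hlt

/-- Labelling each point by the coordinate in a given position of the sorted list of coordinates
is equivariant, as soon as the position is invariant. -/
theorem shuffleEquivariant_sort {K : ℤ} (hK : 0 < K) (q : Fin n → (Fin n → ℤ) → Fin n)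
    (hq : ∀ (t : Fin n) (v : Fin n → ℤ) (A : Finset (Fin n)) (σ : Perm (Fin n)),
      Separates K v A → StrictMonoOn σ A → StrictMonoOn σ (Aᶜ : Finset _) →
        q t (v ∘ σ.symm) = q t v) :
    ShuffleEquivariant K fun t v => Tuple.sort v (q t v) := by
  intro t v A σ hA hσ hσ'
  simp [hq t v A σ hA hσ hσ', sort_comp_symm hK hA hσ hσ']

theorem sort_top_spec [NeZero n] (v : Fin n → ℤ) (j : Fin n) :
    v j < v (Tuple.sort v ⊤) ∨ v j = v (Tuple.sort v ⊤) ∧ j ≤ Tuple.sort v ⊤ := by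
  obtain ⟨hmono, hties⟩ := Tuple.eq_sort_iff.mp (rfl : Tuple.sort v = Tuple.sort v)
  obtain ⟨q, rfl⟩ := (Tuple.sort v).surjective j
  rcases (le_top : q ≤ ⊤).eq_or_lt with rfl | hq
  · simp
  · rcases (hmono hq.le).eq_or_lt with h | h
    · exact Or.inr ⟨h, (hties _ _ hq h).le⟩
    · exact Or.inl h

theorem eq_of_injective_sort_top [NeZero n] {S : Alcove n} (hsum : ∑ i, S.1 i = 0)
    (hS : Function.Injective fun t => Tuple.sort (vertex S t) ⊤) : S = (0, 1) := by
  have hdiff : ∀ i j, i ≤ j → ∀ t,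
      vertex S t j ≤ vertex S t i ∧ vertex S t i ≤ vertex S t j + 1 := by
    intro i j hij t
    rcases hij.eq_or_lt with rfl | hij
    · omega
    obtain ⟨s, hs⟩ := Finite.surjective_of_injective hS i
    obtain ⟨r, hr⟩ := Finite.surjective_of_injective hS j
    simp only at hs hr
    have h1 := sort_top_spec (vertex S s) j
    have h2 := sort_top_spec (vertex S r) i
    rw [hs] at h1
    rw [hr] at h2
    have h3 := vertex_sub_le S s t i j
    have h4 := vertex_sub_le S t r i j
    omega
  have hx : ∀ i, vertex S 0 i = S.1 i := fun i => by simp [vertex]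
  have h0 : ∀ j, S.1 j ≤ S.1 0 ∧ S.1 0 ≤ S.1 j + 1 := by
    intro j
    simpa [hx] using hdiff 0 j (Fin.zero_le j) 0
  have hle : S.1 0 ≤ 0 := by
    by_contra! h
    have : 0 < ∑ i, S.1 i :=
      sum_pos' (fun i _ => by have := h0 i; omega) ⟨0, mem_univ _, h⟩
    omega
  have hx0 := (sum_eq_zero_iff_of_nonpos fun i _ => (h0 i).1.trans hle).mp hsum
  have hmono : StrictMono S.2.symm := by
    intro i j hij
    have h1 := (hdiff i j hij.le (S.2.symm i)).1
    simp only [vertex, hx0 i (mem_univ _), hx0 j (mem_univ _), lt_irrefl, if_false] at h1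
    refine lt_of_le_of_ne ?_ (S.2.symm.injective.ne hij.ne)
    by_contra! h
    simp [h] at h1
  have hid : (S.2.symm : Fin n → Fin n) = id :=
    (StrictMono.range_inj hmono strictMono_id).mp (by simp [S.2.symm.surjective.range_eq])
  ext1
  · ext i
    exact hx0 i (mem_univ i)
  · ext i
    simpa using congrArg Fin.val (congrArg S.2 (congrFun hid i)).symm

theorem isUnit_degree_sort_top [NeZero n] {K : ℤ} (hK : 0 < K) :
    IsUnit (degree (n := n) K fun _ v => Tuple.sort v ⊤) := by
  have hvert : ∀ t i : Fin n, vertex (0, 1) t i = if i < t then 1 else 0 := by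
    intro t i
    simp [vertex]
    rfl
  have hmem : ((0, 1) : Alcove n) ∈ alcoves n K := by
    refine (mem_alcoves hK.le).mpr ⟨by simp, fun t A ⟨a, ha⟩ hA hs => hA ?_⟩
    rw [eq_univ_iff_forall]
    intro b
    by_contra hb
    have := hs a ha b hb
    rw [hvert, hvert] at this
    split_ifs at this <;> omega
  have hinj : Function.Injective fun t : Fin n => Tuple.sort (vertex (0, 1) t) ⊤ := by
    have hlab : ∀ t : Fin n, (t = 0 ∧ ∀ j, j ≤ Tuple.sort (vertex (0, 1) t) ⊤) ∨
        (t ≠ 0 ∧ (Tuple.sort (vertex (0, 1) t) ⊤ : ℕ) + 1 = t) := by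
      intro t
      have hspec := sort_top_spec (vertex (0, 1) t)
      simp only [hvert] at hspec
      rcases eq_or_ne t 0 with rfl | ht
      · refine Or.inl ⟨rfl, fun j => ?_⟩
        simpa using hspec j
      · refine Or.inr ⟨ht, ?_⟩
        have ht' : (t : ℕ) ≠ 0 := fun h => ht (Fin.ext h)
        have h := hspec ⟨t - 1, by omega⟩
        rw [if_pos (show (⟨t - 1, by omega⟩ : Fin n) < t from
          Fin.lt_def.mpr (show (t : ℕ) - 1 < t by omega))] at h
        split_ifs at h with h1
        · have h2 : (t : ℕ) - 1 ≤ (Tuple.sort (vertex (0, 1) t) ⊤ : ℕ) :=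
            (h.resolve_left (lt_irrefl _)).2
          have h3 : (Tuple.sort (vertex (0, 1) t) ⊤ : ℕ) < t := h1
          omega
        · omega
    intro s t hst
    simp only at hst
    rcases hlab s with ⟨rfl, h1⟩ | ⟨hs, h1⟩ <;> rcases hlab t with ⟨rfl, h2⟩ | ⟨ht, h2⟩
    · rfl
    · have := h1 t
      rw [hst, Fin.le_def] at this
      omega
    · have := h2 s
      rw [← hst, Fin.le_def] at this
      omega
    · exact Fin.ext (by rw [← h1, ← h2, hst])
  rw [degree, sum_eq_single (0, 1)]
  · simpa using isUnit_labelSign hinj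
  · intro S hS hne
    by_contra h
    exact hne (eq_of_injective_sort_top ((mem_alcoves hK.le).mp hS).1
      (injective_of_labelSign_ne_zero (right_ne_zero_of_mul h)))
  · exact fun h => absurd hmem h

/-- A Sperner-type lemma: an equivariant labelling admits a fully labelled alcove. -/
theorem exists_injective_labels (hn : IsPrimePow n) {K : ℤ} (hK : 0 < K)
    {L : Fin n → (Fin n → ℤ) → Fin n} (hL : ShuffleEquivariant K L) :
    ∃ S : Alcove n, Function.Injective fun t => L t (vertex S t) := by
  have h2 := hn.two_le
  obtain ⟨p, m, hp, -, hpm⟩ := (isPrimePow_nat_iff n).mp hn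
  have : NeZero n := ⟨by omega⟩
  have hdvd := dvd_degree_sub_degree hp hpm.symm h2 hK.le hL
    (shuffleEquivariant_sort hK (fun _ _ => ⊤) fun _ _ _ _ _ _ _ => rfl)
  by_contra! h
  have h0 : degree K L = 0 := by
    refine sum_eq_zero fun S _ => ?_
    by_contra hne
    exact h S (injective_of_labelSign_ne_zero (right_ne_zero_of_mul hne))
  rw [h0, sub_zero] at hdvd
  exact (Nat.prime_iff_prime_int.mp hp).not_isUnit
    (isUnit_of_dvd_unit hdvd (isUnit_degree_sort_top hK))

/-- The width of the piece with label `i` at `v`: the distance from `v i` to the coordinates with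
a larger index, truncated at `K`. -/
def width (K : ℤ) (v : Fin n → ℤ) (i : Fin n) : ℤ :=
  univ.inf' (univ_nonempty_iff.mpr ⟨i⟩) fun j => if i < j then min K |v i - v j| else K

theorem le_width_iff {K c : ℤ} {v : Fin n → ℤ} {i : Fin n} :
    c ≤ width K v i ↔ c ≤ K ∧ ∀ j, i < j → c ≤ |v i - v j| := by
  rw [width, Finset.le_inf'_iff]
  constructor
  · refine fun h => ⟨by simpa using h i (mem_univ i), fun j hij => ?_⟩
    have := h j (mem_univ j)
    rw [if_pos hij] at this
    exact this.trans (min_le_right _ _)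
  · rintro ⟨h1, h2⟩ j -
    split_ifs with hij
    · exact le_min h1 (h2 j hij)
    · exact h1

theorem width_nonneg {K : ℤ} (hK : 0 ≤ K) (v : Fin n → ℤ) (i : Fin n) : 0 ≤ width K v i :=
  le_width_iff.mpr ⟨hK, fun _ _ => abs_nonneg _⟩

theorem width_le (K : ℤ) (v : Fin n → ℤ) (i : Fin n) : width K v i ≤ K :=
  (le_width_iff.mp le_rfl).1

theorem width_le_abs (K : ℤ) (v : Fin n → ℤ) {i j : Fin n} (h : i < j) :
    width K v i ≤ |v i - v j| :=
  (le_width_iff.mp le_rfl).2 j h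

theorem width_top [NeZero n] (K : ℤ) (v : Fin n → ℤ) : width K v ⊤ = K :=
  le_antisymm (width_le K v ⊤) (le_width_iff.mpr ⟨le_rfl, fun _ h => absurd h not_top_lt⟩)

theorem width_le_width_add_one {K : ℤ} {v w : Fin n → ℤ}
    (h : ∀ i j, v i - v j ≤ w i - w j + 1) (i : Fin n) : width K v i ≤ width K w i + 1 := by
  rw [← sub_le_iff_le_add, le_width_iff]
  refine ⟨by linarith [width_le K v i], fun j hij => ?_⟩
  have h1 := width_le_abs K v hij
  have h2 := h i j
  have h3 := h j i
  rcases abs_cases (v i - v j) with h4 | h4 <;> rcases abs_cases (w i - w j) with h5 | h5 <;> omega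

theorem width_comp_symm {K : ℤ} {v : Fin n → ℤ} {A : Finset (Fin n)}
    {σ : Perm (Fin n)} (hA : Separates K v A) (hσ : StrictMonoOn σ A)
    (hσ' : StrictMonoOn σ (Aᶜ : Finset _)) (i : Fin n) :
    width K (v ∘ σ.symm) (σ i) = width K v i := by
  refine eq_of_forall_le_iff fun c => ?_
  rw [le_width_iff, le_width_iff, σ.surjective.forall]
  refine and_congr_right fun hc => forall_congr' fun j => ?_
  simp only [Function.comp_apply, symm_apply_apply]
  by_cases hi : i ∈ A <;> by_cases hj : j ∈ A
  · rw [hσ.lt_iff_lt hi hj]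
  · have h1 := hA _ hi _ hj
    have h2 := neg_abs_le (v i - v j)
    exact iff_of_true (fun _ => by omega) (fun _ => by omega)
  · have h1 := hA _ hj _ hi
    have h2 := le_abs_self (v i - v j)
    exact iff_of_true (fun _ => by omega) (fun _ => by omega)
  · rw [hσ'.lt_iff_lt (by simpa using hi) (by simpa using hj)]

theorem sum_width_pos [NeZero n] {K : ℤ} (hK : 0 < K) (v : Fin n → ℤ) :
    0 < ∑ i, width K v i :=
  sum_pos' (fun i _ => width_nonneg hK.le v i) ⟨⊤, mem_univ _, by rwa [width_top]⟩

/-- The cut whose tiles have lengths proportional to the widths at `v`, the labels being placed in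
the order of the coordinates of `v`. -/
noncomputable def cut [NeZero n] {K : ℤ} (hK : 0 < K) (v : Fin n → ℤ) : stdSimplex ℝ (Fin n) :=
  ⟨fun q => (width K v (Tuple.sort v q) : ℝ) / ∑ i, (width K v i : ℝ), by
    refine ⟨fun q => ?_, ?_⟩
    · have h := fun i => Int.cast_nonneg (R := ℝ) (width_nonneg hK.le v i)
      exact div_nonneg (h _) (sum_nonneg fun i _ => h i)
    · rw [← sum_div, Equiv.sum_comp (Tuple.sort v) fun i => (width K v i : ℝ)]
      refine div_self ?_
      exact_mod_cast (sum_width_pos hK v).ne'⟩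

theorem cut_comp_symm [NeZero n] {K : ℤ} (hK : 0 < K) {v : Fin n → ℤ} {A : Finset (Fin n)}
    {σ : Perm (Fin n)} (hA : Separates K v A) (hσ : StrictMonoOn σ A)
    (hσ' : StrictMonoOn σ (Aᶜ : Finset _)) : cut hK (v ∘ σ.symm) = cut hK v := by
  have hw := width_comp_symm hA hσ hσ'
  have hsum : ∑ i, (width K (v ∘ σ.symm) i : ℝ) = ∑ i, (width K v i : ℝ) := by
    rw [← Equiv.sum_comp σ]
    simp only [hw]
  ext q
  change (_ : ℝ) / _ = _ / _
  rw [hsum, sort_comp_symm hK hA hσ hσ', Perm.mul_apply, hw]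

open Filter Topology

theorem exists_preferred [NeZero n] (hn : IsPrimePow n)
    {A : Fin n → Fin n → Set (stdSimplex ℝ (Fin n))} (hcov : ∀ j, (⋃ i, A i j) = Set.univ)
    {K : ℤ} (hK : 0 < K) :
    ∃ (S : Alcove n) (q : Fin n → Fin n), (∀ t, cut hK (vertex S t) ∈ A (q t) t) ∧
      Function.Injective fun t => Tuple.sort (vertex S t) (q t) := by
  have hpick : ∀ t z, ∃ i, z ∈ A i t := fun t z => by
    simpa using (hcov t).ge (Set.mem_univ z)
  choose pick hpick using hpick
  obtain ⟨S, hS⟩ := exists_injective_labels hn hK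
    (shuffleEquivariant_sort hK (fun t v => pick t (cut hK v)) fun t v B σ hB hσ hσ' => by
      rw [cut_comp_symm hK hB hσ hσ'])
  exact ⟨S, fun t => pick t (cut hK (vertex S t)), fun t => hpick _ _, hS⟩

theorem sort_symm_lt_iff {v : Fin n → ℤ} {i j : Fin n} (h : v i ≠ v j) :
    (Tuple.sort v).symm i < (Tuple.sort v).symm j ↔ v i < v j := by
  have hmono := Tuple.monotone_sort v
  constructor
  · intro hlt
    exact lt_of_le_of_ne (by simpa using hmono hlt.le) h
  · intro hlt
    by_contra! hle
    exact hlt.not_ge (by simpa using hmono hle)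

/-- The order of two labels whose widths exceed `1` is the same at all vertices of an alcove. -/
theorem sort_symm_lt_sort_symm_iff {K : ℤ} {S : Alcove n} {s t i j : Fin n}
    (hi : 1 < width K (vertex S s) i) (hj : 1 < width K (vertex S s) j) :
    (Tuple.sort (vertex S s)).symm i < (Tuple.sort (vertex S s)).symm j ↔
      (Tuple.sort (vertex S t)).symm i < (Tuple.sort (vertex S t)).symm j := by
  rcases eq_or_ne i j with rfl | hij
  · simp
  have habs : 1 < |vertex S s i - vertex S s j| := by
    rcases hij.lt_or_gt with h | h
    · exact hi.trans_le (width_le_abs K _ h)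
    · exact hj.trans_le (abs_sub_comm (vertex S s i) _ ▸ width_le_abs K _ h)
  have h1 := vertex_sub_le S s t i j
  have h2 := vertex_sub_le S t s i j
  rcases lt_abs.mp habs with h | h <;>
    rw [sort_symm_lt_iff (by omega), sort_symm_lt_iff (by omega)] <;> omega

theorem cutLeft_comp_symm (w : Fin n → ℝ) (ρ : Perm (Fin n)) (i : Fin n) :
    cutLeft (w ∘ ρ) (ρ.symm i) = ∑ j, if ρ.symm j < ρ.symm i then w j else 0 := by
  rw [cutLeft, sum_filter, ← Equiv.sum_comp ρ.symm]
  simp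

theorem cutRight_comp_symm (w : Fin n → ℝ) (ρ : Perm (Fin n)) (i : Fin n) :
    cutRight (w ∘ ρ) (ρ.symm i) = ∑ j, if ρ.symm i < ρ.symm j then 0 else w j := by
  rw [cutRight, sum_filter, ← Equiv.sum_comp ρ.symm]
  refine sum_congr rfl fun j _ => ?_
  rcases lt_or_ge (ρ.symm i) (ρ.symm j) with h | h
  · simp [h, h.not_ge]
  · simp [h, h.not_gt]

/-- Two arrangements of tiles that agree on the order of the essential tiles have the same
essential tiles. -/
theorem tileOf_comp_symm {w : Fin n → ℝ} (hw : ∀ i, 0 ≤ w i) {ρ ρ' : Perm (Fin n)}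
    (h : ∀ i j, 0 < w i → 0 < w j → (ρ.symm i < ρ.symm j ↔ ρ'.symm i < ρ'.symm j))
    {i : Fin n} (hi : 0 < w i) :
    tileOf (w ∘ ρ) (ρ.symm i) = tileOf (w ∘ ρ') (ρ'.symm i) := by
  simp only [tileOf, cutLeft_comp_symm, cutRight_comp_symm]
  congr 1 <;> refine sum_congr rfl fun j _ => ?_ <;> rcases (hw j).eq_or_lt with hj | hj
  · simp [← hj]
  · simp [h j i hj hi]
  · simp [← hj]
  · simp [h i j hi hj]

theorem Ess_comp_subset {w : Fin n → ℝ} (hw : ∀ i, 0 ≤ w i) {ρ ρ' : Perm (Fin n)}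
    (h : ∀ i j, 0 < w i → 0 < w j → (ρ.symm i < ρ.symm j ↔ ρ'.symm i < ρ'.symm j)) :
    Ess (w ∘ ρ) ⊆ Ess (w ∘ ρ') := by
  rintro _ ⟨i, hi, rfl⟩
  refine ⟨ρ'.symm (ρ i), by simpa using hi, ?_⟩
  rw [← tileOf_comp_symm hw h hi, Equiv.symm_apply_apply]

/-- A sequence in a finite type is eventually constant along an ultrafilter. -/
theorem exists_eventually_eq {α β : Type*} [Finite β] (F : Ultrafilter α) (f : α → β) :
    ∃ b, ∀ᶠ a in F, f a = b := by
  obtain ⟨b, hb⟩ := (F.map f).eq_pure_of_finite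
  refine ⟨b, ?_⟩
  have : {b} ∈ F.map f := by rw [hb]; exact Set.mem_singleton b
  exact this

/-- Rescaled widths at the vertices of large alcoves converge to a limit independent of the
vertex. -/
theorem exists_tendsto_width [NeZero n] {F : Ultrafilter ℕ} (hF : (F : Filter ℕ) ≤ atTop)
    (S : ℕ → Alcove n) :
    ∃ u : Fin n → ℝ, ∀ t i, Tendsto
      (fun k : ℕ => (width (k + 1) (vertex (S k) t) i : ℝ) / (k + 1)) F (𝓝 (u i)) := by
  have hbound : ∀ t i, ∃ x : ℝ, Tendsto
      (fun k : ℕ => (width (k + 1) (vertex (S k) t) i : ℝ) / (k + 1)) F (𝓝 x) := by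
    intro t i
    obtain ⟨x, -, hx⟩ := (isCompact_Icc (a := (0 : ℝ)) (b := 1)).ultrafilter_le_nhds
      (F.map fun k : ℕ => (width (k + 1) (vertex (S k) t) i : ℝ) / (k + 1)) (by
        rw [le_principal_iff, Ultrafilter.mem_coe, Ultrafilter.mem_map]
        refine univ_mem' fun k => ?_
        have hk : (0 : ℝ) < k + 1 := by positivity
        have h0 := width_nonneg (K := k + 1) (by positivity) (vertex (S k) t) i
        have h1 := width_le (k + 1) (vertex (S k) t) i
        exact ⟨div_nonneg (by exact_mod_cast h0) hk.le,
          (div_le_one hk).mpr (by exact_mod_cast h1)⟩)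
    exact ⟨x, hx⟩
  choose x hx using hbound
  refine ⟨x 0, fun t i => ?_⟩
  suffices x t i = x 0 i from this ▸ hx t i
  have hlim : Tendsto (fun k : ℕ => 1 / ((k : ℝ) + 1)) F (𝓝 0) :=
    tendsto_one_div_add_atTop_nhds_zero_nat.mono_left hF
  have hle : ∀ s t, x s i ≤ x t i := fun s t => by
    have := (hx t i).add hlim
    rw [add_zero] at this
    refine le_of_tendsto_of_tendsto' (hx s i) this fun k => ?_
    rw [← add_div]
    gcongr
    exact_mod_cast width_le_width_add_one (fun i j => vertex_sub_le (S k) s t i j) i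
  exact le_antisymm (hle _ _) (hle _ _)

theorem one_lt_width_of_tendsto {F : Ultrafilter ℕ} (hF : (F : Filter ℕ) ≤ atTop)
    {v : ℕ → Fin n → ℤ} {i : Fin n} {x : ℝ} (hx : 0 < x)
    (h : Tendsto (fun k : ℕ => (width (k + 1) (v k) i : ℝ) / (k + 1)) F (𝓝 x)) :
    ∀ᶠ k : ℕ in F, 1 < width (k + 1) (v k) i := by
  have hlim : Tendsto (fun k : ℕ => 1 / ((k : ℝ) + 1)) F (𝓝 0) :=
    tendsto_one_div_add_atTop_nhds_zero_nat.mono_left hF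
  filter_upwards [hlim.eventually_lt h hx] with (k : ℕ) hk
  rw [div_lt_div_iff_of_pos_right (by positivity)] at hk
  exact_mod_cast hk

/-- Compactness: there are a limiting vector of tile lengths `w` and, for each player `t`, an
arrangement `ρ t` of the tiles in which `t` prefers the tile in position `q t`; the arrangements
agree on the order of the essential tiles, and the tiles chosen by the players are distinct. -/
theorem exists_arrangements [NeZero n] (hn : IsPrimePow n)
    {A : Fin n → Fin n → Set (stdSimplex ℝ (Fin n))} (hclosed : ∀ i j, IsClosed (A i j))
    (hcov : ∀ j, (⋃ i, A i j) = Set.univ) :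
    ∃ (w : Fin n → ℝ) (z : Fin n → stdSimplex ℝ (Fin n)) (ρ : Fin n → Perm (Fin n))
      (q : Fin n → Fin n), (∀ t, (z t : Fin n → ℝ) = w ∘ ρ t) ∧ (∀ t, z t ∈ A (q t) t) ∧
      (Function.Injective fun t => ρ t (q t)) ∧
      ∀ s t i j, 0 < w i → 0 < w j →
        ((ρ s).symm i < (ρ s).symm j ↔ (ρ t).symm i < (ρ t).symm j) := by
  have hpos : ∀ k : ℕ, (0 : ℤ) < k + 1 := fun k => by positivity
  choose S q hq hinj using fun k : ℕ => exists_preferred hn hcov (hpos k)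
  have hF := Nat.hyperfilter_le_atTop
  set F := hyperfilter ℕ
  obtain ⟨⟨q', ρ⟩, hconst⟩ := exists_eventually_eq F
    fun k => (q k, fun t => Tuple.sort (vertex (S k) t))
  have hq' : ∀ᶠ k in F, q k = q' := hconst.mono fun k hk => congrArg Prod.fst hk
  have hρ : ∀ᶠ k in F, ∀ t, Tuple.sort (vertex (S k) t) = ρ t :=
    hconst.mono fun k hk => congrFun (congrArg Prod.snd hk)
  obtain ⟨u, hu⟩ := exists_tendsto_width hF S
  have hu0 : ∀ i, 0 ≤ u i := fun i => ge_of_tendsto' (hu 0 i) fun k =>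
    div_nonneg (by exact_mod_cast width_nonneg (hpos k).le _ i) (by positivity)
  have htop : u ⊤ = 1 := by
    refine tendsto_nhds_unique (hu 0 ⊤) (tendsto_const_nhds.congr fun k => ?_)
    rw [width_top]
    push_cast
    exact (div_self (by positivity)).symm
  have hU : 0 < ∑ i, u i := sum_pos' (fun i _ => hu0 i) ⟨⊤, mem_univ _, by simp [htop]⟩
  let w : Fin n → ℝ := fun i => u i / ∑ i, u i
  have hw : w ∈ stdSimplex ℝ (Fin n) :=
    ⟨fun i => div_nonneg (hu0 i) hU.le, by rw [← sum_div, div_self hU.ne']⟩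
  have hz : ∀ t, w ∘ ρ t ∈ stdSimplex ℝ (Fin n) := fun t =>
    ⟨fun i => hw.1 _, (Equiv.sum_comp (ρ t) w).trans hw.2⟩
  have hcut : ∀ t, Tendsto (fun k => cut (hpos k) (vertex (S k) t)) F (𝓝 ⟨w ∘ ρ t, hz t⟩) := by
    intro t
    refine tendsto_subtype_rng.mpr (tendsto_pi_nhds.mpr fun p => ?_)
    refine ((hu t (ρ t p)).div (tendsto_finsetSum univ fun i _ => hu t i) hU.ne').congr' ?_
    filter_upwards [hρ] with k hk
    rw [Pi.div_apply, ← sum_div, div_div_div_cancel_right₀ (by positivity), ← hk t]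
    rfl
  refine ⟨w, fun t => ⟨w ∘ ρ t, hz t⟩, ρ, q', fun t => rfl, fun t => ?_, ?_,
    fun s t i j hi hj => ?_⟩
  · refine (hclosed _ _).mem_of_tendsto (hcut t) ?_
    filter_upwards [hq'] with k hk
    exact hk ▸ hq k t
  · obtain ⟨k, hk, hk'⟩ := (hq'.and hρ).exists
    have := hinj k
    simpa only [hk, hk'] using this
  · have hpos' : ∀ i, 0 < w i → 0 < u i := fun i h => (div_pos_iff_of_pos_right hU).mp h
    obtain ⟨k, hk, hi', hj'⟩ := (hρ.and ((one_lt_width_of_tendsto hF (hpos' i hi) (hu s i)).and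
      (one_lt_width_of_tendsto hF (hpos' j hj) (hu s j)))).exists
    rw [← hk s, ← hk t]
    exact sort_symm_lt_sort_symm_iff hi' hj'

end EnvyFree

/-- The Avvakumov–Karasev envy-free division theorem: for `r` a prime power,
closed covering preferences satisfying partition equivalence `P_pe` admit an
envy-free division. -/
theorem avvakumov_karasev_envy_free (r : ℕ) (hr : IsPrimePow r)
    (A : Fin r → Fin r → Set (stdSimplex ℝ (Fin r)))
    (hclosed : ∀ i j, IsClosed (A i j))
    (hcov : ∀ j, (⋃ i, A i j) = Set.univ)
    (hpe : ∀ z z' : stdSimplex ℝ (Fin r),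
      Ess (z : Fin r → ℝ) = Ess (z' : Fin r → ℝ) →
      (∀ (i i' j : Fin r), 0 < (z : Fin r → ℝ) i → 0 < (z' : Fin r → ℝ) i' →
        tileOf (z : Fin r → ℝ) i = tileOf (z' : Fin r → ℝ) i' →
        (z ∈ A i j ↔ z' ∈ A i' j)) ∧
      (∀ j : Fin r, (∃ i₁, (z : Fin r → ℝ) i₁ = 0 ∧ z ∈ A i₁ j) →
        ∀ i₂, (z' : Fin r → ℝ) i₂ = 0 → z' ∈ A i₂ j)) :
    ∃ π : Equiv.Perm (Fin r), (⋂ j, A (π j) j).Nonempty := by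
  have : NeZero r := ⟨hr.ne_zero⟩
  obtain ⟨w, z, ρ, q, hz, hmem, hinj, horder⟩ := EnvyFree.exists_arrangements hr hclosed hcov
  have hw : ∀ i, 0 ≤ w i := fun i => by
    have := (z 0).2.1 ((ρ 0).symm i)
    rw [show (z 0).1 = w ∘ ρ 0 from hz 0] at this
    simpa using this
  have hEss : ∀ t, Ess (z t : Fin r → ℝ) = Ess (z 0 : Fin r → ℝ) := fun t => by
    rw [hz, hz]
    exact (EnvyFree.Ess_comp_subset hw (horder t 0)).antisymm
      (EnvyFree.Ess_comp_subset hw (horder 0 t))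
  let τ : Equiv.Perm (Fin r) := Equiv.ofBijective _ (Finite.injective_iff_bijective.mp hinj)
  refine ⟨τ.trans (ρ 0).symm, z 0, Set.mem_iInter.mpr fun t => ?_⟩
  have hlen : (z t : Fin r → ℝ) (q t) = w (τ t) := by rw [hz]; rfl
  have hlen0 : (z 0 : Fin r → ℝ) ((ρ 0).symm (τ t)) = w (τ t) := by simp [hz]
  rcases (hw (τ t)).eq_or_lt with h | h
  · exact (hpe _ _ (hEss t)).2 t ⟨q t, hlen.trans h.symm, hmem t⟩ _ (hlen0.trans h.symm)
  · refine ((hpe _ _ (hEss t)).1 _ _ t (hlen ▸ h) (hlen0 ▸ h) ?_).mp (hmem t)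
    have := EnvyFree.tileOf_comp_symm hw (horder t 0) h
    rw [hz, hz]
    simpa [τ] using this
end

section
/- (Envy-free division with dropped tiles, for arbitrary r.) Let r ≥ 1 and let A : Fin r → Fin r → Set Δ^{r-1} be an old-style preference matrix that is closed, covering, and satisfies P_dte (degenerate tiles may be preferred). Then there exists an envy-free division in which some tiles may be dropped: there exist z ∈ Δ^{r-1} and a map π : Fin r → Fin r such that z ∈ A (π j) j for every player j, and π is injective on the set {j | z (π j) > 0} (so distinct players receive distinct non-degenerate tiles, while players assigned a degenerate tile receive nothing, and the unassigned non-degenerate tiles are dropped). -/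
open Finset in
theorem even_card_filter_of_not_surjective {n : ℕ} (f : Fin (n + 1) → Fin (n + 1))
    (hf : ¬ Function.Surjective f) :
    Even (#{j : Fin (n + 1) | ∀ c ≠ 0, ∃ i ≠ j, f i = c}) := by
  classical
  rcases Finset.eq_empty_or_nonempty {j : Fin (n + 1) | ∀ c ≠ 0, ∃ i ≠ j, f i = c} with h | ⟨j, hj⟩
  · simp [h]
  · have hj := (Finset.mem_filter.1 hj).2
    have hf0 : ∀ i, f i ≠ 0 := by
      intro i hi
      refine hf fun c => ?_
      by_cases hc : c = 0
      · exact ⟨i, hi.trans hc.symm⟩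
      · obtain ⟨k, -, hk⟩ := hj c hc
        exact ⟨k, hk⟩
    have hinj : Set.InjOn f (univ.erase j : Finset (Fin (n + 1))) := by
      have himg : (univ.erase j).image f = univ.erase 0 := by
        ext c
        simp only [mem_image, mem_erase, mem_univ, and_true]
        exact ⟨by rintro ⟨i, -, rfl⟩; exact hf0 i, fun hc => hj c hc⟩
      apply Finset.injOn_of_card_image_eq
      rw [himg]
      simp
    have hinj' : ∀ a b, a ≠ j → b ≠ j → f a = f b → a = b := fun a b ha hb hab =>
      hinj (by simpa using ha) (by simpa using hb) hab
    obtain ⟨i, hij, hi⟩ := hj (f j) (hf0 j)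
    have hpair : ({j : Fin (n + 1) | ∀ c ≠ 0, ∃ i ≠ j, f i = c} : Finset _) = {i, j} := by
      ext k
      simp only [mem_filter, mem_univ, true_and, mem_insert, mem_singleton]
      constructor
      · intro hk
        by_contra! hne
        obtain ⟨l, hlk, hl⟩ := hk (f k) (hf0 k)
        by_cases hlj : l = j
        · subst hlj
          exact hne.1 (hinj' k i hne.2 hij (by rw [hi, hl]))
        · exact hlk (hinj' l k hlj hne.2 hl)
      · rintro (rfl | rfl)
        · intro c hc
          obtain ⟨l, hlj, hl⟩ := hj c hc
          by_cases hlk : l = k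
          · exact ⟨j, hij.symm, by rw [← hi, ← hlk, hl]⟩
          · exact ⟨l, hlk, hl⟩
        · exact hj
    rw [hpair, card_pair hij]
    exact even_two

namespace CyclicTriangulation

variable {m : ℕ}

/-- The displacement moving one unit from coordinate `k` to the cyclically next one. -/
def step (k : Fin (m + 2)) : Fin (m + 2) → ℤ := Pi.single (k + 1) 1 - Pi.single k 1

theorem step_apply (k c : Fin (m + 2)) :
    step k c = (if c = k + 1 then 1 else 0) - (if c = k then 1 else 0) := by
  simp [step, Pi.single_apply]

theorem add_one_ne (k : Fin (m + 2)) : k + 1 ≠ k := by simp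

theorem sub_one_ne (k : Fin (m + 2)) : k - 1 ≠ k := by simp

theorem step_injective : Function.Injective (step (m := m)) := by
  intro k l h
  have := congrFun h k
  simp only [step_apply, (add_one_ne k).symm, if_true, if_false] at this
  by_contra hne
  rw [if_neg hne] at this
  split_ifs at this <;> omega

/-- The ordered vertex sets of the maximal simplices of the Freudenthal triangulation of the
hyperplane `∑ c, y c = M`: consecutive vertices differ by `step`, each step is used once, and the
`j`-th vertex has weight `j` modulo the number of coordinates. -/
structure IsRoom (M : ℤ) (V : Fin (m + 2) → Fin (m + 2) → ℤ) : Prop where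
  exists_perm : ∃ σ : Equiv.Perm (Fin (m + 2)), ∀ j, V (j + 1) = V j + step (σ j)
  sum_eq : ∀ j, ∑ c, V j c = M
  weight_eq : ∀ j, ∑ c, V j c • c = j

/-- Replace the `j`-th vertex of a simplex by its reflection in the opposite facet. -/
def pivot (V : Fin (m + 2) → Fin (m + 2) → ℤ) (j : Fin (m + 2)) : Fin (m + 2) → Fin (m + 2) → ℤ :=
  Function.update V j (V (j - 1) + V (j + 1) - V j)

theorem pivot_self (V : Fin (m + 2) → Fin (m + 2) → ℤ) (j : Fin (m + 2)) :
    pivot V j j = V (j - 1) + V (j + 1) - V j := by simp [pivot]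

theorem pivot_of_ne (V : Fin (m + 2) → Fin (m + 2) → ℤ) {i j : Fin (m + 2)} (h : i ≠ j) :
    pivot V j i = V i := by simp [pivot, h]

theorem pivot_pivot (V : Fin (m + 2) → Fin (m + 2) → ℤ) (j : Fin (m + 2)) :
    pivot (pivot V j) j = V := by
  funext i
  by_cases h : i = j
  · subst h
    rw [pivot_self, pivot_self, pivot_of_ne _ (sub_one_ne i), pivot_of_ne _ (add_one_ne i)]
    abel
  · rw [pivot_of_ne _ h, pivot_of_ne _ h]

theorem IsRoom.pivot {M : ℤ} {V : Fin (m + 2) → Fin (m + 2) → ℤ} (hV : IsRoom M V)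
    (j : Fin (m + 2)) : IsRoom M (pivot V j) := by
  obtain ⟨⟨σ, hσ⟩, hsum, hw⟩ := hV
  have hprev : V j = V (j - 1) + step (σ (j - 1)) := by
    simpa using hσ (j - 1)
  refine ⟨⟨Equiv.swap (j - 1) j |>.trans σ, fun i => ?_⟩, fun i => ?_, fun i => ?_⟩
  · by_cases hij : i = j
    · subst hij
      rw [pivot_of_ne _ (add_one_ne i), pivot_self]
      simp only [Equiv.trans_apply, Equiv.swap_apply_right]
      have h := hprev.symm
      rw [← eq_sub_iff_add_eq'] at h
      rw [h]
      abel
    · by_cases hij' : i = j - 1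
      · subst hij'
        rw [sub_add_cancel, pivot_self, pivot_of_ne _ (sub_one_ne j)]
        simp only [Equiv.trans_apply, Equiv.swap_apply_left]
        rw [hσ j]
        abel
      · have h1 : i + 1 ≠ j := fun h => hij' (eq_sub_of_add_eq h)
        rw [pivot_of_ne _ h1, pivot_of_ne _ hij, hσ i]
        simp [Equiv.swap_apply_of_ne_of_ne hij' hij]
  · by_cases hij : i = j
    · subst hij
      simp [pivot_self, Finset.sum_add_distrib, hsum]
    · rw [pivot_of_ne _ hij, hsum]
  · by_cases hij : i = j
    · subst hij
      simp only [pivot_self, Pi.add_apply, Pi.sub_apply, add_smul, sub_smul,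
        Finset.sum_add_distrib, Finset.sum_sub_distrib, hw]
      abel
    · rw [pivot_of_ne _ hij, hw]

theorem IsRoom.pivot_ne {M : ℤ} {V : Fin (m + 2) → Fin (m + 2) → ℤ} (hV : IsRoom M V)
    (j : Fin (m + 2)) : CyclicTriangulation.pivot V j ≠ V := by
  obtain ⟨⟨σ, hσ⟩, -, -⟩ := hV
  intro h
  have h := congrFun h j
  have hprev : V j = V (j - 1) + step (σ (j - 1)) := by
    simpa using hσ (j - 1)
  rw [pivot_self, hσ j, add_sub_assoc, add_sub_cancel_left] at h
  have : step (σ j) = step (σ (j - 1)) := add_left_cancel (h.trans hprev)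
  exact sub_one_ne j (σ.injective (step_injective this)).symm

/-- A function on a cycle which only decreases after `s` and increases by one after `t`. -/
theorem apply_eq_of_cyclic_step {g : Fin (m + 2) → ℤ} {s t : Fin (m + 2)}
    (hg : ∀ i, i ≠ s → i ≠ t → g (i + 1) = g i) (ht : g (t + 1) = g t + 1) (x : Fin (m + 2)) :
    g (s + 1 + x) = g (s + 1) + if t - (s + 1) < x then 1 else 0 := by
  induction x using Fin.induction with
  | zero => simp
  | succ x ih =>
    have hx : s + 1 + x.succ = s + 1 + x.castSucc + 1 := by
      rw [← Fin.coeSucc_eq_succ]; abel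
    have hs : s + 1 + x.castSucc ≠ s := by
      intro h
      have : s + x.succ = s + 0 := by
        rw [← Fin.coeSucc_eq_succ, add_zero, add_comm x.castSucc, ← add_assoc, h]
      exact Fin.succ_ne_zero x (add_left_cancel this)
    rw [hx]
    by_cases h : s + 1 + x.castSucc = t
    · have h' : t - (s + 1) = x.castSucc := by rw [← h]; abel
      rw [h, ht, ← h, ih, h']
      simp
    · rw [hg _ hs h, ih]
      have h' : t - (s + 1) ≠ x.castSucc := fun h' => h (by rw [← h']; abel)
      congr 2
      simp only [Fin.lt_def, Fin.val_succ, Fin.val_castSucc, ne_eq, Fin.ext_iff, eq_iff_iff] at *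
      omega

section Coordinates

variable {V : Fin (m + 2) → Fin (m + 2) → ℤ} {σ : Equiv.Perm (Fin (m + 2))}

theorem coord_eq (hσ : ∀ j, V (j + 1) = V j + step (σ j)) (c x : Fin (m + 2)) :
    V (σ.symm c + 1 + x) c =
      V (σ.symm c + 1) c + if σ.symm (c - 1) - (σ.symm c + 1) < x then 1 else 0 := by
  apply apply_eq_of_cyclic_step (g := fun i => V i c)
  · intro i hs ht
    have h1 : c ≠ σ i := fun h => hs (by simp [h])
    have h2 : c ≠ σ i + 1 := fun h => ht (by simp [h])
    simp [hσ, step_apply, h1, h2]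
  · simp [hσ, step_apply, (sub_one_ne c).symm]

theorem coord_le_add_one (hσ : ∀ j, V (j + 1) = V j + step (σ j)) (i j c : Fin (m + 2)) :
    V i c ≤ V j c + 1 := by
  have hi := coord_eq hσ c (i - (σ.symm c + 1))
  have hj := coord_eq hσ c (j - (σ.symm c + 1))
  rw [add_sub_cancel] at hi hj
  split_ifs at hi hj <;> omega

theorem coord_eq_of_ne (hσ : ∀ j, V (j + 1) = V j + step (σ j)) {i j : Fin (m + 2)}
    (hj : σ (j - 1) + 1 = σ j) (hij : i ≠ j) : V i (σ j) = V (j + 1) (σ j) := by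
  have hi := coord_eq hσ (σ j) (i - (j + 1))
  have h1 : σ.symm (σ j - 1) = j - 1 := by rw [← hj]; simp
  rw [h1, Equiv.symm_apply_apply, add_sub_cancel, if_neg, add_zero] at hi
  · exact hi
  · intro hlt
    have h2 := Fin.add_one_le_of_lt hlt
    have h3 : j - 1 - (j + 1) + 1 = Fin.last (m + 1) := by
      have h4 : Fin.last (m + 1) = -1 := by
        rw [eq_neg_iff_add_eq_zero]; exact Fin.last_add_one _
      rw [h4]; abel
    rw [h3, Fin.last_le_iff, ← h3, sub_eq_iff_eq_add] at h2
    exact hij (h2.trans (by abel))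

end Coordinates

/-- The simplex spanned by the points `e k + N • e last`. -/
def baseRoom (N : ℤ) (k : Fin (m + 2)) : Fin (m + 2) → ℤ :=
  Pi.single k 1 + Pi.single (Fin.last (m + 1)) N

theorem sum_single_smul (k : Fin (m + 2)) (a : ℤ) :
    ∑ c, (Pi.single k a : Fin (m + 2) → ℤ) c • c = a • k := by
  rw [Finset.sum_eq_single k]
  · simp
  · intro b _ hb
    simp [hb]
  · simp

theorem mul_smul_fin (q : ℤ) (k : Fin (m + 2)) : ((m + 2 : ℕ) * q : ℤ) • k = 0 := by
  rw [mul_comm, mul_smul]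
  have : ((m + 2 : ℕ) : ℤ) • k = 0 := by
    rw [natCast_zsmul]
    simpa using card_nsmul_eq_zero' (G := Fin (m + 2)) (x := k)
  rw [this, smul_zero]

theorem isRoom_baseRoom (q : ℤ) :
    IsRoom ((m + 2 : ℕ) * q + 1) (baseRoom (m := m) ((m + 2 : ℕ) * q)) := by
  refine ⟨⟨1, fun j => ?_⟩, fun j => ?_, fun j => ?_⟩
  · simp only [baseRoom, step, Equiv.Perm.one_apply]; abel
  · simp only [baseRoom, Pi.add_apply, Finset.sum_add_distrib, Finset.sum_pi_single']
    simp [add_comm]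
  · simp only [baseRoom, Pi.add_apply, Finset.sum_add_distrib, add_smul, sum_single_smul,
      mul_smul_fin]
    simp

theorem baseRoom_nonneg {N : ℤ} (hN : 0 ≤ N) (j c : Fin (m + 2)) : 0 ≤ baseRoom N j c := by
  simp only [baseRoom, Pi.add_apply, Pi.single_apply]
  split_ifs <;> omega

theorem baseRoom_zero_coord (N : ℤ) {k : Fin (m + 2)} (hk : k ≠ 0) : baseRoom N k 0 = 0 := by
  have : (0 : Fin (m + 2)) ≠ Fin.last (m + 1) := (Fin.last_pos).ne
  simp [baseRoom, hk.symm, this]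

theorem pivot_baseRoom_neg (N : ℤ) : pivot (baseRoom (m := m) N) 0 0 0 < 0 := by
  have h : (0 : Fin (m + 2)) ≠ Fin.last (m + 1) := (Fin.last_pos).ne
  rw [pivot_self]
  simp only [Pi.sub_apply, Pi.add_apply]
  rw [baseRoom_zero_coord, baseRoom_zero_coord]
  · simp [baseRoom, h]
  · simp
  · simp

/-- The label of a point is a coordinate in its support, namely the first one if the point lies
on the facet `y 0 = 0`. -/
structure IsLabelling (M : ℤ) (L : Fin (m + 2) → (Fin (m + 2) → ℤ) → Fin (m + 2)) : Prop where
  pos : ∀ j (y : Fin (m + 2) → ℤ), (∀ c, 0 ≤ y c) → ∑ c, y c = M → 0 < y (L j y)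
  eq_zero : ∀ j (y : Fin (m + 2) → ℤ), (∀ c, 0 ≤ y c) → ∑ c, y c = M → y 0 = 0 →
    ∀ k < L j y, y k = 0

/-- The vertices of a simplex other than the `j`-th one, each labelled by its owner, carry all
labels except possibly `0`. -/
def IsDoor (L : Fin (m + 2) → (Fin (m + 2) → ℤ) → Fin (m + 2))
    (V : Fin (m + 2) → Fin (m + 2) → ℤ) (j : Fin (m + 2)) : Prop :=
  ∀ c ≠ 0, ∃ i ≠ j, L i (V i) = c

theorem IsDoor.pivot {L : Fin (m + 2) → (Fin (m + 2) → ℤ) → Fin (m + 2)}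
    {V : Fin (m + 2) → Fin (m + 2) → ℤ} {j : Fin (m + 2)} (h : IsDoor L V j) :
    IsDoor L (pivot V j) j := by
  intro c hc
  obtain ⟨i, hij, hi⟩ := h c hc
  exact ⟨i, hij, by rw [pivot_of_ne _ hij, hi]⟩

section Labelling

variable {q : ℤ} {L : Fin (m + 2) → (Fin (m + 2) → ℤ) → Fin (m + 2)}

theorem isDoor_baseRoom (hq : 0 ≤ q) (hL : IsLabelling ((m + 2 : ℕ) * q + 1) L) :
    IsDoor L (baseRoom ((m + 2 : ℕ) * q)) 0 := by
  have hN : (0 : ℤ) ≤ (m + 2 : ℕ) * q := by positivity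
  intro c hc
  refine ⟨c, hc, ?_⟩
  have hnn := baseRoom_nonneg hN c
  have hsum := (isRoom_baseRoom (m := m) q).sum_eq c
  have h1 := hL.pos c _ hnn hsum
  have h2 := hL.eq_zero c _ hnn hsum (baseRoom_zero_coord _ hc)
  set l := L c (baseRoom ((m + 2 : ℕ) * q) c)
  rcases lt_trichotomy l c with h | h | h
  · have h3 : l ≠ Fin.last (m + 1) := (h.trans_le (Fin.le_last c)).ne
    simp [baseRoom, h3, h.ne] at h1
  · exact h
  · have h3 := h2 c h
    simp only [baseRoom, Pi.add_apply, Pi.single_apply] at h3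
    split_ifs at h3 <;> omega

theorem eq_baseRoom_of_pivot_neg (hq : 0 ≤ q) (hL : IsLabelling ((m + 2 : ℕ) * q + 1) L)
    {V : Fin (m + 2) → Fin (m + 2) → ℤ} (hV : IsRoom ((m + 2 : ℕ) * q + 1) V)
    (hnn : ∀ i c, 0 ≤ V i c) {j : Fin (m + 2)} (hdoor : IsDoor L V j)
    (hneg : ¬ ∀ i c, 0 ≤ pivot V j i c) :
    V = baseRoom ((m + 2 : ℕ) * q) ∧ j = 0 := by
  obtain ⟨⟨σ, hσ⟩, hsum, hw⟩ := hV
  set N : ℤ := (m + 2 : ℕ) * q with hNdef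
  have hN : 0 ≤ N := by positivity
  have hprev : V j = V (j - 1) + step (σ (j - 1)) := by
    simpa using hσ (j - 1)
  push Not at hneg
  obtain ⟨i, b, hib⟩ := hneg
  have hij : i = j := by
    by_contra hij
    rw [pivot_of_ne _ hij] at hib
    exact absurd (hnn i b) (by omega)
  subst hij
  have hfacet : b = σ i ∧ b = σ (i - 1) + 1 ∧ V (i + 1) b = 0 := by
    have h1 := congrFun (hσ i) b
    have h2 := congrFun hprev b
    have h3 := hnn (i - 1) b
    have h4 := hnn (i + 1) b
    rw [pivot_self] at hib
    simp only [Pi.add_apply, Pi.sub_apply, step_apply] at hib h1 h2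
    have hb1 : b = σ i := by
      by_contra hne
      rw [if_neg hne] at h1
      split_ifs at h1 h2 <;> omega
    have hb2 : b = σ (i - 1) + 1 := by
      by_contra hne
      rw [if_neg hne] at h2
      split_ifs at h1 h2 <;> omega
    refine ⟨hb1, hb2, ?_⟩
    split_ifs at h1 h2 <;> omega
  obtain ⟨hb1, hb2, hb3⟩ := hfacet
  have hflat : ∀ k ≠ i, V k b = 0 := by
    intro k hk
    rw [← hb3, hb1]
    exact coord_eq_of_ne hσ (by rw [← hb2, hb1]) hk
  have hb0 : b = 0 := by
    by_contra hb0
    obtain ⟨k, hk, hLk⟩ := hdoor b hb0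
    have := hL.pos k (V k) (hnn k) (hsum k)
    rw [hLk, hflat k hk] at this
    exact lt_irrefl _ this
  subst hb0
  have hlast0 : Fin.last (m + 1) ≠ 0 := (Fin.last_pos).ne'
  have htop : ∃ k, ∀ c ≠ Fin.last (m + 1), V k c = 0 := by
    obtain ⟨k, hk, hLk⟩ := hdoor _ hlast0
    refine ⟨k, fun c hc => hL.eq_zero k (V k) (hnn k) (hsum k) (hflat k hk) c ?_⟩
    rw [hLk]
    exact Fin.lt_last_iff_ne_last.2 hc
  obtain ⟨t, ht⟩ := htop
  have htlast : V t (Fin.last (m + 1)) = N + 1 := by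
    rw [← hsum t, Finset.sum_eq_single (Fin.last (m + 1))]
    · intro c _ hc
      exact ht c hc
    · simp
  have hvert : ∀ c ≠ 0, c ≠ i ∧ V c = baseRoom N c := by
    intro c hc
    obtain ⟨k, hk, hLk⟩ := hdoor c hc
    have hle : ∀ d, baseRoom N c d ≤ V k d := by
      intro d
      have h1 := coord_le_add_one hσ t k (Fin.last (m + 1))
      have h2 := hL.pos k (V k) (hnn k) (hsum k)
      have h3 := hnn k d
      rw [hLk] at h2
      simp only [baseRoom, Pi.add_apply, Pi.single_apply]
      by_cases hd : d = Fin.last (m + 1)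
      · subst hd
        by_cases hdc : Fin.last (m + 1) = c
        · have : V k (Fin.last (m + 1)) = N + 1 := by
            rw [← hsum k, Finset.sum_eq_single (Fin.last (m + 1))]
            · intro e _ he
              refine hL.eq_zero k (V k) (hnn k) (hsum k) (hflat k hk) e ?_
              rw [hLk, ← hdc]
              exact Fin.lt_last_iff_ne_last.2 he
            · simp
          rw [if_pos hdc, if_pos rfl]
          omega
        · rw [if_neg hdc, if_pos rfl]
          omega
      · rw [if_neg hd]
        by_cases hdc : d = c
        · subst hdc
          rw [if_pos rfl]
          omega
        · rw [if_neg hdc]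
          omega
    have heq : V k = baseRoom N c := by
      have hs : ∑ d, baseRoom N c d = ∑ d, V k d := by
        rw [hsum k, (isRoom_baseRoom q).sum_eq c]
      have := (Finset.sum_eq_sum_iff_of_le fun d _ => hle d).1 hs
      funext d
      exact (this d (Finset.mem_univ d)).symm
    have hkc : k = c := by
      rw [← hw k, heq]
      exact (isRoom_baseRoom q).weight_eq c
    subst hkc
    exact ⟨hk, heq⟩
  have hi0 : i = 0 := by
    by_contra hi0
    exact (hvert i hi0).1 rfl
  subst hi0
  refine ⟨?_, rfl⟩
  funext k
  by_cases hk : k = 0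
  · subst hk
    have h1 := hσ 0
    rw [← hb1, (hvert (0 + 1) (add_one_ne 0)).2] at h1
    rw [← sub_eq_iff_eq_add] at h1
    rw [← h1]
    simp only [baseRoom, step]
    abel
  · exact (hvert k hk).2

theorem finite_rooms (M : ℤ) :
    {V : Fin (m + 2) → Fin (m + 2) → ℤ | IsRoom M V ∧ ∀ i c, 0 ≤ V i c}.Finite := by
  refine (Set.finite_Icc (0 : Fin (m + 2) → Fin (m + 2) → ℤ) (fun _ _ => M)).subset ?_
  rintro V ⟨hV, hnn⟩
  refine ⟨fun i c => hnn i c, fun i c => ?_⟩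
  rw [← hV.sum_eq i]
  exact Finset.single_le_sum (f := V i) (fun d _ => hnn i d) (Finset.mem_univ c)

/-- Sperner's lemma with owners: some simplex of the Freudenthal triangulation has all labels
when each vertex is labelled by its owner. -/
theorem exists_surjective_label (hq : 0 ≤ q) (hL : IsLabelling ((m + 2 : ℕ) * q + 1) L) :
    ∃ V, IsRoom ((m + 2 : ℕ) * q + 1) V ∧ (∀ i c, 0 ≤ V i c) ∧
      Function.Surjective fun i => L i (V i) := by
  classical
  by_contra! hno
  set R := (finite_rooms (m := m) ((m + 2 : ℕ) * q + 1)).toFinset with hR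
  have hmemR : ∀ V, V ∈ R ↔ IsRoom ((m + 2 : ℕ) * q + 1) V ∧ ∀ i c, 0 ≤ V i c := by
    intro V; simp [hR]
  set S := (R ×ˢ (Finset.univ : Finset (Fin (m + 2)))).filter fun p => IsDoor L p.1 p.2 with hS
  have hmemS : ∀ p, p ∈ S ↔ p.1 ∈ R ∧ IsDoor L p.1 p.2 := by
    intro p; simp [hS]
  set B : (Fin (m + 2) → Fin (m + 2) → ℤ) × Fin (m + 2) := (baseRoom ((m + 2 : ℕ) * q), 0) with hB
  have hBS : B ∈ S := (hmemS B).2 ⟨(hmemR _).2 ⟨isRoom_baseRoom q,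
    baseRoom_nonneg (by positivity)⟩, isDoor_baseRoom hq hL⟩
  have heven : ∑ _p ∈ S, (1 : ZMod 2) = 0 := by
    rw [hS, Finset.sum_filter, Finset.sum_product]
    refine Finset.sum_eq_zero fun V hV => ?_
    rw [hmemR] at hV
    have := even_card_filter_of_not_surjective (fun i => L i (V i)) (hno V hV.1 hV.2)
    rw [← Finset.sum_filter, Finset.sum_const, nsmul_one, ZMod.natCast_eq_zero_iff_even]
    unfold IsDoor
    convert this
  have hodd : ∑ _p ∈ S.erase B, (1 : ZMod 2) = 0 := by
    refine Finset.sum_involution (fun p _ => (pivot p.1 p.2, p.2)) ?_ ?_ ?_ ?_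
    · intros; decide
    · intro p hp _ h
      have hp := (hmemR _).1 ((hmemS p).1 (Finset.mem_of_mem_erase hp)).1
      exact hp.1.pivot_ne p.2 (congrArg Prod.fst h)
    · intro p hp
      obtain ⟨hne, hp⟩ := Finset.mem_erase.1 hp
      obtain ⟨hpR, hdoor⟩ := (hmemS p).1 hp
      have hroom := (hmemR _).1 hpR
      refine Finset.mem_erase.2 ⟨fun h => ?_, (hmemS _).2 ⟨(hmemR _).2
        ⟨hroom.1.pivot _, ?_⟩, hdoor.pivot⟩⟩
      · have h1 : pivot p.1 p.2 = baseRoom ((m + 2 : ℕ) * q) := congrArg Prod.fst h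
        have h2 : p.2 = 0 := congrArg Prod.snd h
        have h3 : p.1 = pivot (baseRoom ((m + 2 : ℕ) * q)) 0 := by
          rw [← h1, ← h2, pivot_pivot]
        have h4 := hroom.2 0 0
        rw [h3] at h4
        exact absurd (pivot_baseRoom_neg ((m + 2 : ℕ) * q : ℤ)) (not_lt.2 h4)
      · by_contra hneg
        obtain ⟨h1, h2⟩ := eq_baseRoom_of_pivot_neg hq hL hroom.1 hroom.2 hdoor hneg
        exact hne (Prod.ext h1 h2)
    · intro p _
      simp [pivot_pivot]
  rw [← Finset.add_sum_erase S _ hBS, hodd] at heven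
  exact absurd heven (by decide)

end Labelling

end CyclicTriangulation

open CyclicTriangulation in
theorem exists_approx_permutation {m : ℕ}
    (B : Fin (m + 2) → Fin (m + 2) → Set (stdSimplex ℝ (Fin (m + 2))))
    (hB : ∀ j (z : stdSimplex ℝ (Fin (m + 2))), ∃ i, 0 < (z : Fin (m + 2) → ℝ) i ∧ z ∈ B i j)
    (q : ℕ) (hq : 0 < q) :
    ∃ (Z : Fin (m + 2) → stdSimplex ℝ (Fin (m + 2))) (π : Fin (m + 2) → Fin (m + 2)),
      Function.Injective π ∧ (∀ j, Z j ∈ B (π j) j) ∧ ∀ i j, dist (Z i) (Z j) ≤ 1 / q := by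
  classical
  choose lab hlab_pos hlab_mem using hB
  set N : ℝ := (m + 2 : ℕ) * q with hN
  have hqN : (q : ℝ) ≤ N := by
    rw [hN]
    exact le_mul_of_one_le_left (by positivity) (by norm_cast; omega)
  have hq' : (0 : ℝ) < q := by exact_mod_cast hq
  have hNpos : 0 < N := hq'.trans_le hqN
  let Good (y : Fin (m + 2) → ℤ) : Prop :=
    (∀ c, 0 ≤ y c) ∧ ∑ c, y c = (m + 2 : ℕ) * (q : ℤ) + 1 ∧ 1 ≤ y 0
  let pt (y : Fin (m + 2) → ℤ) (h : Good y) : stdSimplex ℝ (Fin (m + 2)) :=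
    ⟨fun c => ((y c - (Pi.single 0 1 : Fin (m + 2) → ℤ) c : ℤ) : ℝ) / N, by
      intro c
      refine div_nonneg ?_ hNpos.le
      have h1 := h.1 c
      have h2 := h.2.2
      rw [Int.cast_nonneg_iff]
      by_cases hc : c = 0
      · subst hc; simpa using h2
      · simpa [hc] using h1, by
      rw [← Finset.sum_div, ← Int.cast_sum, Finset.sum_sub_distrib, h.2.1,
        Finset.sum_pi_single']
      rw [div_eq_one_iff_eq hNpos.ne', hN]
      simp⟩
  have hlabel : ∀ (j : Fin (m + 2)) (y : Fin (m + 2) → ℤ), ∃ l,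
      ((∀ c, 0 ≤ y c) → ∑ c, y c = (m + 2 : ℕ) * (q : ℤ) + 1 → 0 < y l) ∧
      ((∀ c, 0 ≤ y c) → ∑ c, y c = (m + 2 : ℕ) * (q : ℤ) + 1 → y 0 = 0 → ∀ k < l, y k = 0) ∧
      ∀ h : Good y, l = lab j (pt y h) := by
    intro j y
    by_cases hy : (∀ c, 0 ≤ y c) ∧ ∑ c, y c = (m + 2 : ℕ) * (q : ℤ) + 1
    · by_cases h0 : 1 ≤ y 0
      · have hgood : Good y := ⟨hy.1, hy.2, h0⟩
        refine ⟨lab j (pt y hgood), fun _ _ => ?_, fun _ _ h => by omega, fun _ => rfl⟩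
        have h1 := hlab_pos j (pt y hgood)
        generalize lab j (pt y hgood) = l at h1
        have h2 := (div_pos_iff_of_pos_right hNpos).1 h1
        rw [Int.cast_pos, Pi.single_apply] at h2
        split_ifs at h2 <;> omega
      · have hex : ∃ c, 0 < y c := by
          by_contra! hle
          have := Finset.sum_nonpos fun c (_ : c ∈ Finset.univ) => hle c
          rw [hy.2] at this
          exact absurd this (not_le.2 (by positivity))
        obtain ⟨l, hl, hlmin⟩ := (wellFounded_lt (α := Fin (m + 2))).has_min {c | 0 < y c} hex
        refine ⟨l, fun _ _ => hl, fun hnn _ _ k hk => ?_, fun h => absurd h.2.2 h0⟩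
        exact le_antisymm (not_lt.1 fun hpos => hlmin k hpos hk) (hnn k)
    · exact ⟨0, fun h1 h2 => absurd ⟨h1, h2⟩ hy, fun h1 h2 => absurd ⟨h1, h2⟩ hy,
        fun h => absurd ⟨h.1, h.2.1⟩ hy⟩
  choose L hLpos hLmin hLlab using hlabel
  obtain ⟨V, hV, hnn, hsurj⟩ := exists_surjective_label (m := m) (q := q) (L := L)
    (by positivity) ⟨hLpos, hLmin⟩
  obtain ⟨σ, hσ⟩ := hV.exists_perm
  obtain ⟨t, ht⟩ := hsurj 0
  have ht2 : 2 ≤ V t 0 := by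
    have h0 := hLpos t (V t) (hnn t) (hV.sum_eq t)
    have hgood : Good (V t) := ⟨hnn t, hV.sum_eq t, by rw [show L t (V t) = 0 from ht] at h0; omega⟩
    have h1 := hlab_pos t (pt (V t) hgood)
    rw [← hLlab t (V t) hgood, show L t (V t) = 0 from ht] at h1
    have h2 := (div_pos_iff_of_pos_right hNpos).1 h1
    rw [Int.cast_pos, Pi.single_eq_same] at h2
    omega
  have hgood : ∀ i, Good (V i) := fun i =>
    ⟨hnn i, hV.sum_eq i, by have := coord_le_add_one hσ t i 0; omega⟩
  refine ⟨fun i => pt (V i) (hgood i), fun i => L i (V i),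
    Finite.injective_iff_surjective.2 hsurj, fun j => ?_, fun i j => ?_⟩
  · simp only [hLlab j (V j) (hgood j)]
    exact hlab_mem j _
  · rw [Subtype.dist_eq, dist_pi_le_iff (by positivity)]
    intro c
    have h1 := coord_le_add_one hσ i j c
    have h2 := coord_le_add_one hσ j i c
    have h3 : |((V i c : ℤ) : ℝ) - V j c| ≤ 1 := by
      rw [abs_le]
      constructor
      · have : ((V j c : ℤ) : ℝ) ≤ V i c + 1 := by exact_mod_cast h2
        linarith
      · have : ((V i c : ℤ) : ℝ) ≤ V j c + 1 := by exact_mod_cast h1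
        linarith
    have h4 : ((V i c - (Pi.single 0 1 : Fin (m + 2) → ℤ) c : ℤ) : ℝ) / N -
        ((V j c - (Pi.single 0 1 : Fin (m + 2) → ℤ) c : ℤ) : ℝ) / N =
        (((V i c : ℤ) : ℝ) - V j c) / N := by
      push_cast; ring
    rw [Real.dist_eq]
    simp only [pt]
    rw [h4, abs_div, abs_of_pos hNpos]
    exact div_le_div₀ zero_le_one h3 hq' hqN

open Filter Topology in
/-- Gale's colorful version of the Knaster–Kuratowski–Mazurkiewicz theorem. -/
theorem exists_injective_forall_mem_of_isClosed {r : ℕ} (hr : 1 ≤ r)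
    (B : Fin r → Fin r → Set (stdSimplex ℝ (Fin r)))
    (hclosed : ∀ i j, IsClosed (B i j))
    (hB : ∀ j (z : stdSimplex ℝ (Fin r)), ∃ i, 0 < (z : Fin r → ℝ) i ∧ z ∈ B i j) :
    ∃ (z : stdSimplex ℝ (Fin r)) (π : Fin r → Fin r),
      Function.Injective π ∧ ∀ j, z ∈ B (π j) j := by
  obtain _ | _ | m := r
  · omega
  · obtain ⟨z⟩ : Nonempty (stdSimplex ℝ (Fin (0 + 1))) := inferInstance
    choose π _ hπ using fun j => hB j z
    have : Subsingleton (Fin (0 + 1)) := inferInstanceAs (Subsingleton (Fin 1))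
    exact ⟨z, π, Function.injective_of_subsingleton π, hπ⟩
  · choose Z π hπ hZ hdist using fun k : ℕ => exists_approx_permutation B hB (k + 1) k.succ_pos
    obtain ⟨z, φ, hφ, hz⟩ := CompactSpace.tendsto_subseq fun k => Z k 0
    obtain ⟨p, hp⟩ : ∃ p, ∃ᶠ k in atTop, π (φ k) = p := by
      by_contra h
      simp only [not_exists, not_frequently] at h
      obtain ⟨k, hk⟩ := (eventually_all.2 h).exists
      exact hk _ rfl
    obtain ⟨k, hk⟩ := hp.exists
    refine ⟨z, p, hk ▸ hπ (φ k), fun j => ?_⟩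
    have hzj : Tendsto (fun k => Z (φ k) j) atTop (𝓝 z) := by
      refine hz.congr_dist ?_
      refine squeeze_zero (fun _ => dist_nonneg) (fun k => hdist (φ k) 0 j) ?_
      have := (tendsto_one_div_add_atTop_nhds_zero_nat (𝕜 := ℝ)).comp hφ.tendsto_atTop
      simpa [Function.comp_def] using this
    refine (hclosed (p j) j).mem_of_frequently_of_tendsto ?_ hzj
    exact hp.mono fun k hk => hk ▸ hZ (φ k) j

/-- Envy-free division with dropped tiles, for arbitrary `r`: closed covering
preferences satisfying `P_dte` (all degenerate tiles are equal) admit an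
envy-free division in which some non-degenerate tiles may be dropped. -/
theorem envy_free_with_dropped_tiles (r : ℕ) (hr : 1 ≤ r)
    (A : Fin r → Fin r → Set (stdSimplex ℝ (Fin r)))
    (hclosed : ∀ i j, IsClosed (A i j))
    (hcov : ∀ j, (⋃ i, A i j) = Set.univ)
    (hdte : ∀ (j : Fin r) (z : stdSimplex ℝ (Fin r)) (i i' : Fin r),
      (z : Fin r → ℝ) i = 0 → (z : Fin r → ℝ) i' = 0 →
      (z ∈ A i j ↔ z ∈ A i' j)) :
    ∃ (z : stdSimplex ℝ (Fin r)) (π : Fin r → Fin r),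
      (∀ j, z ∈ A (π j) j) ∧
      Set.InjOn π {j | 0 < (z : Fin r → ℝ) (π j)} := by
  classical
  let E (j : Fin r) : Set (stdSimplex ℝ (Fin r)) :=
    ⋃ i, A i j ∩ {z | (z : Fin r → ℝ) i = 0}
  have hE : ∀ j, IsClosed (E j) := fun j => isClosed_iUnion_of_finite fun i =>
    (hclosed i j).inter (isClosed_eq ((continuous_apply i).comp continuous_subtype_val)
      continuous_const)
  obtain ⟨z, π, hπ, hz⟩ := exists_injective_forall_mem_of_isClosed hr (fun i j => A i j ∪ E j)
    (fun i j => (hclosed i j).union (hE j)) fun j z => by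
      obtain ⟨i, hi⟩ := Set.mem_iUnion.1 ((hcov j).symm ▸ Set.mem_univ z)
      rcases (z.2.1 i).eq_or_lt with h0 | hpos
      · obtain ⟨k, hk⟩ : ∃ k, 0 < (z : Fin r → ℝ) k := by
          by_contra! hle
          have := Finset.sum_nonpos fun c (_ : c ∈ Finset.univ) => hle c
          have h1 : ∑ c, (z : Fin r → ℝ) c = 1 := z.2.2
          linarith
        exact ⟨k, hk, Or.inr (Set.mem_iUnion.2 ⟨i, hi, h0.symm⟩)⟩
      · exact ⟨i, hpos, Or.inl hi⟩
  have hchoice : ∀ j, ∃ i, z ∈ A i j ∧ (0 < (z : Fin r → ℝ) i → i = π j) := by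
    intro j
    rcases hz j with h | h
    · exact ⟨π j, h, fun _ => rfl⟩
    · obtain ⟨i, hi, h0⟩ := Set.mem_iUnion.1 h
      exact ⟨i, hi, fun hpos => absurd h0 hpos.ne'⟩
  choose ρ hρ hρπ using hchoice
  refine ⟨z, ρ, hρ, fun j hj k hk hjk => hπ ?_⟩
  rw [← hρπ j hj, ← hρπ k hk, hjk]
end

section
/- (The 'right gorbushka' theorem.) Suppose r is a prime number or r = 4. Let B : Fin r → Fin r → Set C₁ be a new-style preference matrix on the configuration space C₁ that is closed, covering, and equivariant. Then there exists an envy-free division: ⋂ i, B i i is nonempty. In other words, there is a cut and an allocation of the non-degenerate tiles into boxes (at most one tile per box, except that one box may additionally contain the last tile) such that player j prefers the content of box j for every j. -/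
/-- The configuration space `C₁`, the geometric realization of the chessboard
complex `Δ_{r,r-1} * [r]`: matrices with nonnegative entries summing to `1`,
at most one nonzero entry in each column, and at most one nonzero entry in
each row among the columns other than the last one. -/
def ConfC1 (r : ℕ) : Set (Fin r → Fin r → ℝ) :=
  {M | (∀ b t, 0 ≤ M b t) ∧ (∑ b, ∑ t, M b t) = 1 ∧
    (∀ t b b', M b t ≠ 0 → M b' t ≠ 0 → b = b') ∧
    (∀ (b : Fin r) (t t' : Fin r), (t : ℕ) + 1 < r → (t' : ℕ) + 1 < r →
      M b t ≠ 0 → M b t' ≠ 0 → t = t')}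

/-- The action of `σ ∈ S_r` on configuration spaces of matrices,
permuting the rows (boxes). -/
def rowPerm {r m : ℕ} (σ : Equiv.Perm (Fin r)) (M : Fin r → Fin m → ℝ) :
    Fin r → Fin m → ℝ :=
  fun b t => M (σ⁻¹ b) t

/-- The coboundary of a cochain on ordered simplices, represented by lists of vertices. -/
def listCoboundary {Y : Type*} : (List Y → ℤ) → List Y → ℤ
  | _, [] => 0
  | f, b :: y => f y - listCoboundary (fun l => f (b :: l)) y

/-- The dual of barycentric subdivision of simplices with `n` vertices, where `b` assigns
to each simplex its barycenter. -/
def subdivide {Y : Type*} (b : List Y → Y) : ℕ → (List Y → ℤ) → List Y → ℤ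
  | 0, f, x => f x
  | n + 1, f, x => listCoboundary (subdivide b n (fun l => f (b x :: l))) x

/-- The prism operator between two vertex maps `p` and `q`. -/
def prism {Y Z : Type*} (p q : Y → Z) : (List Z → ℤ) → List Y → ℤ
  | _, [] => 0
  | F, x :: y => F (p x :: q x :: y.map q) - prism p q (fun l => F (p x :: l)) y

section Cochains

variable {Y Z : Type*}

theorem listCoboundary_congr {f g : List Y → ℤ} {x : List Y}
    (h : ∀ y : List Y, y.length + 1 = x.length → f y = g y) :
    listCoboundary f x = listCoboundary g x := by
  induction x generalizing f g with
  | nil => rfl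
  | cons b y ih =>
    simp only [listCoboundary]
    rw [h y (by simp), ih (fun z hz => h (b :: z) (by simp [hz]))]

theorem listCoboundary_sub (f g : List Y → ℤ) (x : List Y) :
    listCoboundary (fun l => f l - g l) x = listCoboundary f x - listCoboundary g x := by
  induction x generalizing f g with
  | nil => rfl
  | cons b y ih => simp only [listCoboundary, ih]; ring

theorem listCoboundary_const_mul (c : ℤ) (f : List Y → ℤ) (x : List Y) :
    listCoboundary (fun l => c * f l) x = c * listCoboundary f x := by
  induction x generalizing f with
  | nil => simp [listCoboundary]
  | cons b y ih => simp only [listCoboundary, ih]; ring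

theorem listCoboundary_zero (x : List Y) : listCoboundary (fun _ => 0) x = 0 := by
  simpa using listCoboundary_const_mul 0 (fun _ => 0) x

theorem listCoboundary_listCoboundary (f : List Y → ℤ) (x : List Y) :
    listCoboundary (listCoboundary f) x = 0 := by
  induction x generalizing f with
  | nil => rfl
  | cons b y ih => simp only [listCoboundary, listCoboundary_sub, ih]; ring

theorem listCoboundary_map (g : Y → Z) (f : List Z → ℤ) (x : List Y) :
    listCoboundary f (x.map g) = listCoboundary (fun l => f (l.map g)) x := by
  induction x generalizing f with
  | nil => rfl
  | cons b y ih => simp only [List.map_cons, listCoboundary, ih]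

theorem exists_of_listCoboundary_ne_zero {f : List Y → ℤ} {x : List Y}
    (h : listCoboundary f x ≠ 0) :
    ∃ y : List Y, y ⊆ x ∧ y.length + 1 = x.length ∧ f y ≠ 0 := by
  by_contra! hc
  induction x generalizing f with
  | nil => exact h rfl
  | cons b y ih =>
    simp only [listCoboundary] at h
    rw [hc y (by simp) (by simp)] at h
    refine ih (f := fun l => f (b :: l)) (by simpa using h) fun z hz hl => ?_
    exact hc _ (List.cons_subset_cons b hz) (by simp [hl])

theorem subdivide_congr (b : List Y → Y) {n : ℕ} {f g : List Y → ℤ} {x : List Y}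
    (hx : x.length = n) (h : ∀ y : List Y, y.length = n → f y = g y) :
    subdivide b n f x = subdivide b n g x := by
  induction n generalizing f g x with
  | zero => exact h x hx
  | succ n ih =>
    refine listCoboundary_congr fun y hy => ih (by omega) fun z hz => h _ (by simp [hz])

theorem subdivide_sub (b : List Y → Y) (n : ℕ) (f g : List Y → ℤ) (x : List Y) :
    subdivide b n (fun l => f l - g l) x = subdivide b n f x - subdivide b n g x := by
  induction n generalizing f g x with
  | zero => rfl
  | succ n ih =>
    simp only [subdivide, ← listCoboundary_sub]
    congr 1; ext l; exact ih _ _ _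

theorem subdivide_const_mul (b : List Y → Y) (n : ℕ) (c : ℤ) (f : List Y → ℤ) (x : List Y) :
    subdivide b n (fun l => c * f l) x = c * subdivide b n f x := by
  induction n generalizing f x with
  | zero => rfl
  | succ n ih =>
    simp only [subdivide, ← listCoboundary_const_mul]
    congr 1; ext l; exact ih _ _

theorem subdivide_listCoboundary (b : List Y → Y) {n : ℕ} (f : List Y → ℤ) {x : List Y}
    (hx : x.length = n + 1) :
    subdivide b (n + 1) (listCoboundary f) x = listCoboundary (subdivide b n f) x := by
  induction n generalizing f x with
  | zero =>
    simp only [subdivide]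
    refine listCoboundary_congr fun y hy => ?_
    obtain rfl : y = [] := List.length_eq_zero_iff.mp (by omega)
    simp [listCoboundary]
  | succ n ih =>
    rw [subdivide]
    simp only [listCoboundary]
    calc _ = listCoboundary (fun y => subdivide b (n + 1) f y -
            listCoboundary (subdivide b n (fun l => f (b x :: l))) y) x := by
          refine listCoboundary_congr fun y hy => ?_
          rw [subdivide_sub b (n + 1) f, ih _ (by omega)]
      _ = _ := by
          rw [listCoboundary_sub, listCoboundary_listCoboundary, sub_zero]

theorem subdivide_map (b : List Y → Y) (g : Y → Y)
    (hb : ∀ x : List Y, x ≠ [] → b (x.map g) = g (b x)) (n : ℕ) (f : List Y → ℤ) (x : List Y) :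
    subdivide b n f (x.map g) = subdivide b n (fun l => f (l.map g)) x := by
  induction n generalizing f x with
  | zero => rfl
  | succ n ih =>
    rcases eq_or_ne x [] with rfl | hx
    · rfl
    · simp only [subdivide, listCoboundary_map, ih, hb x hx, List.map_cons]

theorem prism_map (p q : Y → Z) (g : Y → Y) (k : Z → Z) (hp : ∀ y, p (g y) = k (p y))
    (hq : ∀ y, q (g y) = k (q y)) (F : List Z → ℤ) (x : List Y) :
    prism p q F (x.map g) = prism p q (fun l => F (l.map k)) x := by
  induction x generalizing F with
  | nil => rfl
  | cons b y ih =>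
    have : q ∘ g = k ∘ q := funext hq
    simp [prism, ih, hp, hq, this]

theorem prism_sub (p q : Y → Z) (F G : List Z → ℤ) (x : List Y) :
    prism p q (fun l => F l - G l) x = prism p q F x - prism p q G x := by
  induction x generalizing F G with
  | nil => rfl
  | cons b y ih => simp only [prism, ih]; ring

theorem prism_const_mul (p q : Y → Z) (c : ℤ) (F : List Z → ℤ) (x : List Y) :
    prism p q (fun l => c * F l) x = c * prism p q F x := by
  induction x generalizing F with
  | nil => simp [prism]
  | cons b y ih => simp only [prism, ih]; ring

theorem prism_homotopy (p q : Y → Z) (F : List Z → ℤ) (x : List Y) :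
    prism p q (listCoboundary F) x + listCoboundary (prism p q F) x =
      F (x.map q) - F (x.map p) := by
  induction x generalizing F with
  | nil => simp [prism, listCoboundary]
  | cons b y ih =>
    have h := ih (fun l => F (p b :: l))
    simp only [prism, listCoboundary, prism_sub, listCoboundary_sub, List.map_cons,
      listCoboundary_map] at h ⊢
    linarith

/-- If the barycenter of every simplex carries the label of one of its vertices, labels
pull back alternating cochains to cochains invariant under subdivision. -/
theorem subdivide_label (b : List Y → Y) (q : Y → Z)
    (hb : ∀ x : List Y, x ≠ [] → q (b x) ∈ x.map q) {n : ℕ} (F : List Z → ℤ)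
    (hF : ∀ l : List Z, ¬ l.Nodup → F l = 0)
    (hdF : ∀ l : List Z, ¬ l.Nodup → listCoboundary F l = 0) {x : List Y} (hx : x.length = n) :
    subdivide b n (fun l => F (l.map q)) x = F (x.map q) := by
  induction n generalizing F x with
  | zero => rfl
  | succ n ih =>
    have hne : x ≠ [] := by rintro rfl; simp at hx
    have key : ∀ l, listCoboundary F (q (b x) :: l) =
      F l - listCoboundary (fun l => F (q (b x) :: l)) l := fun l => rfl
    simp only [subdivide, List.map_cons]
    calc _ = listCoboundary (fun l : List Y => F (q (b x) :: l.map q)) x := by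
          refine listCoboundary_congr fun y hy => ?_
          refine ih (fun l => F (q (b x) :: l)) (fun l hl => hF _ (by simp [hl]))
            (fun l hl => ?_) (by omega)
          have := key l
          rw [hF l hl, hdF _ (by simp [hl])] at this
          linarith
      _ = _ := by
          have := key (x.map q)
          rw [hdF _ (by simp [hb x hne]), listCoboundary_map] at this
          linarith

end Cochains

section IteratedSubdivision

variable {Y Z : Type*} (b : List Y → Y) {n : ℕ}

theorem iterate_subdivide_sub (N : ℕ) (f g : List Y → ℤ) :
    (subdivide b n)^[N] (fun l => f l - g l) =
      fun l => (subdivide b n)^[N] f l - (subdivide b n)^[N] g l := by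
  induction N with
  | zero => rfl
  | succ N ih =>
    simp only [Function.iterate_succ_apply', ih]
    ext x; exact subdivide_sub b n _ _ x

theorem iterate_subdivide_listCoboundary (N : ℕ) (f : List Y → ℤ) {x : List Y}
    (hx : x.length = n + 1) :
    (subdivide b (n + 1))^[N] (listCoboundary f) x =
      listCoboundary ((subdivide b n)^[N] f) x := by
  induction N generalizing x with
  | zero => rfl
  | succ N ih =>
    simp only [Function.iterate_succ_apply']
    rw [subdivide_congr b hx fun y hy => ih hy, subdivide_listCoboundary b _ hx]

theorem iterate_subdivide_map_eq_mul (g : Y → Y)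
    (hb : ∀ x : List Y, x ≠ [] → b (x.map g) = g (b x)) (c : ℤ) (N : ℕ) {f : List Y → ℤ}
    (hf : ∀ x, f (x.map g) = c * f x) (x : List Y) :
    (subdivide b n)^[N] f (x.map g) = c * (subdivide b n)^[N] f x := by
  induction N generalizing x with
  | zero => exact hf x
  | succ N ih =>
    simp only [Function.iterate_succ_apply', subdivide_map b g hb, ih, subdivide_const_mul]

theorem iterate_subdivide_label (q : Y → Z)
    (hb : ∀ x : List Y, x ≠ [] → q (b x) ∈ x.map q) (F : List Z → ℤ)
    (hF : ∀ l : List Z, ¬ l.Nodup → F l = 0)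
    (hdF : ∀ l : List Z, ¬ l.Nodup → listCoboundary F l = 0) (N : ℕ) {x : List Y}
    (hx : x.length = n) :
    (subdivide b n)^[N] (fun l => F (l.map q)) x = F (x.map q) := by
  induction N generalizing x with
  | zero => rfl
  | succ N ih =>
    simp only [Function.iterate_succ_apply']
    rw [subdivide_congr b hx fun y hy => ih hy, subdivide_label b q hb F hF hdF hx]

end IteratedSubdivision

/-- The determinant of the 0-1 matrix whose rows are the basis vectors named by a list. -/
def labelDet (m : ℕ) (l : List (Fin m)) : ℤ :=
  if l.length = m then
    Matrix.det (Matrix.of fun i j : Fin m => if l[(i : ℕ)]? = some j then (1 : ℤ) else 0)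
  else 0

theorem exists_ofFn_eq {α : Type*} {l : List α} {m : ℕ} (h : l.length = m) :
    ∃ x : Fin m → α, List.ofFn x = l := by
  subst h
  exact ⟨l.get, List.ofFn_get l⟩

theorem listCoboundary_ofFn {Y : Type*} {n : ℕ} (f : List Y → ℤ) (x : Fin (n + 1) → Y) :
    listCoboundary f (List.ofFn x) =
      ∑ j : Fin (n + 1), (-1) ^ (j : ℕ) * f (List.ofFn fun i => x (j.succAbove i)) := by
  induction n generalizing f with
  | zero => simp [listCoboundary]
  | succ n ih =>
    rw [Fin.sum_univ_succ, List.ofFn_succ, listCoboundary, ih, sub_eq_add_neg,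
      ← Finset.sum_neg_distrib]
    congr 1
    · simp
    · refine Finset.sum_congr rfl fun j _ => ?_
      simp [pow_succ, List.ofFn_succ]

section LabelDet

variable {m : ℕ}

theorem labelDet_ofFn (x : Fin m → Fin m) :
    labelDet m (List.ofFn x) =
      Matrix.det (Matrix.of fun i j : Fin m => if x i = j then (1 : ℤ) else 0) := by
  simp [labelDet]

theorem length_eq_of_labelDet_ne_zero {l : List (Fin m)} (h : labelDet m l ≠ 0) :
    l.length = m := by
  by_contra hl
  exact h (if_neg hl)

theorem labelDet_eq_zero_of_not_nodup {l : List (Fin m)} (h : ¬ l.Nodup) : labelDet m l = 0 := by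
  by_contra h0
  obtain ⟨x, rfl⟩ := exists_ofFn_eq (length_eq_of_labelDet_ne_zero h0)
  rw [List.nodup_ofFn] at h
  simp only [Function.Injective, not_forall] at h
  obtain ⟨i, j, hij, hne⟩ := h
  rw [labelDet_ofFn] at h0
  exact h0 (Matrix.det_zero_of_row_eq hne (by ext k; simp [hij]))

theorem listCoboundary_labelDet (l : List (Fin m)) : listCoboundary (labelDet m) l = 0 := by
  by_cases hl : l.length = m + 1
  · obtain ⟨x, rfl⟩ := exists_ofFn_eq hl
    let A : Matrix (Fin (m + 1)) (Fin (m + 1)) ℤ :=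
      Matrix.of fun i j => Fin.cases 1 (fun k => if x i = k then 1 else 0) j
    have hA : A.det = 0 := by
      refine Matrix.exists_mulVec_eq_zero_iff.mp
        ⟨Fin.cons 1 (fun _ => -1), fun h => by simpa using congrFun h 0, ?_⟩
      ext i
      simp [A, Matrix.mulVec, dotProduct, Fin.sum_univ_succ]
    rw [listCoboundary_ofFn, ← hA, Matrix.det_succ_column_zero]
    refine Finset.sum_congr rfl fun j _ => ?_
    rw [labelDet_ofFn]
    simp [A, Matrix.submatrix]
  · rw [← listCoboundary_zero l]
    exact listCoboundary_congr fun y hy => if_neg (by omega)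

theorem labelDet_map_perm (σ : Equiv.Perm (Fin m)) (l : List (Fin m)) :
    labelDet m (l.map σ) = (Equiv.Perm.sign σ : ℤ) * labelDet m l := by
  by_cases hl : l.length = m
  · obtain ⟨x, rfl⟩ := exists_ofFn_eq hl
    have h := Matrix.det_permute' σ⁻¹
      (Matrix.of fun i j : Fin m => if x i = j then (1 : ℤ) else 0)
    rw [Equiv.Perm.sign_inv] at h
    rw [List.map_ofFn, labelDet_ofFn, labelDet_ofFn, ← Int.cast_id (n := (Equiv.Perm.sign σ : ℤ)),
      ← h]
    congr 1
    ext i j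
    simp [Equiv.eq_symm_apply]
  · simp [labelDet, hl]

theorem labelDet_ofFn_perm (σ : Equiv.Perm (Fin m)) :
    labelDet m (List.ofFn σ) = (Equiv.Perm.sign σ : ℤ) := by
  have h := labelDet_map_perm σ (List.ofFn id)
  rw [List.map_ofFn, labelDet_ofFn id] at h
  have h1 : (Matrix.of fun i j : Fin m => if id i = j then (1 : ℤ) else 0) = 1 := by
    ext i j; simp [Matrix.one_apply]
  rw [h1, Matrix.det_one, mul_one] at h
  exact h

theorem listCoboundary_labelDet_cons (a : Fin m) (l : List (Fin m)) :
    listCoboundary (fun l => labelDet m (a :: l)) l = labelDet m l := by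
  have h := listCoboundary_labelDet (a :: l)
  rw [listCoboundary] at h
  linarith

end LabelDet

section ChessboardCycle

variable {n : ℕ}

theorem sum_perm_eq_mul (t : Equiv.Perm (Fin (n + 1)) → ℤ)
    (ht : ∀ a σ, t (Equiv.addLeft a * σ) = t σ) :
    ∑ σ, t σ = (n + 1 : ℕ) * ∑ σ with σ (Fin.last n) = 0, t σ := by
  have h : ∀ v : Fin (n + 1), ∑ σ with σ (Fin.last n) = v, t σ =
      ∑ σ with σ (Fin.last n) = 0, t σ := by
    intro v
    refine (Finset.sum_equiv (Equiv.mulLeft (Equiv.addLeft v)) ?_ ?_).symm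
    · intro σ; simp
    · intro σ _; exact (ht v σ).symm
  rw [← Finset.sum_fiberwise Finset.univ (fun σ : Equiv.Perm (Fin (n + 1)) => σ (Fin.last n)) t,
    Finset.sum_congr rfl fun v _ => h v]
  simp

theorem card_perm_last_eq_zero :
    (Finset.univ.filter fun σ : Equiv.Perm (Fin (n + 1)) => σ (Fin.last n) = 0).card =
      n.factorial := by
  have h := sum_perm_eq_mul (n := n) (fun _ => 1) (fun _ _ => rfl)
  simp only [Finset.sum_const, Finset.card_univ, Fintype.card_perm, Fintype.card_fin,
    nsmul_eq_mul, mul_one, Nat.factorial_succ] at h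
  exact (Nat.eq_of_mul_eq_mul_left n.succ_pos (by exact_mod_cast h)).symm

/-- The facet of the chessboard complex given by a permutation, with vertices `v`. -/
def chessFacet {Y : Type*} (v : Fin (n + 1) → Fin (n + 1) → Y) (σ : Equiv.Perm (Fin (n + 1))) :
    List Y :=
  List.ofFn fun i : Fin n => v (σ i.castSucc) i.castSucc

/-- Evaluation of a cochain on the fundamental cycle of the chessboard complex. -/
def chessCycle {Y : Type*} (v : Fin (n + 1) → Fin (n + 1) → Y) (f : List Y → ℤ) : ℤ :=
  ∑ σ : Equiv.Perm (Fin (n + 1)), (Equiv.Perm.sign σ : ℤ) * f (chessFacet v σ)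

theorem length_chessFacet {Y : Type*} (v : Fin (n + 1) → Fin (n + 1) → Y)
    (σ : Equiv.Perm (Fin (n + 1))) : (chessFacet v σ).length = n := by
  simp [chessFacet]

theorem chessCycle_sub {Y : Type*} (v : Fin (n + 1) → Fin (n + 1) → Y) (f g : List Y → ℤ) :
    chessCycle v (fun l => f l - g l) = chessCycle v f - chessCycle v g := by
  simp [chessCycle, mul_sub]

theorem chessCycle_congr {Y : Type*} (v : Fin (n + 1) → Fin (n + 1) → Y) {f g : List Y → ℤ}
    (h : ∀ l : List Y, l.length = n → f l = g l) : chessCycle v f = chessCycle v g :=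
  Finset.sum_congr rfl fun σ _ => by rw [h _ (length_chessFacet v σ)]

theorem chessCycle_listCoboundary (hn : n ≠ 0) {Y : Type*} (v : Fin (n + 1) → Fin (n + 1) → Y)
    (f : List Y → ℤ) : chessCycle v (listCoboundary f) = 0 := by
  obtain ⟨k, rfl⟩ := Nat.exists_eq_succ_of_ne_zero hn
  simp only [chessCycle, chessFacet, listCoboundary_ofFn, Finset.mul_sum]
  rw [Finset.sum_comm]
  refine Finset.sum_eq_zero fun j _ => ?_
  set τ : Equiv.Perm (Fin (k + 1 + 1)) := Equiv.swap j.castSucc (Fin.last _) with hτ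
  have hfix : ∀ i : Fin k, τ (j.succAbove i).castSucc = (j.succAbove i).castSucc := fun i =>
    Equiv.swap_apply_of_ne_of_ne (by simp [Fin.succAbove_ne]) (Fin.castSucc_ne_last _)
  have hsign : Equiv.Perm.sign τ = -1 := Equiv.Perm.sign_swap (Fin.castSucc_ne_last _)
  have h := Equiv.sum_comp (Equiv.mulRight τ) fun σ : Equiv.Perm (Fin (k + 1 + 1)) =>
    (Equiv.Perm.sign σ : ℤ) * ((-1) ^ (j : ℕ) * f (List.ofFn fun i =>
      v (σ (j.succAbove i).castSucc) (j.succAbove i).castSucc))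
  simp only [Equiv.coe_mulRight, Equiv.Perm.sign_mul, hsign, Equiv.Perm.mul_apply, hfix,
    mul_neg, mul_one, Units.val_neg, neg_mul, Finset.sum_neg_distrib] at h
  linarith

theorem dvd_chessCycle {Y : Type*} (v : Fin (n + 1) → Fin (n + 1) → Y)
    (g : Fin (n + 1) → Y → Y) (hv : ∀ a i t, v (a + i) t = g a (v i t)) {f : List Y → ℤ}
    (hf : ∀ a x, f (x.map (g a)) = (Equiv.Perm.sign (Equiv.addLeft a) : ℤ) * f x) :
    ((n + 1 : ℕ) : ℤ) ∣ chessCycle v f := by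
  refine ⟨_, sum_perm_eq_mul _ fun a σ => ?_⟩
  have : chessFacet v (Equiv.addLeft a * σ) = (chessFacet v σ).map (g a) := by
    simp [chessFacet, List.map_ofFn, hv, Function.comp_def]
  rw [this, hf, Equiv.Perm.sign_mul, Units.val_mul]
  have h1 : ((Equiv.Perm.sign (Equiv.addLeft a) : ℤˣ) : ℤ) *
      (Equiv.Perm.sign (Equiv.addLeft a) : ℤˣ) = 1 := by
    rw [← Units.val_mul, Int.units_mul_self, Units.val_one]
  linear_combination ((Equiv.Perm.sign σ : ℤˣ) : ℤ) * f (chessFacet v σ) * h1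

theorem chessCycle_labelDet :
    chessCycle (fun i _ => i) (fun l => labelDet (n + 1) (0 :: l)) =
      (Equiv.Perm.sign (finRotate (n + 1)) : ℤ) * n.factorial := by
  rw [← card_perm_last_eq_zero, Finset.card_filter, Nat.cast_sum, Finset.mul_sum, chessCycle]
  refine Finset.sum_congr rfl fun σ _ => ?_
  split_ifs with h
  · have : (0 :: chessFacet (fun i _ => i) σ) = List.ofFn (σ * (finRotate (n + 1))⁻¹) := by
      rw [List.ofFn_succ]
      have h0 : (finRotate (n + 1))⁻¹ 0 = Fin.last n := by
        rw [Equiv.Perm.inv_eq_iff_eq, finRotate_last]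
      have hs : ∀ i : Fin n, (finRotate (n + 1))⁻¹ i.succ = i.castSucc := fun i => by
        rw [Equiv.Perm.inv_eq_iff_eq, finRotate_apply]; simp
      simp only [chessFacet, Equiv.Perm.mul_apply, h0, hs, h]
    rw [this, labelDet_ofFn_perm, Equiv.Perm.sign_mul, Equiv.Perm.sign_inv, Units.val_mul,
      ← mul_assoc, ← Units.val_mul, Int.units_mul_self]
    simp
  · rw [labelDet_eq_zero_of_not_nodup, mul_zero, Nat.cast_zero, mul_zero]
    rw [List.nodup_cons, not_and_or, not_not]
    left
    have hne : σ⁻¹ 0 ≠ Fin.last n := fun h0 => h (by rw [← h0]; simp)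
    obtain ⟨i, hi⟩ := Fin.exists_castSucc_eq.mpr hne
    exact (List.mem_ofFn' _ _).mpr ⟨i, by simp [hi]⟩

end ChessboardCycle

/-- Equivariant labellings of subdivisions of `Δ_{r,r-1} * [r]` have a fully labelled facet. -/
theorem exists_labelDet_ne_zero {n : ℕ} (hn : n ≠ 0) (hdvd : ¬ n + 1 ∣ n.factorial)
    {Y : Type*} (b : List Y → Y) (g : Fin (n + 1) → Y → Y) (p q : Y → Fin (n + 1))
    (hb : ∀ a (x : List Y), x ≠ [] → b (x.map (g a)) = g a (b x))
    (hbq : ∀ x : List Y, x ≠ [] → q (b x) ∈ x.map q)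
    (hp : ∀ a y, p (g a y) = a + p y) (hq : ∀ a y, q (g a y) = a + q y)
    (v : Fin (n + 1) → Fin (n + 1) → Y) (hv : ∀ a i t, v (a + i) t = g a (v i t))
    (hqv : ∀ i t, t ≠ Fin.last n → q (v i t) = i) (apex : Y) (N : ℕ) :
    ∃ σ : Equiv.Perm (Fin (n + 1)),
      (subdivide b (n + 1))^[N] (fun l => labelDet (n + 1) (l.map p))
        (apex :: chessFacet v σ) ≠ 0 := by
  by_contra! hzero
  set F : List (Fin (n + 1)) → ℤ := fun l => labelDet (n + 1) (0 :: l)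
  have hdF : listCoboundary F = labelDet (n + 1) := funext (listCoboundary_labelDet_cons 0)
  have hcone : chessCycle v ((subdivide b n)^[N] fun l => F (l.map p)) = 0 := by
    have h : ∀ σ, (subdivide b n)^[N] (fun l => F (l.map p)) (chessFacet v σ) =
        listCoboundary (fun l => (subdivide b n)^[N] (fun l => F (l.map p)) (apex :: l))
          (chessFacet v σ) := by
      intro σ
      have h1 := iterate_subdivide_listCoboundary (n := n) b N (fun l => F (l.map p))
        (x := apex :: chessFacet v σ) (by simp [length_chessFacet])
      have h2 : listCoboundary (fun l : List Y => F (l.map p)) =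
          fun l => labelDet (n + 1) (l.map p) := by
        ext l; rw [← listCoboundary_map, hdF]
      rw [h2, hzero, listCoboundary] at h1
      linarith
    rw [← chessCycle_listCoboundary hn v]
    exact Finset.sum_congr rfl fun σ _ => by rw [h σ]
  have hstd : chessCycle v ((subdivide b n)^[N] fun l => F (l.map q)) =
      (Equiv.Perm.sign (finRotate (n + 1)) : ℤ) * n.factorial := by
    rw [← chessCycle_labelDet]
    refine Finset.sum_congr rfl fun σ _ => ?_
    rw [iterate_subdivide_label (n := n) b q hbq F
      (fun l hl => labelDet_eq_zero_of_not_nodup (by simp [hl]))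
      (fun l hl => by rw [hdF, labelDet_eq_zero_of_not_nodup hl]) N (length_chessFacet v σ)]
    congr 3
    simp [chessFacet, List.map_ofFn, Function.comp_def, hqv]
  have hprism : chessCycle v ((subdivide b n)^[N] (prism p q (labelDet (n + 1)))) =
      (Equiv.Perm.sign (finRotate (n + 1)) : ℤ) * n.factorial := by
    obtain ⟨k, rfl⟩ := Nat.exists_eq_succ_of_ne_zero hn
    have h : chessCycle v ((subdivide b (k + 1))^[N] (listCoboundary (prism p q F))) = 0 := by
      rw [← chessCycle_listCoboundary hn v]
      exact chessCycle_congr v fun l hl => iterate_subdivide_listCoboundary b N _ hl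
    have h2 : prism p q (labelDet (k + 1 + 1)) = fun l =>
        ((fun l => F (l.map q)) l - (fun l => F (l.map p)) l) -
          listCoboundary (prism p q F) l := by
      ext l
      rw [← hdF, ← prism_homotopy p q F l]; ring
    rw [h2, iterate_subdivide_sub, chessCycle_sub, h, iterate_subdivide_sub, chessCycle_sub,
      hstd, hcone]
    ring
  have hd : ((n + 1 : ℕ) : ℤ) ∣
      chessCycle v ((subdivide b n)^[N] (prism p q (labelDet (n + 1)))) := by
    refine dvd_chessCycle v g hv fun a x => ?_
    refine iterate_subdivide_map_eq_mul b (g a) (hb a) _ N (fun x => ?_) x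
    rw [prism_map p q (g a) (Equiv.addLeft a) (by simp [hp]) (by simp [hq]),
      ← prism_const_mul]
    simp only [labelDet_map_perm]
  rw [hprism] at hd
  refine hdvd (Int.natCast_dvd_natCast.mp ?_)
  rcases Int.units_eq_one_or (Equiv.Perm.sign (finRotate (n + 1))) with h | h <;>
    simpa [h] using hd

theorem norm_sum_le_of_mem {E : Type*} [SeminormedAddCommGroup E] {l : List E} {d : ℝ}
    (h : ∀ z ∈ l, ‖z‖ ≤ d) :
    ‖l.sum‖ ≤ l.length * d := by
  induction l with
  | nil => simp
  | cons a l ih =>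
    have h1 := h a (by simp)
    have h2 := ih fun z hz => h z (by simp [hz])
    have h3 := norm_add_le a l.sum
    simp only [List.sum_cons, List.length_cons, Nat.cast_add, Nat.cast_one]
    linarith

section Mesh

variable {E : Type*} [NormedAddCommGroup E] [NormedSpace ℝ E]

theorem sum_map_sub_const {α : Type*} (f : α → E) (a : E) (l : List α) :
    (l.map fun z => f z - a).sum = (l.map f).sum - (l.length : ℝ) • a := by
  induction l with
  | nil => simp
  | cons c l ih =>
    simp only [List.map_cons, List.sum_cons, ih, List.length_cons, Nat.cast_add, Nat.cast_one,
      add_smul, one_smul]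
    abel

theorem dist_average_le {Y : Type*} (pos : Y → E) {x : List Y} {d c : ℝ} (hd : 0 ≤ d)
    (hx : ∀ y ∈ x, ∀ z ∈ x, dist (pos y) (pos z) ≤ d)
    (hc : (x.length : ℝ) - 1 ≤ c * x.length) {y : Y} (hy : y ∈ x) :
    dist ((x.length : ℝ)⁻¹ • (x.map pos).sum) (pos y) ≤ c * d := by
  obtain ⟨l₁, l₂, rfl⟩ := List.append_of_mem hy
  set x := l₁ ++ y :: l₂ with hxdef
  have hlen : (0 : ℝ) < x.length := by
    rw [hxdef]; simp; positivity
  have hsum : (x.map fun z => pos z - pos y).sum =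
      ((l₁ ++ l₂).map fun z => pos z - pos y).sum := by simp [hxdef]
  have hnorm : ‖(x.map fun z => pos z - pos y).sum‖ ≤ ((x.length : ℝ) - 1) * d := by
    rw [hsum]
    refine (norm_sum_le_of_mem (d := d) ?_).trans (le_of_eq ?_)
    · intro w hw
      obtain ⟨z, hz, rfl⟩ := List.mem_map.mp hw
      rw [← dist_eq_norm]
      refine hx z ?_ y hy
      simp only [hxdef, List.mem_append, List.mem_cons] at hz ⊢
      tauto
    · simp only [hxdef, List.length_map, List.length_append, List.length_cons]; push_cast; ring
  have heq : (x.length : ℝ)⁻¹ • (x.map pos).sum - pos y =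
      (x.length : ℝ)⁻¹ • (x.map fun z => pos z - pos y).sum := by
    rw [sum_map_sub_const, smul_sub, smul_smul, inv_mul_cancel₀ hlen.ne', one_smul]
  rw [dist_eq_norm, heq, norm_smul, norm_inv, Real.norm_of_nonneg hlen.le]
  rw [inv_mul_le_iff₀ hlen]
  calc _ ≤ ((x.length : ℝ) - 1) * d := hnorm
    _ ≤ (c * x.length) * d := by gcongr
    _ = _ := by ring

theorem average_mem {Y : Type*} (pos : Y → E) {K : Set E} (hK : Convex ℝ K) {x : List Y}
    (hne : x ≠ []) (hx : ∀ y ∈ x, pos y ∈ K) :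
    (x.length : ℝ)⁻¹ • (x.map pos).sum ∈ K := by
  have hlen : (x.length : ℝ) ≠ 0 := by simpa using hne
  have h := hK.sum_mem (t := Finset.univ) (w := fun _ : Fin x.length => (x.length : ℝ)⁻¹)
    (z := fun i => pos x[i]) (fun _ _ => by positivity) (by simp [hlen])
    (fun i _ => hx _ (by simp))
  have hmap : (List.ofFn fun i : Fin x.length => pos x[i]) = x.map pos :=
    List.ext_getElem (by simp) (by simp)
  rwa [← Finset.smul_sum, ← List.sum_ofFn, hmap] at h

/-- A cochain with nonzero subdivision is nonzero on some simplex of the subdivision; such a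
simplex is a flag of barycenters, of diameter at most `c` times the original one. -/
theorem exists_of_subdivide_ne_zero {Y : Type*} (pos : Y → E) (own : Y → ℕ) (b : List Y → Y)
    (S : Set E)
    (hpos : ∀ x : List Y, x ≠ [] → (x.length : ℝ)⁻¹ • (x.map pos).sum ∈ S →
      pos (b x) = (x.length : ℝ)⁻¹ • (x.map pos).sum)
    (hown : ∀ x : List Y, own (b x) = x.length - 1) {c d : ℝ} (hc1 : c ≤ 1) (hd : 0 ≤ d)
    {n : ℕ} (hc : (n : ℝ) - 1 ≤ c * n) {K : Set E} (hK : Convex ℝ K) (hKS : K ⊆ S)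
    {f : List Y → ℤ} {x : List Y} (hxn : x.length = n) (hxK : ∀ y ∈ x, pos y ∈ K)
    (hx : ∀ y ∈ x, ∀ z ∈ x, dist (pos y) (pos z) ≤ d) (hf : subdivide b n f x ≠ 0) :
    ∃ y : List Y, f y ≠ 0 ∧ y.length = n ∧ (∀ z ∈ y, pos z ∈ K) ∧
      (∀ z ∈ y, ∀ w ∈ y, dist (pos z) (pos w) ≤ c * d) ∧
      y.map own = (List.range n).reverse := by
  induction n generalizing K f x with
  | zero =>
    obtain rfl : x = [] := List.length_eq_zero_iff.mp hxn
    exact ⟨[], hf, rfl, by simp, by simp, by simp⟩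
  | succ n ih =>
    have hne : x ≠ [] := by rintro rfl; simp at hxn
    have hmem := average_mem pos hK hne hxK
    have hb := hpos x hne (hKS hmem)
    have hdist : ∀ y ∈ x, dist (pos y) (pos (b x)) ≤ c * d := fun y hy => by
      rw [dist_comm, hb]
      exact dist_average_le pos hd hx (by rw [hxn]; exact hc) hy
    obtain ⟨x', hx', hlen, hne'⟩ := exists_of_listCoboundary_ne_zero hf
    obtain ⟨y, hfy, hyn, hyK, hy, hyo⟩ := ih (K := K ∩ Metric.closedBall (pos (b x)) (c * d))
      (by push_cast at hc; linarith) (hK.inter (convex_closedBall _ _))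
      (Set.inter_subset_left.trans hKS) (by omega)
      (fun y hy => ⟨hxK y (hx' hy), hdist y (hx' hy)⟩)
      (fun y hy z hz => hx y (hx' hy) z (hx' hz)) hne'
    have hcd : 0 ≤ c * d := by
      obtain ⟨y, hy⟩ := List.exists_mem_of_ne_nil x hne
      exact dist_nonneg.trans (hdist y hy)
    refine ⟨b x :: y, hfy, by simp [hyn], ?_, ?_, ?_⟩
    · simp only [List.forall_mem_cons]
      exact ⟨hb ▸ hmem, fun z hz => (hyK z hz).1⟩
    · simp only [List.forall_mem_cons, dist_self]
      exact ⟨⟨hcd, fun z hz => by rw [dist_comm]; exact (hyK z hz).2⟩,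
        fun z hz => ⟨(hyK z hz).2, hy z hz⟩⟩
    · simp [hyo, hown, hxn, List.range_succ]

theorem exists_of_iterate_subdivide_ne_zero {Y : Type*} (pos : Y → E) (own : Y → ℕ)
    (b : List Y → Y) (S : Set E)
    (hpos : ∀ x : List Y, x ≠ [] → (x.length : ℝ)⁻¹ • (x.map pos).sum ∈ S →
      pos (b x) = (x.length : ℝ)⁻¹ • (x.map pos).sum)
    (hown : ∀ x : List Y, own (b x) = x.length - 1) {c d : ℝ} (hc0 : 0 ≤ c) (hc1 : c ≤ 1)
    (hd : 0 ≤ d) {n : ℕ} (hc : (n : ℝ) - 1 ≤ c * n) {K : Set E} (hK : Convex ℝ K) (hKS : K ⊆ S)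
    (N : ℕ) {f : List Y → ℤ} {x : List Y} (hxn : x.length = n) (hxK : ∀ y ∈ x, pos y ∈ K)
    (hx : ∀ y ∈ x, ∀ z ∈ x, dist (pos y) (pos z) ≤ d)
    (hf : (subdivide b n)^[N + 1] f x ≠ 0) :
    ∃ y : List Y, f y ≠ 0 ∧ y.length = n ∧
      (∀ z ∈ y, ∀ w ∈ y, dist (pos z) (pos w) ≤ c ^ (N + 1) * d) ∧
      y.map own = (List.range n).reverse := by
  induction N generalizing d x with
  | zero =>
    obtain ⟨y, hy, hyn, -, hyd, hyo⟩ :=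
      exists_of_subdivide_ne_zero pos own b S hpos hown hc1 hd hc hK hKS hxn hxK hx hf
    exact ⟨y, hy, hyn, by simpa using hyd, hyo⟩
  | succ N ih =>
    rw [Function.iterate_succ_apply'] at hf
    obtain ⟨y, hy, hyn, hyK, hyd, -⟩ :=
      exists_of_subdivide_ne_zero pos own b S hpos hown hc1 hd hc hK hKS hxn hxK hx hf
    obtain ⟨z, hz, hzn, hzd, hzo⟩ := ih (mul_nonneg hc0 hd) hyn hyK hyd hy
    refine ⟨z, hz, hzn, ?_, hzo⟩
    rwa [pow_succ, mul_assoc]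

end Mesh

section Configuration

variable {r : ℕ}

theorem rowPerm_mem {M : Fin r → Fin r → ℝ} (hM : M ∈ ConfC1 r) (σ : Equiv.Perm (Fin r)) :
    rowPerm σ M ∈ ConfC1 r := by
  obtain ⟨h0, h1, h2, h3⟩ := hM
  refine ⟨fun b t => h0 _ t, ?_, fun t b b' hb hb' => σ⁻¹.injective (h2 t _ _ hb hb'),
    fun b t t' => h3 _ t t'⟩
  rw [← h1]
  exact Equiv.sum_comp σ⁻¹ fun b => ∑ t, M b t

theorem rowPerm_mul (σ τ : Equiv.Perm (Fin r)) (M : Fin r → Fin r → ℝ) :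
    rowPerm (σ * τ) M = rowPerm σ (rowPerm τ M) := by
  ext b t; simp [rowPerm]

theorem rowPerm_mem_iff {M : Fin r → Fin r → ℝ} (σ : Equiv.Perm (Fin r)) :
    rowPerm σ M ∈ ConfC1 r ↔ M ∈ ConfC1 r := by
  refine ⟨fun h => ?_, fun h => rowPerm_mem h σ⟩
  have := rowPerm_mem h σ⁻¹
  rwa [← rowPerm_mul, inv_mul_cancel] at this

theorem le_one_of_mem_confC1 {M : Fin r → Fin r → ℝ} (hM : M ∈ ConfC1 r) (b t : Fin r) :
    M b t ≤ 1 := by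
  obtain ⟨h0, h1, -, -⟩ := hM
  rw [← h1]
  calc M b t ≤ ∑ t, M b t :=
        Finset.single_le_sum (f := M b) (fun t _ => h0 b t) (Finset.mem_univ t)
    _ ≤ _ := Finset.single_le_sum (f := fun b => ∑ t, M b t)
        (fun b _ => Finset.sum_nonneg fun t _ => h0 b t) (Finset.mem_univ b)

theorem isCompact_confC1 (r : ℕ) : IsCompact (ConfC1 r) := by
  refine (isCompact_Icc (a := (0 : Fin r → Fin r → ℝ)) (b := 1)).of_isClosed_subset ?_ ?_
  · have h : ConfC1 r = {M | (∀ b t, 0 ≤ M b t) ∧ (∑ b, ∑ t, M b t) = 1 ∧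
        (∀ t b b', b ≠ b' → M b t * M b' t = 0) ∧
        (∀ (b : Fin r) (t t' : Fin r), (t : ℕ) + 1 < r → (t' : ℕ) + 1 < r → t ≠ t' →
          M b t * M b t' = 0)} := by
      ext M
      simp only [ConfC1, Set.mem_ofPred_eq, mul_eq_zero]
      refine and_congr_right fun _ => and_congr_right fun _ => and_congr ?_ ?_
      · exact forall₃_congr fun _ _ _ => by tauto
      · exact forall₅_congr fun _ _ _ _ _ => by tauto
    rw [h]
    simp only [Set.ofPred_and, Set.ofPred_forall]
    refine ((isClosed_iInter fun b => isClosed_iInter fun t => ?_).inter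
      (IsClosed.inter ?_ (IsClosed.inter ?_ ?_)))
    · exact isClosed_le (by fun_prop) (by fun_prop)
    · exact isClosed_eq (by fun_prop) (by fun_prop)
    · exact isClosed_iInter fun t => isClosed_iInter fun b => isClosed_iInter fun b' =>
        isClosed_iInter fun _ => isClosed_eq (by fun_prop) (by fun_prop)
    · exact isClosed_iInter fun t => isClosed_iInter fun b => isClosed_iInter fun b' =>
        isClosed_iInter fun _ => isClosed_iInter fun _ => isClosed_iInter fun _ =>
        isClosed_eq (by fun_prop) (by fun_prop)
  · intro M hM
    exact ⟨hM.1, le_one_of_mem_confC1 hM⟩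

theorem dist_le_one_of_mem_confC1 {M M' : Fin r → Fin r → ℝ} (hM : M ∈ ConfC1 r)
    (hM' : M' ∈ ConfC1 r) : dist M M' ≤ 1 := by
  refine (dist_pi_le_iff zero_le_one).mpr fun b => (dist_pi_le_iff zero_le_one).mpr fun t => ?_
  exact Real.dist_le_of_mem_Icc_01 ⟨hM.1 b t, le_one_of_mem_confC1 hM b t⟩
    ⟨hM'.1 b t, le_one_of_mem_confC1 hM' b t⟩

/-- Box `b` contains the first non-degenerate tile of `M`. -/
def IsFirstBox (M : Fin r → Fin r → ℝ) (b : Fin r) : Prop :=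
  ∃ t, M b t ≠ 0 ∧ ∀ t' < t, ∀ b', M b' t' = 0

theorem exists_isFirstBox {M : Fin r → Fin r → ℝ} (hM : M ∈ ConfC1 r) :
    ∃ b, IsFirstBox M b := by
  have hex : ∃ t b, M b t ≠ 0 := by
    by_contra! h
    have := hM.2.1
    simp [h] at this
  obtain ⟨t, ⟨b, hb⟩, hmin⟩ := WellFounded.has_min (wellFounded_lt (α := Fin r))
    {t | ∃ b, M b t ≠ 0} hex
  refine ⟨b, t, hb, fun t' ht' b' => ?_⟩
  by_contra h
  exact hmin t' ⟨b', h⟩ ht'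

theorem IsFirstBox.unique {M : Fin r → Fin r → ℝ} (hM : M ∈ ConfC1 r) {b b' : Fin r}
    (h : IsFirstBox M b) (h' : IsFirstBox M b') : b = b' := by
  obtain ⟨t, ht, hlt⟩ := h
  obtain ⟨t', ht', hlt'⟩ := h'
  obtain rfl : t = t' := by
    rcases lt_trichotomy t t' with h | h | h
    · exact absurd (hlt' t h b) ht
    · exact h
    · exact absurd (hlt t' h b') ht'
  exact hM.2.2.1 t b b' ht ht'

theorem IsFirstBox.rowPerm {M : Fin r → Fin r → ℝ} {b : Fin r} (h : IsFirstBox M b)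
    (σ : Equiv.Perm (Fin r)) : IsFirstBox (rowPerm σ M) (σ b) := by
  obtain ⟨t, ht, hlt⟩ := h
  exact ⟨t, by simpa [_root_.rowPerm] using ht, fun t' ht' b' => hlt t' ht' _⟩

/-- The box containing the first non-degenerate tile. -/
noncomputable def firstBox (M : ConfC1 r) : Fin r :=
  (exists_isFirstBox M.2).choose

theorem isFirstBox_firstBox (M : ConfC1 r) : IsFirstBox M.1 (firstBox M) :=
  (exists_isFirstBox M.2).choose_spec

theorem firstBox_eq {M : ConfC1 r} {b : Fin r} (h : IsFirstBox M.1 b) : firstBox M = b :=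
  (isFirstBox_firstBox M).unique M.2 h

/-- The action of box permutations on the configuration space. -/
def confPerm (σ : Equiv.Perm (Fin r)) (M : ConfC1 r) : ConfC1 r :=
  ⟨rowPerm σ M.1, rowPerm_mem M.2 σ⟩

theorem firstBox_confPerm (σ : Equiv.Perm (Fin r)) (M : ConfC1 r) :
    firstBox (confPerm σ M) = σ (firstBox M) :=
  firstBox_eq ((isFirstBox_firstBox M).rowPerm σ)

theorem confPerm_mul (σ τ : Equiv.Perm (Fin r)) (M : ConfC1 r) :
    confPerm (σ * τ) M = confPerm σ (confPerm τ M) :=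
  Subtype.ext (rowPerm_mul σ τ M.1)

/-- The arithmetic mean of a list of configurations, as a matrix. -/
noncomputable def confAverage (x : List (ConfC1 r × ℕ)) : Fin r → Fin r → ℝ :=
  (x.length : ℝ)⁻¹ • (x.map fun y => y.1.1).sum

theorem confAverage_apply (x : List (ConfC1 r × ℕ)) (b t : Fin r) :
    confAverage x b t = (x.length : ℝ)⁻¹ * (x.map fun y => y.1.1 b t).sum := by
  have : (x.map fun y => y.1.1).sum b t = (x.map fun y => y.1.1 b t).sum := by
    induction x with
    | nil => rfl
    | cons a x ih => simp [ih]
  simp [confAverage, this]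

theorem confAverage_eq_zero_iff {x : List (ConfC1 r × ℕ)} (hx : x ≠ []) (b t : Fin r) :
    confAverage x b t = 0 ↔ ∀ y ∈ x, y.1.1 b t = 0 := by
  have hlen : (x.length : ℝ) ≠ 0 := by simpa using hx
  rw [confAverage_apply, mul_eq_zero, or_iff_right (inv_ne_zero hlen)]
  clear hlen hx
  induction x with
  | nil => simp
  | cons a x ih =>
    have h0 : 0 ≤ (x.map fun y => y.1.1 b t).sum :=
      List.sum_nonneg fun z hz => by
        obtain ⟨y, -, rfl⟩ := List.mem_map.mp hz
        exact y.1.2.1 b t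
    rw [List.map_cons, List.sum_cons, add_eq_zero_iff_of_nonneg (a.1.2.1 b t) h0,
      List.forall_mem_cons]
    exact and_congr_right fun _ => ih

open Classical in
/-- The barycenter of a list of configurations when it is a configuration (and the first
element of the list otherwise), together with the dimension of the simplex. -/
noncomputable def confBary (y₀ : ConfC1 r × ℕ) (x : List (ConfC1 r × ℕ)) : ConfC1 r × ℕ :=
  (if h : confAverage x ∈ ConfC1 r then ⟨confAverage x, h⟩ else (x.headD y₀).1, x.length - 1)

theorem confBary_fst {y₀ : ConfC1 r × ℕ} {x : List (ConfC1 r × ℕ)}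
    (h : confAverage x ∈ ConfC1 r) : (confBary y₀ x).1.1 = confAverage x := by
  simp [confBary, h]

theorem confAverage_map (σ : Equiv.Perm (Fin r)) (x : List (ConfC1 r × ℕ)) :
    confAverage (x.map fun y => (confPerm σ y.1, y.2)) = rowPerm σ (confAverage x) := by
  ext b t
  simp only [rowPerm, confAverage_apply, List.length_map, List.map_map]
  rfl

theorem confBary_map (y₀ : ConfC1 r × ℕ) (σ : Equiv.Perm (Fin r)) {x : List (ConfC1 r × ℕ)}
    (hx : x ≠ []) : confBary y₀ (x.map fun y => (confPerm σ y.1, y.2)) =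
      (confPerm σ (confBary y₀ x).1, (confBary y₀ x).2) := by
  have hm := confAverage_map σ x
  refine Prod.ext (Subtype.ext ?_) (by simp [confBary])
  by_cases h : confAverage x ∈ ConfC1 r
  · rw [confBary_fst (hm ▸ rowPerm_mem h σ), hm]
    exact congrArg (rowPerm σ) (confBary_fst h).symm
  · have h' : confAverage (x.map fun y => (confPerm σ y.1, y.2)) ∉ ConfC1 r := by
      rwa [hm, rowPerm_mem_iff]
    rw [confBary, confBary, dif_neg h', dif_neg h]
    obtain ⟨a, l, rfl⟩ := List.exists_cons_of_ne_nil hx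
    rfl

theorem firstBox_confBary_mem (y₀ : ConfC1 r × ℕ) {x : List (ConfC1 r × ℕ)} (hx : x ≠ []) :
    firstBox (confBary y₀ x).1 ∈ x.map fun y => firstBox y.1 := by
  rw [List.mem_map]
  by_cases h : confAverage x ∈ ConfC1 r
  · obtain ⟨t, ht, hlt⟩ := isFirstBox_firstBox (confBary y₀ x).1
    rw [confBary_fst h] at ht hlt
    have hex : ∃ y ∈ x, y.1.1 (firstBox (confBary y₀ x).1) t ≠ 0 := by
      by_contra! hc
      exact ht ((confAverage_eq_zero_iff hx _ _).mpr hc)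
    obtain ⟨y, hy, hyt⟩ := hex
    exact ⟨y, hy, firstBox_eq ⟨t, hyt, fun t' ht' b' =>
      (confAverage_eq_zero_iff hx _ _).mp (hlt t' ht' b') y hy⟩⟩
  · obtain ⟨a, l, rfl⟩ := List.exists_cons_of_ne_nil hx
    exact ⟨a, by simp, by simp [confBary, h]⟩

/-- The configuration whose whole cake is the tile `t`, placed into the box `b`. -/
def confVertex (b t : Fin r) : ConfC1 r :=
  ⟨fun b' t' => if b' = b ∧ t' = t then 1 else 0, by
    refine ⟨fun b' t' => by positivity, ?_, ?_, ?_⟩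
    · simp [ite_and]
    · intro s c c' h h'
      simp only [ne_eq, ite_eq_right_iff, one_ne_zero, imp_false, not_not] at h h'
      rw [h.1, h'.1]
    · intro s c c' _ _ h h'
      simp only [ne_eq, ite_eq_right_iff, one_ne_zero, imp_false, not_not] at h h'
      rw [h.2, h'.2]⟩

theorem confPerm_confVertex (σ : Equiv.Perm (Fin r)) (b t : Fin r) :
    confPerm σ (confVertex b t) = confVertex (σ b) t := by
  ext b' t'
  simp [confPerm, rowPerm, confVertex, Equiv.symm_apply_eq]

theorem firstBox_confVertex (b t : Fin r) : firstBox (confVertex b t) = b :=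
  firstBox_eq ⟨t, by simp [confVertex], fun t' ht' b' => by simp [confVertex, ht'.ne]⟩

/-- The configurations placing each non-degenerate tile `t` into the box `ρ t`. -/
def confFacet (ρ : Fin r → Fin r) : Set (Fin r → Fin r → ℝ) :=
  {M | (∀ b t, 0 ≤ M b t) ∧ (∑ b, ∑ t, M b t) = 1 ∧ ∀ b t, b ≠ ρ t → M b t = 0}

theorem convex_confFacet (ρ : Fin r → Fin r) : Convex ℝ (confFacet ρ) := by
  rintro M ⟨h0, h1, h2⟩ M' ⟨h0', h1', h2'⟩ a c ha hc hac
  refine ⟨fun b t => ?_, ?_, fun b t hb => ?_⟩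
  · have := h0 b t
    have := h0' b t
    simp only [Pi.add_apply, Pi.smul_apply, smul_eq_mul]
    positivity
  · simp only [Pi.add_apply, Pi.smul_apply, smul_eq_mul, Finset.sum_add_distrib,
      ← Finset.mul_sum, h1, h1', mul_one, hac]
  · simp [h2 b t hb, h2' b t hb]

theorem confFacet_subset {ρ : Fin r → Fin r}
    (hρ : ∀ t t' : Fin r, (t : ℕ) + 1 < r → (t' : ℕ) + 1 < r → ρ t = ρ t' → t = t') :
    confFacet ρ ⊆ ConfC1 r := by
  rintro M ⟨h0, h1, h2⟩
  have h : ∀ {b t}, M b t ≠ 0 → b = ρ t := fun hb => by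
    by_contra hne
    exact hb (h2 _ _ hne)
  exact ⟨h0, h1, fun t b b' hb hb' => (h hb).trans (h hb').symm,
    fun b t t' ht ht' hb hb' => hρ t t' ht ht' ((h hb).symm.trans (h hb'))⟩

theorem confVertex_mem_confFacet {ρ : Fin r → Fin r} {b t : Fin r} (h : ρ t = b) :
    (confVertex b t).1 ∈ confFacet ρ := by
  refine ⟨(confVertex b t).2.1, (confVertex b t).2.2.1, fun b' t' hne => ?_⟩
  simp only [confVertex, ite_eq_right_iff, one_ne_zero, imp_false, not_and]
  rintro rfl rfl
  exact hne h.symm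

end Configuration

/-- For every cyclically equivariant labelling rule of the players there are arbitrarily close
configurations, one for each player, at which the players choose pairwise distinct boxes. -/
theorem exists_close_configurations {n : ℕ} (hn : n ≠ 0) (hdvd : ¬ n + 1 ∣ n.factorial)
    (p : ConfC1 (n + 1) × ℕ → Fin (n + 1))
    (hp : ∀ a y, p (confPerm (Equiv.addLeft a) y.1, y.2) = a + p y) {ε : ℝ} (hε : 0 < ε) :
    ∃ (τ : Equiv.Perm (Fin (n + 1))) (M : Fin (n + 1) → ConfC1 (n + 1)),
      (∀ j, p (M j, j) = τ j) ∧ ∀ i j, dist (M i) (M j) < ε := by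
  set c : ℝ := 1 - 1 / ((n + 1 : ℕ) : ℝ) with hcdef
  have hpos : (0 : ℝ) < ((n + 1 : ℕ) : ℝ) := by positivity
  have hinv : 1 / ((n + 1 : ℕ) : ℝ) ≤ 1 := by
    rw [div_le_one hpos]; exact_mod_cast Nat.succ_pos n
  have hc0 : 0 ≤ c := by linarith
  have hc1 : c < 1 := by have := one_div_pos.mpr hpos; linarith
  obtain ⟨N, hN⟩ := exists_pow_lt_of_lt_one hε hc1
  set apex : ConfC1 (n + 1) × ℕ := (confVertex 0 (Fin.last n), 0)
  set v : Fin (n + 1) → Fin (n + 1) → ConfC1 (n + 1) × ℕ := fun i t => (confVertex i t, 0)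
    with hv
  obtain ⟨σ, hσ⟩ := exists_labelDet_ne_zero hn hdvd (confBary apex)
    (fun a y => (confPerm (Equiv.addLeft a) y.1, y.2)) p (fun y => firstBox y.1)
    (fun a x hx => confBary_map apex _ hx) (fun x hx => firstBox_confBary_mem apex hx) hp
    (fun a y => firstBox_confPerm _ _) v
    (fun a i t => by simp [hv, confPerm_confVertex])
    (fun i t _ => firstBox_confVertex i t) apex (N + 1)
  set ρ : Fin (n + 1) → Fin (n + 1) := fun t => if t = Fin.last n then 0 else σ t with hρ
  have hρinj : ∀ t t' : Fin (n + 1), (t : ℕ) + 1 < n + 1 → (t' : ℕ) + 1 < n + 1 →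
      ρ t = ρ t' → t = t' := by
    intro t t' ht ht' h
    have h1 : t ≠ Fin.last n := by rintro rfl; simp at ht
    have h2 : t' ≠ Fin.last n := by rintro rfl; simp at ht'
    simpa [hρ, h1, h2] using h
  obtain ⟨y, hy, hylen, hyd, hyo⟩ := exists_of_iterate_subdivide_ne_zero
    (fun y : ConfC1 (n + 1) × ℕ => y.1.1) (fun y => y.2) (confBary apex) (ConfC1 (n + 1))
    (fun x _ hx => confBary_fst hx) (fun x => rfl) hc0 hc1.le zero_le_one
    (n := n + 1) (by rw [hcdef, sub_mul, one_div, inv_mul_cancel₀ hpos.ne', one_mul])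
    (convex_confFacet ρ) (confFacet_subset hρinj) N
    (by simp [length_chessFacet])
    (by
      simp only [List.forall_mem_cons]
      refine ⟨confVertex_mem_confFacet (by simp [hρ]), fun z hz => ?_⟩
      obtain ⟨i, rfl⟩ := (List.mem_ofFn' _ _).mp hz
      exact confVertex_mem_confFacet (by simp [hρ]))
    (fun z _ w _ => dist_le_one_of_mem_confC1 z.1.2 w.1.2) hσ
  obtain ⟨x, rfl⟩ := exists_ofFn_eq hylen
  have hown : ∀ j : Fin (n + 1), (x j.rev).2 = j := fun j => by
    rw [List.map_ofFn] at hyo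
    have h := List.getElem_of_eq hyo (i := j.rev) (by simp only [List.length_ofFn, Fin.is_lt])
    rw [List.getElem_ofFn, List.getElem_reverse, List.getElem_range, List.length_range] at h
    change (x j.rev).2 = n + 1 - 1 - (j.rev : ℕ) at h
    rw [h, Fin.val_rev]
    omega
  have hinj : Function.Injective fun j : Fin (n + 1) => p (x j.rev) := by
    have h : (List.ofFn (p ∘ x)).Nodup := by
      by_contra h
      rw [← List.map_ofFn] at h
      exact hy (labelDet_eq_zero_of_not_nodup h)
    exact (List.nodup_ofFn.mp h).comp Fin.rev_injective
  refine ⟨Equiv.ofBijective _ (Finite.injective_iff_bijective.mp hinj), fun j => (x j.rev).1,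
    fun j => ?_, fun i j => ?_⟩
  · rw [Equiv.ofBijective_apply, ← hown j]
  · refine lt_of_le_of_lt (hyd _ ((List.mem_ofFn' _ _).mpr ⟨_, rfl⟩) _
      ((List.mem_ofFn' _ _).mpr ⟨_, rfl⟩)) ?_
    rw [mul_one, pow_succ]
    exact lt_of_le_of_lt (mul_le_of_le_one_right (pow_nonneg hc0 N) hc1.le) hN

/-- Closed sets of a compact space containing arbitrarily close points have a common point. -/
theorem exists_pos_of_iInter_eq_empty {X ι : Type*} [PseudoMetricSpace X] [CompactSpace X]
    [Nonempty ι] {C : ι → Set X} (hC : ∀ j, IsClosed (C j)) (hempty : ⋂ j, C j = ∅) :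
    ∃ δ > 0, ∀ M : ι → X, (∀ j, M j ∈ C j) → ¬ ∀ i j, dist (M i) (M j) < δ := by
  obtain ⟨δ, hδ, h⟩ := lebesgue_number_lemma_of_metric (isCompact_univ (X := X))
    (fun j => (hC j).isOpen_compl) (by rw [← Set.compl_iInter, hempty, Set.compl_empty])
  refine ⟨δ, hδ, fun M hM hd => ?_⟩
  obtain ⟨j, hj⟩ := h (M (Classical.arbitrary ι)) (Set.mem_univ _)
  exact hj (Metric.mem_ball.mpr (hd j _)) (hM j)

theorem not_dvd_factorial_of_prime_or_four {n : ℕ} (hr : (n + 1).Prime ∨ n + 1 = 4) :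
    ¬ n + 1 ∣ n.factorial := by
  rcases hr with h | h
  · rw [h.dvd_factorial]; omega
  · obtain rfl : n = 3 := by omega
    decide

/-- The "right gorbushka" theorem: for `r` prime or `r = 4`, closed covering
equivariant new-style preferences on `C₁` admit an envy-free division. -/
theorem right_gorbushka (r : ℕ) (hr : r.Prime ∨ r = 4)
    (B : Fin r → Fin r → Set (Fin r → Fin r → ℝ))
    (hsub : ∀ i j, B i j ⊆ ConfC1 r)
    (hclosed : ∀ i j, IsClosed {x : ConfC1 r | (x : Fin r → Fin r → ℝ) ∈ B i j})
    (hcov : ∀ j, ∀ M ∈ ConfC1 r, ∃ i, M ∈ B i j)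
    (hequi : ∀ (σ : Equiv.Perm (Fin r)) (i j : Fin r), ∀ M ∈ ConfC1 r,
      (M ∈ B i j ↔ rowPerm σ M ∈ B (σ i) j)) :
    (⋂ i, B i i).Nonempty := by
  obtain ⟨n, rfl⟩ : ∃ n, r = n + 1 :=
    Nat.exists_eq_succ_of_ne_zero (hr.elim Nat.Prime.ne_zero (by omega))
  have hn : n ≠ 0 := by
    rintro rfl
    exact hr.elim Nat.not_prime_one (by omega)
  have : CompactSpace (ConfC1 (n + 1)) :=
    isCompact_iff_compactSpace.mp (isCompact_confC1 (n + 1))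
  choose ch hch using fun (j : Fin (n + 1)) (M : ConfC1 (n + 1)) => hcov j M.1 M.2
  set p : ConfC1 (n + 1) × ℕ → Fin (n + 1) := fun y => firstBox y.1 +
    ch (Fin.ofNat (n + 1) y.2) (confPerm (Equiv.addLeft (-firstBox y.1)) y.1) with hp
  have hmem : ∀ M : ConfC1 (n + 1), ∀ j : Fin (n + 1), M.1 ∈ B (p (M, j)) j := by
    intro M j
    set N := confPerm (Equiv.addLeft (-firstBox M)) M with hN
    have hM : rowPerm (Equiv.addLeft (firstBox M)) N.1 = M.1 := by
      rw [hN, confPerm, ← rowPerm_mul]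
      ext b t
      simp [rowPerm]
    have h := (hequi (Equiv.addLeft (firstBox M)) _ j N.1 N.2).mp (hch j N)
    rw [hM] at h
    simpa [hp] using h
  have hpeq : ∀ a y, p (confPerm (Equiv.addLeft a) y.1, y.2) = a + p y := by
    intro a y
    have hmul : Equiv.addLeft (-(a + firstBox y.1)) * Equiv.addLeft a =
        Equiv.addLeft (-firstBox y.1) := by
      ext b : 1
      simp
    simp only [hp, firstBox_confPerm, Equiv.coe_addLeft, ← confPerm_mul, hmul, add_assoc]
  by_contra hempty
  have hτ : ∀ τ : Equiv.Perm (Fin (n + 1)),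
      ⋂ j, {M : ConfC1 (n + 1) | M.1 ∈ B (τ j) j} = ∅ := by
    intro τ
    by_contra hne
    obtain ⟨M, hM⟩ := Set.nonempty_iff_ne_empty.mpr hne
    refine hempty ⟨rowPerm τ⁻¹ M.1, Set.mem_iInter.mpr fun j => ?_⟩
    simpa using (hequi τ⁻¹ _ j M.1 M.2).mp (Set.mem_iInter.mp hM j)
  choose δ hδ hfar using fun τ : Equiv.Perm (Fin (n + 1)) =>
    exists_pos_of_iInter_eq_empty (fun j => hclosed (τ j) j) (hτ τ)
  obtain ⟨τ₀, hτ₀⟩ := Finite.exists_min δ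
  obtain ⟨τ, M, hpM, hclose⟩ := exists_close_configurations hn
    (not_dvd_factorial_of_prime_or_four hr) p hpeq (hδ τ₀)
  refine hfar τ M (fun j => ?_) fun i j => (hclose i j).trans_le (hτ₀ τ)
  have h := hmem (M j) j
  rwa [hpM] at h
end
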